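/- arXiv:math/0410275 — 2 statements merged into one kernel-verified Lean document; each statement's English description precedes it below -/
import Mathlib

section
/- For every n ≥ 2, the Artin group A of type B n admits a left-invariant linear order < such that for all x ∈ A, x > 1 if and only if rev x > 1. -/
/-- The alternating word `w k (a, b) = a b a b ⋯` (`k` factors) in the free group on `B`. -/
def artinWord {B : Type*} : ℕ → B → B → FreeGroup B
  | 0, _, _ => 1
  | (k + 1), a, b => FreeGroup.of a * artinWord k b a

/-- The Artin relators of a Coxeter matrix `m` : the relators
`w (m i j) (sᵢ, sⱼ) * (w (m i j) (sⱼ, sᵢ))⁻¹` for `i ≠ j` with `m i j ≠ 0`. -/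
def artinRels {B : Type*} (m : B → B → ℕ) : Set (FreeGroup B) :=
  { r | ∃ i j : B, i ≠ j ∧ m i j ≠ 0 ∧
      r = artinWord (m i j) i j * (artinWord (m i j) j i)⁻¹ }

/-- The Artin group of a Coxeter matrix `m`, as a presented group. -/
def ArtinGroup {B : Type*} (m : B → B → ℕ) : Type _ := PresentedGroup (artinRels m)

instance {B : Type*} (m : B → B → ℕ) : Group (ArtinGroup m) :=
  QuotientGroup.Quotient.group _

/-- The Artin generator `s i` of the Artin group. -/
def artinGen {B : Type*} (m : B → B → ℕ) (i : B) : ArtinGroup m := PresentedGroup.of i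

/-- The Coxeter matrix of type `Bₙ` (indices `0, …, n-1` correspond to `s 1, …, s n`):
`m i (i+1) = 3` for the first `n-2` consecutive pairs, `m (n-1) n = 4` for the last pair,
and `m i j = 2` whenever `|i - j| ≥ 2`. -/
def BTypeMatrix (n : ℕ) : Fin n → Fin n → ℕ := fun i j =>
  if i = j then 1
  else if ((i : ℕ) + 1 = (j : ℕ) ∧ (j : ℕ) = n - 1) ∨
          ((j : ℕ) + 1 = (i : ℕ) ∧ (i : ℕ) = n - 1) then 4
  else if (i : ℕ) + 1 = (j : ℕ) ∨ (j : ℕ) + 1 = (i : ℕ) then 3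
  else 2

/-- The alternating product `a b a b ⋯` with `k` factors in a monoid. -/
def altProd {G : Type*} [Monoid G] : ℕ → G → G → G
  | 0, _, _ => 1
  | (k + 1), a, b => a * altProd k b a

theorem lift_artinWord {B G : Type*} [Group G] (f : B → G) (k : ℕ) (i j : B) :
    FreeGroup.lift f (artinWord k i j) = altProd k (f i) (f j) := by
  induction k generalizing i j with
  | zero => simp [artinWord, altProd]
  | succ k ih => simp [artinWord, altProd, ih]

namespace ArtinGroup

variable {B G : Type*} [Group G] {m : B → B → ℕ}

/-- The homomorphism out of an Artin group determined by images of the generators which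
satisfy the Artin relations. -/
def lift (f : B → G) (h : ∀ i j, i ≠ j → m i j ≠ 0 →
    altProd (m i j) (f i) (f j) = altProd (m i j) (f j) (f i)) : ArtinGroup m →* G :=
  PresentedGroup.toGroup (f := f) (by
    rintro r ⟨i, j, hij, h0, rfl⟩
    rw [map_mul, map_inv, lift_artinWord, lift_artinWord, h i j hij h0, mul_inv_cancel])

@[simp]
theorem lift_artinGen (f : B → G) (h) (i : B) :
    lift (m := m) f h (artinGen m i) = f i :=
  PresentedGroup.toGroup.of _

theorem altProd_artinGen (m : B → B → ℕ) {i j : B} (hij : i ≠ j) (h0 : m i j ≠ 0) :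
    altProd (m i j) (artinGen m i) (artinGen m j) =
      altProd (m i j) (artinGen m j) (artinGen m i) := by
  have h := PresentedGroup.one_of_mem (rels := artinRels m) ⟨i, j, hij, h0, rfl⟩
  have key (w : FreeGroup B) : PresentedGroup.mk (artinRels m) w =
      FreeGroup.lift (fun i => (PresentedGroup.of i : PresentedGroup (artinRels m))) w := by
    rw [show PresentedGroup.mk (artinRels m) = FreeGroup.lift _ from
      (FreeGroup.lift.apply_symm_apply _).symm]
    rfl
  rw [map_mul, map_inv, mul_inv_eq_one, key, key, lift_artinWord, lift_artinWord] at h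
  exact h

theorem hom_ext {f g : ArtinGroup m →* G}
    (h : ∀ i, f (artinGen m i) = g (artinGen m i)) : f = g :=
  PresentedGroup.ext h

theorem closure_range_artinGen (m : B → B → ℕ) :
    Subgroup.closure (Set.range (artinGen m)) = ⊤ :=
  PresentedGroup.closure_range_of _

end ArtinGroup

/-- The Coxeter matrix of the braid group on infinitely many strands. -/
def braidMatrix (i j : ℕ) : ℕ := if i + 1 = j ∨ j + 1 = i then 3 else 2

/-- The parabolic braid group with generators indexed by a set `S` of natural numbers. -/
abbrev BraidGroup (S : Set ℕ) : Type := ArtinGroup (fun i j : S => braidMatrix i j)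

/-- The elements `s i`, for `i ∈ S`, satisfy the braid relations. -/
structure IsBraidSeq {G : Type*} [Group G] (S : Set ℕ) (s : ℕ → G) : Prop where
  comm : ∀ i j, i ∈ S → j ∈ S → i + 1 < j → s i * s j = s j * s i
  braid : ∀ i, i ∈ S → i + 1 ∈ S → s i * s (i + 1) * s i = s (i + 1) * s i * s (i + 1)

theorem IsBraidSeq.mono {G : Type*} [Group G] {S T : Set ℕ} {s : ℕ → G} (h : IsBraidSeq T s)
    (hST : S ⊆ T) : IsBraidSeq S s :=
  ⟨fun i j hi hj => h.comm i j (hST hi) (hST hj), fun i hi hj => h.braid i (hST hi) (hST hj)⟩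

namespace BraidGroup

variable {G : Type*} [Group G] {S : Set ℕ} {s : ℕ → G}

open Classical in
/-- The standard generators of `BraidGroup S`, extended by `1` outside of `S`. -/
noncomputable def gen (S : Set ℕ) (i : ℕ) : BraidGroup S :=
  if h : i ∈ S then artinGen _ ⟨i, h⟩ else 1

theorem gen_of_mem {i : ℕ} (h : i ∈ S) : gen S i = artinGen _ ⟨i, h⟩ := dif_pos h

theorem gen_of_notMem {i : ℕ} (h : i ∉ S) : gen S i = 1 := dif_neg h

theorem isBraidSeq_gen (S : Set ℕ) : IsBraidSeq S (gen S) where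
  comm i j hi hj hij := by
    have h := ArtinGroup.altProd_artinGen (fun i j : S => braidMatrix i j)
      (i := ⟨i, hi⟩) (j := ⟨j, hj⟩) (by simp; omega) (by simp [braidMatrix]; split_ifs <;> simp)
    have h2 : braidMatrix i j = 2 := by unfold braidMatrix; split_ifs <;> omega
    simpa [h2, altProd, gen_of_mem hi, gen_of_mem hj] using h
  braid i hi hj := by
    have h := ArtinGroup.altProd_artinGen (fun i j : S => braidMatrix i j)
      (i := ⟨i, hi⟩) (j := ⟨i + 1, hj⟩) (by simp) (by simp [braidMatrix])
    have h3 : braidMatrix i (i + 1) = 3 := by simp [braidMatrix]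
    simpa [h3, altProd, gen_of_mem hi, gen_of_mem hj, mul_assoc] using h

/-- The homomorphism out of a braid group determined by elements satisfying the braid
relations. -/
def lift (s : ℕ → G) (h : IsBraidSeq S s) : BraidGroup S →* G :=
  ArtinGroup.lift (fun i => s i) (by
    rintro ⟨i, hi⟩ ⟨j, hj⟩ hij -
    have hij' : i ≠ j := fun h => hij (Subtype.ext h)
    simp only [braidMatrix]
    split_ifs with h1
    · rcases h1 with rfl | rfl
      · simpa [altProd, mul_assoc] using h.braid i hi hj
      · simpa [altProd, mul_assoc] using (h.braid j hj hi).symm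
    · rcases lt_or_gt_of_ne hij' with h2 | h2
      · simpa [altProd] using h.comm i j hi hj (by omega)
      · simpa [altProd] using (h.comm j i hj hi (by omega)).symm)

theorem lift_gen (h : IsBraidSeq S s) {i : ℕ} (hi : i ∈ S) : lift s h (gen S i) = s i := by
  rw [gen_of_mem hi]; exact ArtinGroup.lift_artinGen _ _ _

theorem hom_ext {f g : BraidGroup S →* G}
    (h : ∀ i ∈ S, f (gen S i) = g (gen S i)) : f = g :=
  ArtinGroup.hom_ext fun i => by simpa [gen_of_mem i.2] using h i i.2

theorem closure_gen (S : Set ℕ) : Subgroup.closure (gen S '' S) = ⊤ := by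
  rw [← ArtinGroup.closure_range_artinGen]
  congr 1
  ext x
  constructor
  · rintro ⟨i, hi, rfl⟩
    exact ⟨⟨i, hi⟩, (gen_of_mem hi).symm⟩
  · rintro ⟨i, rfl⟩
    exact ⟨i, i.2, gen_of_mem i.2⟩

end BraidGroup

/-- Terms in one variable and one binary operation. -/
inductive LDTerm : Type
  | leaf : LDTerm
  | node : LDTerm → LDTerm → LDTerm

namespace LDTerm

open Relation

/-- One-step expansion by left self-distributivity, at any position. -/
inductive Red : LDTerm → LDTerm → Prop
  | rule (a b c : LDTerm) : Red (node a (node b c)) (node (node a b) (node a c))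
  | left {a a' : LDTerm} (b : LDTerm) : Red a a' → Red (node a b) (node a' b)
  | right (a : LDTerm) {b b' : LDTerm} : Red b b' → Red (node a b) (node a b')

/-- Iterated expansion. -/
abbrev Reds : LDTerm → LDTerm → Prop := ReflTransGen Red

theorem Reds.node {a a' b b' : LDTerm} (ha : Reds a a') (hb : Reds b b') :
    Reds (node a b) (node a' b') :=
  (ReflTransGen.lift (fun t => LDTerm.node t b) (fun _ _ => Red.left b) _ _ ha).trans
    (ReflTransGen.lift (fun t => LDTerm.node a' t) (fun _ _ => Red.right a') _ _ hb)

/-- `dist a t` multiplies every leaf of `t` by `a` on the left. -/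
def dist (a : LDTerm) : LDTerm → LDTerm
  | leaf => node a leaf
  | node s t => node (dist a s) (dist a t)

/-- The common expansion of all one-step expansions of a term. -/
def full : LDTerm → LDTerm
  | leaf => leaf
  | node s t => dist (full s) (full t)

theorem reds_dist (a t : LDTerm) : Reds (node a t) (dist a t) := by
  induction t with
  | leaf => exact .refl
  | node s t hs ht => exact .head (.rule a s t) (hs.node ht)

theorem Reds.dist_left {a a' : LDTerm} (h : Reds a a') (t : LDTerm) :
    Reds (dist a t) (dist a' t) := by
  induction t with
  | leaf => exact h.node .refl
  | node s t hs ht => exact hs.node ht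

theorem Red.dist_right (a : LDTerm) {t t' : LDTerm} (h : Red t t') :
    Red (dist a t) (dist a t') := by
  induction h with
  | rule b c d => exact .rule _ _ _
  | left b _ ih => exact .left _ ih
  | right b _ ih => exact .right _ ih

theorem Reds.dist {a a' t t' : LDTerm} (h : Reds a a') (ht : Reds t t') :
    Reds (dist a t) (dist a' t') :=
  (h.dist_left t).trans (ReflTransGen.lift (LDTerm.dist a') (fun _ _ => Red.dist_right a') _ _ ht)

theorem reds_dist_dist (a b t : LDTerm) :
    Reds (dist a (dist b t)) (dist (dist a b) (dist a t)) := by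
  induction t with
  | leaf => exact (reds_dist (dist a b) (node a leaf))
  | node s t hs ht => exact hs.node ht

theorem reds_full (t : LDTerm) : Reds t (full t) := by
  induction t with
  | leaf => exact .refl
  | node s t hs ht => exact (hs.node ht).trans (reds_dist _ _)

theorem Red.full {t t' : LDTerm} (h : Red t t') : Reds (full t) (full t') := by
  induction h with
  | rule a b c => exact reds_dist_dist _ _ _
  | left b _ ih => exact ih.dist .refl
  | right a _ ih => exact Reds.dist .refl ih

theorem Reds.full {t t' : LDTerm} (h : Reds t t') : Reds (full t) (full t') := by
  induction h with
  | refl => exact .refl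
  | tail _ h ih => exact ih.trans h.full

theorem Red.reds_full {t t' : LDTerm} (h : Red t t') : Reds t' (LDTerm.full t) := by
  induction h with
  | rule a b c =>
    exact ((reds_dist a b).node (reds_dist a c)).trans
      ((LDTerm.reds_full a).dist (((LDTerm.reds_full b).node (LDTerm.reds_full c)).trans
        (reds_dist _ _)))
  | left b _ ih => exact (ih.node (LDTerm.reds_full b)).trans (reds_dist _ _)
  | right a _ ih => exact ((LDTerm.reds_full a).node ih).trans (reds_dist _ _)

theorem Reds.iterate_full {t t' : LDTerm} (n : ℕ) (h : Reds t t') :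
    Reds (LDTerm.full^[n] t) (LDTerm.full^[n] t') := by
  induction n generalizing t t' with
  | zero => exact h
  | succ n ih => exact ih h.full

theorem reds_iterate_full (n : ℕ) (t : LDTerm) : Reds t (full^[n] t) := by
  induction n generalizing t with
  | zero => exact .refl
  | succ n ih => exact (reds_full t).trans (ih _)

theorem Reds.exists_iterate_full {t t' : LDTerm} (h : Reds t t') :
    ∃ n, Reds t' (LDTerm.full^[n] t) := by
  induction h using ReflTransGen.head_induction_on with
  | refl => exact ⟨0, .refl⟩
  | head h _ ih =>
    obtain ⟨n, hn⟩ := ih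
    exact ⟨n + 1, hn.trans (h.reds_full.iterate_full n)⟩

theorem reds_confluent {t u v : LDTerm} (hu : Reds t u) (hv : Reds t v) : Join Reds u v := by
  obtain ⟨m, hm⟩ := hu.exists_iterate_full
  obtain ⟨n, hn⟩ := hv.exists_iterate_full
  refine ⟨full^[m + n] t, ?_, ?_⟩
  · rw [add_comm, Function.iterate_add_apply]
    exact hm.trans (reds_iterate_full _ _)
  · rw [Function.iterate_add_apply]
    exact hn.trans (reds_iterate_full _ _)

theorem join_reds_equivalence : Equivalence (Join Reds) :=
  equivalence_join fun _ _ _ => reds_confluent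

theorem join_reds_node {a a' b b' : LDTerm} (ha : Join Reds a a') (hb : Join Reds b b') :
    Join Reds (node a b) (node a' b') := by
  obtain ⟨c, h1, h2⟩ := ha
  obtain ⟨d, h3, h4⟩ := hb
  exact ⟨node c d, h1.node h3, h2.node h4⟩

/-- The right comb with `n + 1` leaves. -/
def comb : ℕ → LDTerm
  | 0 => leaf
  | n + 1 => node leaf (comb n)

/-- Absorption: large right combs swallow any term multiplied on the left. -/
theorem exists_join_comb (t : LDTerm) :
    ∃ N, ∀ n ≥ N, Join Reds (comb (n + 1)) (node t (comb n)) := by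
  induction t with
  | leaf => exact ⟨0, fun n _ => join_reds_equivalence.refl _⟩
  | node s t hs ht =>
    obtain ⟨M, hM⟩ := hs
    obtain ⟨N, hN⟩ := ht
    refine ⟨max M N + 1, fun n hn => ?_⟩
    obtain ⟨k, rfl⟩ : ∃ k, n = k + 1 := ⟨n - 1, by omega⟩
    have e := join_reds_equivalence
    have h1 := hM (k + 1) (by omega)
    have h2 := join_reds_node (e.refl s) (hN k (by omega))
    have h3 : Join Reds (node s (node t (comb k))) (node (node s t) (node s (comb k))) :=
      ⟨_, .single (.rule _ _ _), .refl⟩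
    have h4 := join_reds_node (e.refl (node s t)) (e.symm (hM k (by omega)))
    exact e.trans h1 (e.trans h2 (e.trans h3 h4))

/-- `a` is the left factor of `t`. -/
def IsLeft (t a : LDTerm) : Prop := ∃ b, t = node a b

theorem Red.exists_left {t t' a : LDTerm} (h : Red t t') (ha : ReflTransGen IsLeft t a) :
    ∃ a', Reds a a' ∧ ReflTransGen IsLeft t' a' := by
  induction ha using ReflTransGen.head_induction_on generalizing t' with
  | refl => exact ⟨t', .single h, .refl⟩
  | head hc hca ih =>
    obtain ⟨b, rfl⟩ := hc
    cases h with
    | rule _ b c => exact ⟨a, .refl, .head ⟨_, rfl⟩ (.head ⟨_, rfl⟩ hca)⟩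
    | left _ h =>
      obtain ⟨a', h1, h2⟩ := ih h
      exact ⟨a', h1, .head ⟨_, rfl⟩ h2⟩
    | right _ h => exact ⟨a, .refl, .head ⟨_, rfl⟩ hca⟩

theorem Reds.exists_left {t t' a : LDTerm} (h : Reds t t') (ha : ReflTransGen IsLeft t a) :
    ∃ a', Reds a a' ∧ ReflTransGen IsLeft t' a' := by
  induction h with
  | refl => exact ⟨a, .refl, ha⟩
  | tail _ h ih =>
    obtain ⟨b, h1, h2⟩ := ih
    obtain ⟨c, h3, h4⟩ := h.exists_left h2
    exact ⟨c, h1.trans h3, h4⟩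

/-- Any two terms have expansions which are comparable for the iterated left factor relation. -/
theorem exists_comparable (s t : LDTerm) : ∃ s' t', Reds s s' ∧ Reds t t' ∧
    (ReflTransGen IsLeft s' t' ∨ ReflTransGen IsLeft t' s') := by
  obtain ⟨M, hM⟩ := exists_join_comb s
  obtain ⟨N, hN⟩ := exists_join_comb t
  obtain ⟨u, hs, ht⟩ := join_reds_equivalence.trans
    (join_reds_equivalence.symm (hM (max M N) (le_max_left _ _))) (hN _ (le_max_right _ _))
  obtain ⟨s', hs', h1⟩ := hs.exists_left (.single ⟨_, rfl⟩)
  obtain ⟨t', ht', h2⟩ := ht.exists_left (.single ⟨_, rfl⟩)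
  refine ⟨s', t', hs', ht', ReflTransGen.total_of_right_unique ?_ h1 h2⟩
  rintro _ a b ⟨c, rfl⟩ ⟨d, h⟩
  exact (node.inj h).1

end LDTerm

/-- The braid group on infinitely many strands. -/
abbrev BraidInf : Type := BraidGroup Set.univ

namespace BraidInf

/-- The standard generators. -/
noncomputable def σ (i : ℕ) : BraidInf := BraidGroup.gen Set.univ i

theorem σ_comm {i j : ℕ} (h : i + 1 < j) : σ i * σ j = σ j * σ i :=
  (BraidGroup.isBraidSeq_gen _).comm i j trivial trivial h

theorem σ_braid (i : ℕ) : σ i * σ (i + 1) * σ i = σ (i + 1) * σ i * σ (i + 1) :=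
  (BraidGroup.isBraidSeq_gen _).braid i trivial trivial

theorem closure_σ : Subgroup.closure (Set.range σ) = ⊤ := by
  rw [← BraidGroup.closure_gen, Set.image_univ]
  rfl

/-- The shift endomorphism. -/
noncomputable def shift : BraidInf →* BraidInf :=
  BraidGroup.lift (fun i => σ (i + 1))
    ⟨fun _ _ _ _ h => σ_comm (by omega), fun i _ _ => σ_braid (i + 1)⟩

@[simp]
theorem shift_σ (i : ℕ) : shift (σ i) = σ (i + 1) := BraidGroup.lift_gen _ trivial

theorem σ_zero_comm_shift_shift (x : BraidInf) :
    σ 0 * shift (shift x) = shift (shift x) * σ 0 := by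
  have h : x ∈ Subgroup.closure (Set.range σ) := closure_σ ▸ Subgroup.mem_top x
  change Commute (σ 0) (shift (shift x))
  induction h using Subgroup.closure_induction with
  | mem x hx =>
    obtain ⟨i, rfl⟩ := hx
    rw [shift_σ, shift_σ]
    exact σ_comm (by omega)
  | one => simp
  | mul x y _ _ hx hy => simpa using hx.mul_right hy
  | inv x _ hx => simpa using hx.inv_right

/-- Words in which `σ i` occurs only positively, and `σ j` does not occur for `j < i`. -/
noncomputable def nonneg (i : ℕ) : Submonoid BraidInf :=
  Submonoid.closure ({x | ∃ j, i ≤ j ∧ x = σ j} ∪ {x | ∃ j, i < j ∧ x = (σ j)⁻¹})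

/-- A braid is `σ i`-positive if it has an expression in which `σ i` occurs, `(σ i)⁻¹` does not
occur, and `σ j` and `(σ j)⁻¹` do not occur for `j < i`. -/
def SPos (i : ℕ) (x : BraidInf) : Prop :=
  ∃ a ∈ nonneg i, ∃ b ∈ nonneg i, x = a * σ i * b

theorem σ_mem_nonneg {i j : ℕ} (h : i ≤ j) : σ j ∈ nonneg i :=
  Submonoid.subset_closure (.inl ⟨j, h, rfl⟩)

theorem σ_inv_mem_nonneg {i j : ℕ} (h : i < j) : (σ j)⁻¹ ∈ nonneg i :=
  Submonoid.subset_closure (.inr ⟨j, h, rfl⟩)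

theorem nonneg_anti {i j : ℕ} (h : i ≤ j) : nonneg j ≤ nonneg i := by
  refine Submonoid.closure_le.2 ?_
  rintro x (⟨k, hk, rfl⟩ | ⟨k, hk, rfl⟩)
  · exact σ_mem_nonneg (h.trans hk)
  · exact σ_inv_mem_nonneg (h.trans_lt hk)

theorem SPos.mem_nonneg {i : ℕ} {x : BraidInf} (h : SPos i x) : x ∈ nonneg i := by
  obtain ⟨a, ha, b, hb, rfl⟩ := h
  exact mul_mem (mul_mem ha (σ_mem_nonneg le_rfl)) hb

theorem SPos.mul_right {i : ℕ} {x y : BraidInf} (h : SPos i x) (hy : y ∈ nonneg i) :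
    SPos i (x * y) := by
  obtain ⟨a, ha, b, hb, rfl⟩ := h
  exact ⟨a, ha, b * y, mul_mem hb hy, by simp [mul_assoc]⟩

theorem SPos.mul_left {i : ℕ} {x y : BraidInf} (h : SPos i x) (hy : y ∈ nonneg i) :
    SPos i (y * x) := by
  obtain ⟨a, ha, b, hb, rfl⟩ := h
  exact ⟨y * a, mul_mem hy ha, b, hb, by simp [mul_assoc]⟩

/-- The positive cone of the Dehornoy ordering. -/
def Pos (x : BraidInf) : Prop := ∃ i, SPos i x

theorem Pos.mul {x y : BraidInf} (hx : Pos x) (hy : Pos y) : Pos (x * y) := by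
  obtain ⟨i, hi⟩ := hx
  obtain ⟨j, hj⟩ := hy
  rcases le_total i j with h | h
  · exact ⟨i, hi.mul_right (nonneg_anti h hj.mem_nonneg)⟩
  · exact ⟨j, hj.mul_left (nonneg_anti h hi.mem_nonneg)⟩

theorem shift_mem_nonneg (x : BraidInf) : shift x ∈ nonneg 0 := by
  have h : x ∈ Subgroup.closure (Set.range σ) := closure_σ ▸ Subgroup.mem_top x
  suffices shift x ∈ nonneg 0 ∧ (shift x)⁻¹ ∈ nonneg 0 from this.1
  induction h using Subgroup.closure_induction with
  | mem x hx =>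
    obtain ⟨i, rfl⟩ := hx
    simpa using ⟨σ_mem_nonneg (by omega), σ_inv_mem_nonneg (by omega)⟩
  | one => simp
  | mul x y _ _ hx hy => simpa using ⟨mul_mem hx.1 hy.1, mul_mem hy.2 hx.2⟩
  | inv x _ hx => simpa using hx.symm

theorem SPos.shift {i : ℕ} {x : BraidInf} (h : SPos i x) : SPos (i + 1) (shift x) := by
  have key : nonneg i ≤ (nonneg (i + 1)).comap BraidInf.shift := by
    refine Submonoid.closure_le.2 ?_
    rintro x (⟨k, hk, rfl⟩ | ⟨k, hk, rfl⟩)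
    · simpa using σ_mem_nonneg (by omega)
    · simpa using σ_inv_mem_nonneg (by omega)
  obtain ⟨a, ha, b, hb, rfl⟩ := h
  exact ⟨_, key ha, _, key hb, by simp⟩

/-! ### The reversal anti-automorphism -/

/-- The reversal anti-automorphism, fixing all generators. -/
noncomputable def reverse : BraidInf →* BraidInfᵐᵒᵖ :=
  BraidGroup.lift (fun i => MulOpposite.op (σ i))
    ⟨fun _ _ _ _ h => MulOpposite.unop_injective (σ_comm h).symm,
      fun i _ _ => MulOpposite.unop_injective (by simpa [mul_assoc] using σ_braid i)⟩

@[simp]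
theorem reverse_σ (i : ℕ) : reverse (σ i) = MulOpposite.op (σ i) := BraidGroup.lift_gen _ trivial

theorem SPos.reverse {i : ℕ} {x : BraidInf} (h : SPos i x) : SPos i (reverse x).unop := by
  have key {y : BraidInf} (hy : y ∈ nonneg i) : (BraidInf.reverse y).unop ∈ nonneg i := by
    induction hy using Submonoid.closure_induction with
    | mem x hx =>
      rcases hx with ⟨k, hk, rfl⟩ | ⟨k, hk, rfl⟩
      · simpa using σ_mem_nonneg hk
      · simpa using σ_inv_mem_nonneg hk
    | one => simp
    | mul x y _ _ hx hy => simpa using mul_mem hy hx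
  obtain ⟨a, ha, b, hb, rfl⟩ := h
  exact ⟨_, key hb, _, key ha, by simp [mul_assoc]⟩

/-! ### Totality of the order -/

/-- Evaluation of a term at the trivial braid, for the self-distributive operation
`a ▷ b = a * shift b * σ 0 * (shift a)⁻¹`. -/
noncomputable def eval : LDTerm → BraidInf
  | .leaf => 1
  | .node a b => eval a * shift (eval b) * σ 0 * (shift (eval a))⁻¹

theorem self_distrib (a b c : BraidInf) :
    a * shift (b * shift c * σ 0 * (shift b)⁻¹) * σ 0 * (shift a)⁻¹ =
      (a * shift b * σ 0 * (shift a)⁻¹) * shift (a * shift c * σ 0 * (shift a)⁻¹) * σ 0 *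
        (shift (a * shift b * σ 0 * (shift a)⁻¹))⁻¹ := by
  have hb : (shift (shift b))⁻¹ * σ 0 = σ 0 * (shift (shift b))⁻¹ := by
    simpa using (σ_zero_comm_shift_shift b⁻¹).symm
  have ha := σ_zero_comm_shift_shift a
  have hc := σ_zero_comm_shift_shift c
  have hs : σ 0 * σ 1 * σ 0 * (σ 1)⁻¹ = σ 1 * σ 0 := by
    rw [mul_inv_eq_iff_eq_mul]
    exact σ_braid 0
  simp only [map_mul, map_inv, shift_σ, zero_add, mul_inv_rev, inv_inv]
  calc _ = a * shift b * shift (shift c) * σ 1 * ((shift (shift b))⁻¹ * σ 0) * (shift a)⁻¹ := by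
        group
    _ = a * shift b * shift (shift c) * (σ 1 * σ 0) * (shift (shift b))⁻¹ * (shift a)⁻¹ := by
        rw [hb]; group
    _ = a * shift b * (shift (shift c) * σ 0) * σ 1 * σ 0 * (σ 1)⁻¹ * (shift (shift b))⁻¹ *
          (shift a)⁻¹ := by
        rw [← hs]; group
    _ = a * shift b * σ 0 * shift (shift c) * σ 1 * ((shift (shift a))⁻¹ *
          (shift (shift a) * σ 0)) * (σ 1)⁻¹ * (shift (shift b))⁻¹ * (shift a)⁻¹ := by
        rw [← hc]; group
    _ = _ := by rw [← ha]; group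

theorem eval_eq_of_red {s t : LDTerm} (h : LDTerm.Red s t) : eval s = eval t := by
  induction h with
  | rule a b c => exact self_distrib _ _ _
  | left b _ ih => simp only [eval, ih]
  | right a _ ih => simp only [eval, ih]

theorem eval_eq_of_reds {s t : LDTerm} (h : LDTerm.Reds s t) : eval s = eval t := by
  induction h with
  | refl => rfl
  | tail _ h ih => exact ih.trans (eval_eq_of_red h)

theorem eval_eq_or_sPos_of_isLeft {s t : LDTerm} (h : Relation.ReflTransGen LDTerm.IsLeft t s) :
    eval s = eval t ∨ SPos 0 ((eval s)⁻¹ * eval t) := by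
  induction h with
  | refl => exact .inl rfl
  | @tail r s _ h ih =>
    right
    obtain ⟨b, rfl⟩ := h
    have h1 : SPos 0 ((eval s)⁻¹ * eval (s.node b)) :=
      ⟨shift (eval b), shift_mem_nonneg _, shift (eval s)⁻¹, shift_mem_nonneg _, by
        simp only [eval, map_inv]; group⟩
    rcases ih with ih | ih
    · rwa [← ih]
    · simpa [mul_assoc] using h1.mul_right ih.mem_nonneg

theorem eval_trichotomy (s t : LDTerm) :
    eval s = eval t ∨ SPos 0 ((eval s)⁻¹ * eval t) ∨ SPos 0 ((eval t)⁻¹ * eval s) := by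
  obtain ⟨s', t', hs, ht, h⟩ := LDTerm.exists_comparable s t
  rw [eval_eq_of_reds hs, eval_eq_of_reds ht]
  rcases h with h | h <;> have := eval_eq_or_sPos_of_isLeft h <;> tauto

/-- The braid `eval t₀ * shift (eval t₁) * shift² (eval t₂) * ⋯`. -/
noncomputable def evalList : List LDTerm → BraidInf
  | [] => 1
  | t :: l => eval t * shift (evalList l)

theorem exists_evalList_mul_σ (i : ℕ) (l : List LDTerm) :
    ∃ l', evalList l * σ i = evalList l' := by
  have hσ (s t : LDTerm) (l : List LDTerm) :
      evalList (s :: t :: l) * σ 0 = evalList (s.node t :: s :: l) := by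
    simp only [evalList, eval, map_mul]
    have h := σ_zero_comm_shift_shift (evalList l)
    calc _ = eval s * shift (eval t) * (shift (shift (evalList l)) * σ 0) := by group
      _ = _ := by rw [← h]; group
  induction i generalizing l with
  | zero =>
    match l with
    | [] => exact ⟨_, (congrArg (· * σ 0) (by simp [evalList, eval] :
        evalList [] = evalList [.leaf, .leaf])).trans (hσ _ _ _)⟩
    | [s] => exact ⟨_, (congrArg (· * σ 0) (by simp [evalList, eval] :
        evalList [s] = evalList [s, .leaf])).trans (hσ _ _ _)⟩
    | s :: t :: l => exact ⟨_, hσ s t l⟩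
  | succ i ih =>
    match l with
    | [] =>
      obtain ⟨l', h⟩ := ih []
      refine ⟨.leaf :: l', ?_⟩
      simp [evalList, eval, ← h]
    | s :: l =>
      obtain ⟨l', h⟩ := ih l
      refine ⟨s :: l', ?_⟩
      simp [evalList, ← h, mul_assoc]

theorem evalList_trichotomy (l l' : List LDTerm) :
    evalList l = evalList l' ∨ Pos ((evalList l)⁻¹ * evalList l') ∨
      Pos ((evalList l')⁻¹ * evalList l) := by
  have key (s t : LDTerm) (l l' : List LDTerm)
      (ih : evalList l = evalList l' ∨ Pos ((evalList l)⁻¹ * evalList l') ∨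
        Pos ((evalList l')⁻¹ * evalList l)) :
      evalList (s :: l) = evalList (t :: l') ∨ Pos ((evalList (s :: l))⁻¹ * evalList (t :: l')) ∨
        Pos ((evalList (t :: l'))⁻¹ * evalList (s :: l)) := by
    have hpos (s t : LDTerm) (l l' : List LDTerm) (h : SPos 0 ((eval s)⁻¹ * eval t)) :
        Pos ((evalList (s :: l))⁻¹ * evalList (t :: l')) := by
      refine ⟨0, ?_⟩
      have := (h.mul_left (shift_mem_nonneg (evalList l)⁻¹)).mul_right
        (shift_mem_nonneg (evalList l'))
      simpa [evalList, mul_assoc] using this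
    rcases eval_trichotomy s t with h | h | h
    · simp only [evalList, h]
      rcases ih with ih | ⟨i, ih⟩ | ⟨i, ih⟩
      · simp [ih]
      · exact .inr (.inl ⟨i + 1, by simpa [mul_assoc] using ih.shift⟩)
      · exact .inr (.inr ⟨i + 1, by simpa [mul_assoc] using ih.shift⟩)
    · exact .inr (.inl (hpos _ _ _ _ h))
    · exact .inr (.inr (hpos _ _ _ _ h))
  have hnil : evalList [] = evalList [.leaf] := by simp [evalList, eval]
  induction l generalizing l' with
  | nil =>
    induction l' with
    | nil => exact .inl rfl
    | cons t l' ih => rw [hnil]; exact key _ _ _ _ ih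
  | cons s l ih =>
    match l' with
    | [] => rw [hnil]; exact key _ _ _ _ (ih [])
    | t :: l' => exact key _ _ _ _ (ih l')

/-- The monoid of positive braids in the generators `σ j`, `j < n`. -/
noncomputable def posMonoid (n : ℕ) : Submonoid BraidInf := Submonoid.closure (σ '' Set.Iio n)

theorem σ_mem_posMonoid {i n : ℕ} (h : i < n) : σ i ∈ posMonoid n :=
  Submonoid.subset_closure ⟨i, h, rfl⟩

theorem posMonoid_mono {m n : ℕ} (h : m ≤ n) : posMonoid m ≤ posMonoid n :=
  Submonoid.closure_mono (Set.image_mono (Set.Iio_subset_Iio h))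

theorem exists_evalList_of_mem_posMonoid {n : ℕ} {x : BraidInf} (h : x ∈ posMonoid n) :
    ∃ l, evalList l = x := by
  induction h using Submonoid.closure_induction_right with
  | one => exact ⟨[], rfl⟩
  | mul_right x _ y hy ih =>
    obtain ⟨l, rfl⟩ := ih
    obtain ⟨i, _, rfl⟩ := hy
    obtain ⟨l', h⟩ := exists_evalList_mul_σ i l
    exact ⟨l', h.symm⟩

/-- The braid `σ 0 * σ 1 * ⋯ * σ (n - 1)`. -/
noncomputable def coxeter : ℕ → BraidInf
  | 0 => 1
  | n + 1 => coxeter n * σ n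

theorem coxeter_mem (n : ℕ) : coxeter n ∈ posMonoid n := by
  induction n with
  | zero => exact one_mem _
  | succ n ih => exact mul_mem (posMonoid_mono n.le_succ ih) (σ_mem_posMonoid n.lt_succ_self)

theorem coxeter_mul_σ_of_lt {n i : ℕ} (h : n < i) : coxeter n * σ i = σ i * coxeter n := by
  induction n with
  | zero => simp [coxeter]
  | succ n ih =>
    rw [coxeter, mul_assoc, σ_comm h, ← mul_assoc, ih (by omega), mul_assoc]

theorem coxeter_mul_σ {n i : ℕ} (h : i + 1 < n) : coxeter n * σ i = σ (i + 1) * coxeter n := by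
  induction n with
  | zero => omega
  | succ n ih =>
    rcases Nat.lt_succ_iff_lt_or_eq.1 h with h | rfl
    · rw [coxeter, mul_assoc, ← σ_comm h, ← mul_assoc, ih h, mul_assoc]
    · calc _ = coxeter i * (σ i * σ (i + 1) * σ i) := by simp [coxeter, mul_assoc]
        _ = coxeter i * σ (i + 1) * σ i * σ (i + 1) := by rw [σ_braid]; simp [mul_assoc]
        _ = _ := by rw [coxeter_mul_σ_of_lt i.lt_succ_self]; simp [coxeter, mul_assoc]

theorem coxeter_pow_mul_σ {n i k : ℕ} (h : i + k < n) :
    coxeter n ^ k * σ i = σ (i + k) * coxeter n ^ k := by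
  induction k with
  | zero => simp
  | succ k ih =>
    rw [pow_succ', mul_assoc, ih (by omega), ← mul_assoc, coxeter_mul_σ (by omega), mul_assoc]
    rfl

theorem coxeter_sq_mul_σ (n : ℕ) :
    coxeter (n + 1) ^ 2 * σ n = σ 0 * coxeter (n + 1) ^ 2 := by
  have key : ∀ m ≤ n, coxeter (n + 1) * coxeter m =
      (σ 0)⁻¹ * coxeter (m + 1) * coxeter (n + 1) := by
    intro m hm
    induction m with
    | zero => simp [coxeter]
    | succ m ih =>
      calc _ = coxeter (n + 1) * coxeter m * σ m := by rw [mul_assoc]; rfl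
        _ = (σ 0)⁻¹ * coxeter (m + 1) * (coxeter (n + 1) * σ m) := by
            rw [ih (by omega), mul_assoc]
        _ = (σ 0)⁻¹ * (coxeter (m + 1) * σ (m + 1)) * coxeter (n + 1) := by
            rw [coxeter_mul_σ (by omega)]; simp only [mul_assoc]
        _ = _ := rfl
  have h := key n le_rfl
  calc _ = coxeter (n + 1) * coxeter (n + 1) * σ n := by rw [sq]
    _ = σ 0 * (coxeter (n + 1) * coxeter n) * σ n := by rw [h]; group
    _ = _ := by rw [sq]; simp [coxeter, mul_assoc]

/-- The square of the half twist. -/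
noncomputable def fullTwist (n : ℕ) : BraidInf := coxeter n ^ (n + 1)

theorem fullTwist_mem (n : ℕ) : fullTwist n ∈ posMonoid n := pow_mem (coxeter_mem n) _

theorem fullTwist_comm_σ {n i : ℕ} (h : i < n) : Commute (fullTwist n) (σ i) := by
  obtain ⟨k, rfl⟩ : ∃ k, n = i + k + 1 := ⟨n - i - 1, by omega⟩
  have h1 : fullTwist (i + k + 1) =
      coxeter (i + k + 1) ^ i * coxeter (i + k + 1) ^ 2 * coxeter (i + k + 1) ^ k := by
    rw [fullTwist, ← pow_add, ← pow_add]; congr 1; omega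
  rw [h1]
  change _ * _ = _ * _
  calc _ = coxeter (i + k + 1) ^ i * coxeter (i + k + 1) ^ 2 *
        (coxeter (i + k + 1) ^ k * σ i) := by group
    _ = coxeter (i + k + 1) ^ i * (coxeter (i + k + 1) ^ 2 * σ (i + k)) *
        coxeter (i + k + 1) ^ k := by rw [coxeter_pow_mul_σ (by omega)]; group
    _ = (coxeter (i + k + 1) ^ i * σ 0) * coxeter (i + k + 1) ^ 2 *
        coxeter (i + k + 1) ^ k := by rw [coxeter_sq_mul_σ]; group
    _ = _ := by rw [coxeter_pow_mul_σ (by omega), zero_add]; group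

theorem fullTwist_comm {n : ℕ} {x : BraidInf} (h : x ∈ posMonoid n) : Commute (fullTwist n) x := by
  induction h using Submonoid.closure_induction with
  | mem x hx => obtain ⟨i, hi, rfl⟩ := hx; exact fullTwist_comm_σ hi
  | one => exact .one_right _
  | mul x y _ _ hx hy => exact hx.mul_right hy

theorem fullTwist_mul_σ_inv_mem {n i : ℕ} (h : i < n) : fullTwist n * (σ i)⁻¹ ∈ posMonoid n := by
  obtain ⟨k, rfl⟩ : ∃ k, n = i + k + 1 := ⟨n - i - 1, by omega⟩
  have h1 : fullTwist (i + k + 1) * (σ i)⁻¹ =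
      coxeter (i + k + 1) ^ (i + 1) * coxeter (i + k) * coxeter (i + k + 1) ^ k := by
    rw [mul_inv_eq_iff_eq_mul, mul_assoc, coxeter_pow_mul_σ (by omega), fullTwist]
    calc _ = coxeter (i + k + 1) ^ (i + 1) * coxeter (i + k + 1) * coxeter (i + k + 1) ^ k := by
          rw [← pow_succ, ← pow_add]; congr 1; omega
      _ = _ := by simp only [coxeter, mul_assoc]
  rw [h1]
  exact mul_mem (mul_mem (pow_mem (coxeter_mem _) _)
    (posMonoid_mono (Nat.le_succ _) (coxeter_mem _))) (pow_mem (coxeter_mem _) _)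

/-- Every braid is a left fraction of positive braids. -/
theorem exists_eq_inv_mul (x : BraidInf) :
    ∃ n, ∃ p ∈ posMonoid n, ∃ q ∈ posMonoid n, x = p⁻¹ * q := by
  have h : x ∈ Subgroup.closure (Set.range σ) := closure_σ ▸ Subgroup.mem_top x
  induction h using Subgroup.closure_induction_right with
  | one => exact ⟨0, 1, one_mem _, 1, one_mem _, by simp⟩
  | mul_right x _ y hy ih =>
    obtain ⟨n, p, hp, q, hq, rfl⟩ := ih
    obtain ⟨i, rfl⟩ := hy
    exact ⟨max n (i + 1), p, posMonoid_mono (le_max_left _ _) hp, q * σ i,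
      mul_mem (posMonoid_mono (le_max_left _ _) hq)
        (σ_mem_posMonoid (le_max_right n (i + 1))), by group⟩
  | mul_inv_cancel x _ y hy ih =>
    obtain ⟨n, p, hp, q, hq, rfl⟩ := ih
    obtain ⟨i, rfl⟩ := hy
    have hi : i < max n (i + 1) := le_max_right n (i + 1)
    have hq' := posMonoid_mono (le_max_left n (i + 1)) hq
    refine ⟨max n (i + 1), fullTwist (max n (i + 1)) * p,
      mul_mem (fullTwist_mem _) (posMonoid_mono (le_max_left _ _) hp),
      q * (fullTwist (max n (i + 1)) * (σ i)⁻¹), mul_mem hq' (fullTwist_mul_σ_inv_mem hi), ?_⟩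
    rw [← mul_assoc q, ← (fullTwist_comm hq').eq]
    group

theorem trichotomy (x : BraidInf) : x = 1 ∨ Pos x ∨ Pos x⁻¹ := by
  obtain ⟨n, p, hp, q, hq, rfl⟩ := exists_eq_inv_mul x
  obtain ⟨l, rfl⟩ := exists_evalList_of_mem_posMonoid hp
  obtain ⟨l', rfl⟩ := exists_evalList_of_mem_posMonoid hq
  rw [inv_mul_eq_one, mul_inv_rev, inv_inv]
  exact evalList_trichotomy l l'

end BraidInf

/-! ### A subtraction-free rational action of the braid group -/

/-- Positive rational numbers. -/
abbrev PosRat := {x : ℚ // 0 < x}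

/-- First component of the rational Dynnikov map. -/
def dynA (u v : PosRat × PosRat) : PosRat × PosRat :=
  let ⟨⟨a, _⟩, ⟨b, _⟩⟩ := u
  let ⟨⟨c, _⟩, ⟨d, _⟩⟩ := v
  (⟨a * (1 + b) + b * c, by positivity⟩,
   ⟨b * c * d / (b * c + a * (1 + b) * (1 + d)), by positivity⟩)

/-- Second component of the rational Dynnikov map. -/
def dynB (u v : PosRat × PosRat) : PosRat × PosRat :=
  let ⟨⟨a, _⟩, ⟨b, _⟩⟩ := u
  let ⟨⟨c, _⟩, ⟨d, _⟩⟩ := v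
  (⟨a * c * d / (c + a * (1 + d)), by positivity⟩,
   ⟨(b * c + a * (1 + b) * (1 + d)) / c, by positivity⟩)

/-- First component of the inverse of the rational Dynnikov map. -/
def dynA' (u v : PosRat × PosRat) : PosRat × PosRat :=
  let ⟨⟨a, _⟩, ⟨b, _⟩⟩ := u
  let ⟨⟨c, _⟩, ⟨d, _⟩⟩ := v
  (⟨a * c / (c * (1 + b) + a * b), by positivity⟩,
   ⟨a * b * d / (a * b + c * (1 + b) * (1 + d)), by positivity⟩)

/-- Second component of the inverse of the rational Dynnikov map. -/
def dynB' (u v : PosRat × PosRat) : PosRat × PosRat :=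
  let ⟨⟨a, _⟩, ⟨b, _⟩⟩ := u
  let ⟨⟨c, _⟩, ⟨d, _⟩⟩ := v
  (⟨(c * (1 + d) + a) / d, by positivity⟩,
   ⟨(a * b + c * (1 + b) * (1 + d)) / a, by positivity⟩)

theorem dynA'_dynA_dynB (u v) : dynA' (dynA u v) (dynB u v) = u := by
  obtain ⟨⟨a, _⟩, ⟨b, _⟩⟩ := u
  obtain ⟨⟨c, _⟩, ⟨d, _⟩⟩ := v
  simp only [dynA, dynB, dynA', Prod.mk.injEq, Subtype.mk.injEq]
  constructor <;> (field_simp; ring)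

theorem dynB'_dynA_dynB (u v) : dynB' (dynA u v) (dynB u v) = v := by
  obtain ⟨⟨a, _⟩, ⟨b, _⟩⟩ := u
  obtain ⟨⟨c, _⟩, ⟨d, _⟩⟩ := v
  simp only [dynA, dynB, dynB', Prod.mk.injEq, Subtype.mk.injEq]
  constructor <;> (field_simp; ring)

theorem dynA_dynA'_dynB' (u v) : dynA (dynA' u v) (dynB' u v) = u := by
  obtain ⟨⟨a, _⟩, ⟨b, _⟩⟩ := u
  obtain ⟨⟨c, _⟩, ⟨d, _⟩⟩ := v
  simp only [dynA, dynA', dynB', Prod.mk.injEq, Subtype.mk.injEq]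
  constructor <;> (field_simp; ring)

theorem dynB_dynA'_dynB' (u v) : dynB (dynA' u v) (dynB' u v) = v := by
  obtain ⟨⟨a, _⟩, ⟨b, _⟩⟩ := u
  obtain ⟨⟨c, _⟩, ⟨d, _⟩⟩ := v
  simp only [dynB, dynA', dynB', Prod.mk.injEq, Subtype.mk.injEq]
  constructor <;> (field_simp; ring)

theorem dynA_snd_mul_dynB_snd (u v) : (dynA u v).2 * (dynB u v).2 = u.2 * v.2 := by
  obtain ⟨⟨a, _⟩, ⟨b, _⟩⟩ := u
  obtain ⟨⟨c, _⟩, ⟨d, _⟩⟩ := v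
  apply Subtype.ext
  simp only [dynA, dynB, Positive.val_mul]
  field_simp

theorem dynA_dynB (u v w) :
    dynA (dynB u v) w =
    (⟨(u.1 * v.1 * v.2 * (1 + u.2) + (u.2 * v.1 + u.1 * (1 + u.2) * (1 + v.2)) * w.1) / v.1, by
      have := u.1.2; have := u.2.2; have := v.1.2; have := v.2.2; have := w.1.2
      positivity⟩,
    ⟨(u.2 * v.1 + u.1 * (1 + u.2) * (1 + v.2)) * w.1 * w.2 /
        ((u.2 * v.1 + u.1 * (1 + u.2) * (1 + v.2)) * w.1 +
          u.1 * v.1 * v.2 * (1 + u.2) * (1 + w.2)), by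
      have := u.1.2; have := u.2.2; have := v.1.2; have := v.2.2; have := w.1.2; have := w.2.2
      positivity⟩) := by
  obtain ⟨⟨a, _⟩, ⟨b, _⟩⟩ := u
  obtain ⟨⟨c, _⟩, ⟨d, _⟩⟩ := v
  obtain ⟨⟨e, _⟩, ⟨f, _⟩⟩ := w
  simp only [dynA, dynB, Prod.mk.injEq, Subtype.mk.injEq]
  constructor <;> (field_simp; ring)

theorem dyn_braid_left (u v w) : dynA (dynA u v) (dynA (dynB u v) w) = dynA u (dynA v w) := by
  rw [dynA_dynB]
  obtain ⟨⟨a, _⟩, ⟨b, _⟩⟩ := u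
  obtain ⟨⟨c, _⟩, ⟨d, _⟩⟩ := v
  obtain ⟨⟨e, _⟩, ⟨f, _⟩⟩ := w
  simp only [dynA, Prod.mk.injEq, Subtype.mk.injEq]
  constructor <;> (field_simp; ring)

theorem dyn_braid_right (u v w) : dynB (dynB u v) w = dynB (dynB u (dynA v w)) (dynB v w) := by
  obtain ⟨⟨a, _⟩, ⟨b, _⟩⟩ := u
  obtain ⟨⟨c, _⟩, ⟨d, _⟩⟩ := v
  obtain ⟨⟨e, _⟩, ⟨f, _⟩⟩ := w
  simp only [dynA, dynB, Prod.mk.injEq, Subtype.mk.injEq]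
  constructor <;> (field_simp; ring)

theorem dyn_braid_mid_aux (u v w) : (dynB (dynA u v) (dynA (dynB u v) w)).1.1 =
    w.1 * w.2 * (u.1 * (1 + u.2) + u.2 * v.1) / (w.1 + v.1 * (1 + w.2)) := by
  rw [dynA_dynB]
  obtain ⟨⟨a, _⟩, ⟨b, _⟩⟩ := u
  obtain ⟨⟨c, _⟩, ⟨d, _⟩⟩ := v
  obtain ⟨⟨e, _⟩, ⟨f, _⟩⟩ := w
  simp only [dynA, dynB]
  field_simp
  ring

theorem dyn_braid_mid_aux' (u v w) : (dynA (dynB u (dynA v w)) (dynB v w)).1.1 =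
    w.1 * w.2 * (u.1 * (1 + u.2) + u.2 * v.1) / (w.1 + v.1 * (1 + w.2)) := by
  rw [dynA_dynB]
  obtain ⟨⟨a, _⟩, ⟨b, _⟩⟩ := u
  obtain ⟨⟨c, _⟩, ⟨d, _⟩⟩ := v
  obtain ⟨⟨e, _⟩, ⟨f, _⟩⟩ := w
  simp only [dynA, dynB]
  field_simp
  ring

theorem dyn_braid_mid (u v w) : dynB (dynA u v) (dynA (dynB u v) w) =
    dynA (dynB u (dynA v w)) (dynB v w) := by
  refine Prod.ext (Subtype.ext ((dyn_braid_mid_aux u v w).trans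
    (dyn_braid_mid_aux' u v w).symm)) ?_
  have h1 := dynA_snd_mul_dynB_snd (dynA u v) (dynA (dynB u v) w)
  have h2 := dynA_snd_mul_dynB_snd (dynB u v) w
  have h3 := dynA_snd_mul_dynB_snd u v
  have h4 := dynA_snd_mul_dynB_snd (dynB u (dynA v w)) (dynB v w)
  have h5 := dynA_snd_mul_dynB_snd u (dynA v w)
  have h6 := dynA_snd_mul_dynB_snd v w
  rw [dyn_braid_left] at h1
  rw [dyn_braid_right] at h2
  have h : (dynA u (dynA v w)).2 * (dynB (dynB u (dynA v w)) (dynB v w)).2 *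
      (dynB (dynA u v) (dynA (dynB u v) w)).2 = (dynA u (dynA v w)).2 *
      (dynB (dynB u (dynA v w)) (dynB v w)).2 * (dynA (dynB u (dynA v w)) (dynB v w)).2 := by
    calc _ = ((dynA u (dynA v w)).2 * (dynB (dynA u v) (dynA (dynB u v) w)).2) *
           (dynB (dynB u (dynA v w)) (dynB v w)).2 := mul_right_comm _ _ _
      _ = (dynA u v).2 * ((dynA (dynB u v) w).2 * (dynB (dynB u (dynA v w)) (dynB v w)).2) := by
        rw [h1, mul_assoc]
      _ = u.2 * (v.2 * w.2) := by rw [h2, ← mul_assoc, h3, mul_assoc]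
      _ = ((dynA u (dynA v w)).2 * (dynB u (dynA v w)).2) * (dynB v w).2 := by
        rw [h5, mul_assoc, h6]
      _ = _ := by rw [mul_assoc, ← h4, mul_assoc, mul_comm (dynB _ _).2]
  exact mul_left_cancel h

theorem fst_lt_dynA_fst (u v : PosRat × PosRat) : u.1 < (dynA u v).1 := by
  obtain ⟨⟨a, ha⟩, ⟨b, hb⟩⟩ := u
  obtain ⟨⟨c, hc⟩, ⟨d, _⟩⟩ := v
  change a < a * (1 + b) + b * c
  nlinarith [mul_pos ha hb, mul_pos hb hc]

/-- The action of the braid generator with index `i` on sequences. -/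
def dynPerm (i : ℕ) : Equiv.Perm (ℕ → PosRat × PosRat) where
  toFun s j := if j = i then dynA (s i) (s (i + 1))
    else if j = i + 1 then dynB (s i) (s (i + 1)) else s j
  invFun s j := if j = i then dynA' (s i) (s (i + 1))
    else if j = i + 1 then dynB' (s i) (s (i + 1)) else s j
  left_inv s := by
    ext1 j
    by_cases h1 : j = i
    · subst h1; simp [dynA'_dynA_dynB]
    · by_cases h2 : j = i + 1
      · subst h2; simp [dynB'_dynA_dynB]
      · simp [h1, h2]
  right_inv s := by
    ext1 j
    by_cases h1 : j = i
    · subst h1; simp [dynA_dynA'_dynB']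
    · by_cases h2 : j = i + 1
      · subst h2; simp [dynB_dynA'_dynB']
      · simp [h1, h2]

theorem dynPerm_apply (i : ℕ) (s : ℕ → PosRat × PosRat) (j : ℕ) :
    dynPerm i s j = if j = i then dynA (s i) (s (i + 1))
      else if j = i + 1 then dynB (s i) (s (i + 1)) else s j := rfl

theorem isBraidSeq_dynPerm : IsBraidSeq Set.univ dynPerm where
  comm i j _ _ h := by
    ext1 s
    funext k
    have h1 : i ≠ j := by omega
    have h2 : i + 1 ≠ j := by omega
    have h3 : i ≠ j + 1 := by omega
    have h4 : j + 1 ≠ i := by omega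
    simp only [Equiv.Perm.mul_apply, dynPerm_apply, add_left_inj, h1, h2, h3, h1.symm, h2.symm,
      h4, if_false]
    split_ifs <;> first | rfl | omega
  braid i _ _ := by
    ext1 s
    funext k
    have h1 : i + 1 + 1 ≠ i := by omega
    have h2 : i ≠ i + 1 + 1 := by omega
    by_cases hk : k = i
    · subst hk
      simpa [Equiv.Perm.mul_apply, dynPerm_apply, h1, h2] using dyn_braid_left (s k) _ _
    by_cases hk1 : k = i + 1
    · subst hk1
      simpa [Equiv.Perm.mul_apply, dynPerm_apply, h1, h2] using dyn_braid_mid (s i) _ _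
    by_cases hk2 : k = i + 1 + 1
    · subst hk2
      simpa [Equiv.Perm.mul_apply, dynPerm_apply, h1, h2] using dyn_braid_right (s i) _ _
    simp [Equiv.Perm.mul_apply, dynPerm_apply, hk, hk1, hk2]

namespace BraidInf

/-- The action of the braid group on sequences of pairs of positive rationals. -/
noncomputable def dyn : BraidInf →* Equiv.Perm (ℕ → PosRat × PosRat) :=
  BraidGroup.lift dynPerm isBraidSeq_dynPerm

theorem dyn_σ (i : ℕ) : dyn (σ i) = dynPerm i := BraidGroup.lift_gen _ trivial

theorem fst_lt_dyn_σ (i : ℕ) (s : ℕ → PosRat × PosRat) : (s i).1 < (dyn (σ i) s i).1 := by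
  rw [dyn_σ, dynPerm_apply, if_pos rfl]
  exact fst_lt_dynA_fst _ _

theorem dyn_σ_apply_of_lt {i j : ℕ} (h : i < j) (s : ℕ → PosRat × PosRat) :
    dyn (σ j) s i = s i := by
  rw [dyn_σ, dynPerm_apply, if_neg (by omega), if_neg (by omega)]

theorem fst_le_dyn {i : ℕ} {x : BraidInf} (hx : x ∈ nonneg i) (s : ℕ → PosRat × PosRat) :
    (s i).1 ≤ (dyn x s i).1 := by
  induction hx using Submonoid.closure_induction generalizing s with
  | mem x hx =>
    rcases hx with ⟨j, hj, rfl⟩ | ⟨j, hj, rfl⟩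
    · rcases hj.eq_or_lt with rfl | hj
      · exact (fst_lt_dyn_σ i s).le
      · rw [dyn_σ_apply_of_lt hj]
    · have h := dyn_σ_apply_of_lt hj (dyn (σ j)⁻¹ s)
      rw [← Equiv.Perm.mul_apply, ← map_mul, mul_inv_cancel, map_one, Equiv.Perm.one_apply] at h
      rw [← h]
  | one => simp
  | mul x y _ _ hx hy =>
    rw [map_mul, Equiv.Perm.mul_apply]
    exact (hy s).trans (hx _)

theorem Pos.ne_one {x : BraidInf} (h : Pos x) : x ≠ 1 := by
  rintro rfl
  obtain ⟨i, a, ha, b, hb, h⟩ := h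
  let s : ℕ → PosRat × PosRat := fun _ => (1, 1)
  have h1 : (s i).1 < (dyn (a * σ i * b) s i).1 := by
    simp only [map_mul, Equiv.Perm.mul_apply]
    exact (fst_le_dyn hb s).trans_lt ((fst_lt_dyn_σ i _).trans_le (fst_le_dyn ha _))
  rw [← h, map_one] at h1
  exact lt_irrefl _ h1

end BraidInf

/-! ### The Artin group of type `B` inside the braid group -/

/-- The elements `s 0, …, s N` satisfy the Artin relations of type `B (N + 1)`. -/
structure IsTypeBSeq {G : Type*} [Group G] (N : ℕ) (s : ℕ → G) : Prop where
  comm : ∀ i j, i + 1 < j → j ≤ N → Commute (s i) (s j)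
  braid : ∀ i, i + 1 < N → s i * s (i + 1) * s i = s (i + 1) * s i * s (i + 1)
  four : ∀ i, i + 1 = N → s (i + 1) * s i * s (i + 1) * s i = s i * s (i + 1) * s i * s (i + 1)

namespace IsTypeBSeq

variable {G : Type*} [Group G] {N : ℕ} {s : ℕ → G}

/-- The element of index `N - d` in the orbit of `s N` under successive conjugation by
`s (N - 1), …, s 0`. -/
def tauAux (N : ℕ) (s : ℕ → G) : ℕ → G
  | 0 => s N
  | d + 1 => s (N - 1 - d) * tauAux N s d * (s (N - 1 - d))⁻¹

/-- The conjugate of `s N` by `s k * s (k + 1) * ⋯ * s (N - 1)`. -/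
def tau (N : ℕ) (s : ℕ → G) (k : ℕ) : G := tauAux N s (N - k)

theorem tau_self : tau N s N = s N := by simp [tau, tauAux]

theorem tau_of_lt {k : ℕ} (h : k < N) : tau N s k = s k * tau N s (k + 1) * (s k)⁻¹ := by
  obtain ⟨d, rfl⟩ : ∃ d, N = k + 1 + d := ⟨N - (k + 1), by omega⟩
  rw [tau, tau, show k + 1 + d - k = d + 1 by omega, show k + 1 + d - (k + 1) = d by omega,
    tauAux, show k + 1 + d - 1 - d = k by omega]

theorem tau_mul {k : ℕ} (h : k < N) : tau N s k * s k = s k * tau N s (k + 1) := by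
  rw [tau_of_lt h, inv_mul_cancel_right]

theorem comm_tau_of_lt (h : IsTypeBSeq N s) {j k : ℕ} (hjk : j + 1 < k) (hk : k ≤ N) :
    Commute (s j) (tau N s k) := by
  induction hk using Nat.decreasingInduction with
  | self => rw [tau_self]; exact h.comm _ _ hjk le_rfl
  | of_succ k hk ih =>
    rw [tau_of_lt hk]
    have h1 := h.comm _ _ hjk hk.le
    exact (h1.mul_right (ih (by omega))).mul_right h1.inv_right

theorem comm_tau_of_gt (h : IsTypeBSeq N s) {j k : ℕ} (hkj : k < j) (hj : j < N) :
    Commute (s j) (tau N s k) := by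
  obtain ⟨m, rfl⟩ : ∃ m, j = m + 1 := ⟨j - 1, by omega⟩
  have hkm := Nat.lt_succ_iff.1 hkj
  induction hkm using Nat.decreasingInduction with
  | self =>
    have h1 : SemiconjBy (s m * s (m + 1)) (s m) (s (m + 1)) := by
      simpa [SemiconjBy, mul_assoc] using h.braid m hj
    have h2 := (h.comm_tau_of_lt (Nat.lt_succ_self (m + 1)) hj).symm
    have h3 : tau N s m = s m * s (m + 1) * tau N s (m + 1 + 1) * (s m * s (m + 1))⁻¹ := by
      rw [tau_of_lt (by omega), tau_of_lt hj]
      group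
    rw [h3]
    exact Commute.symm ((h1.mul_left h2).mul_left h1.inv_symm_left)
  | of_succ k hk ih =>
    rw [tau_of_lt (by omega)]
    have h1 := (h.comm k (m + 1) (by omega) hj.le).symm
    exact (h1.mul_right (ih (by omega))).mul_right h1.inv_right

theorem tau_four (h : IsTypeBSeq N s) {k : ℕ} (hk : k < N) :
    tau N s (k + 1) * s k * tau N s (k + 1) * s k =
      s k * tau N s (k + 1) * s k * tau N s (k + 1) := by
  obtain ⟨N, rfl⟩ : ∃ M, N = M + 1 := ⟨N - 1, by omega⟩
  have hkN := Nat.lt_succ_iff.1 hk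
  induction hkN using Nat.decreasingInduction with
  | self => rw [tau_self]; exact h.four _ rfl
  | of_succ k hk' ih =>
    have h1 : MulAut.conj (s (k + 1) * s k) (s (k + 1)) = s k := by
      rw [MulAut.conj_apply, mul_inv_eq_iff_eq_mul, ← mul_assoc]
      exact (h.braid k (by omega)).symm
    have h2 : MulAut.conj (s (k + 1) * s k) (tau (N + 1) s (k + 1 + 1)) =
        tau (N + 1) s (k + 1) := by
      rw [MulAut.conj_apply, tau_of_lt (by omega : k + 1 < N + 1), mul_assoc (s (k + 1)),
        (h.comm_tau_of_lt (Nat.lt_succ_self (k + 1)) (by omega)).eq]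
      group
    have h3 := congrArg (MulAut.conj (s (k + 1) * s k)) (ih (by omega))
    generalize MulAut.conj (s (k + 1) * s k) = φ at h1 h2 h3
    simpa only [map_mul, h1, h2] using h3

/-- The permutation of `ℕ × G` which exchanges the fibres over `k` and `k + 1`, with a twist by
`t`, and translates the fibre over any other `i` by `c i`. -/
def swapPerm (k : ℕ) (t : G) (c : ℕ → G) : Equiv.Perm (ℕ × G) where
  toFun p := if p.1 = k + 1 then (k, p.2) else if p.1 = k then (k + 1, t * p.2)
    else (p.1, c p.1 * p.2)
  invFun p := if p.1 = k + 1 then (k, t⁻¹ * p.2) else if p.1 = k then (k + 1, p.2)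
    else (p.1, (c p.1)⁻¹ * p.2)
  left_inv p := by
    obtain ⟨i, a⟩ := p
    by_cases h1 : i = k + 1
    · simp [h1]
    · by_cases h2 : i = k <;> simp [h1, h2]
  right_inv p := by
    obtain ⟨i, a⟩ := p
    by_cases h1 : i = k + 1
    · simp [h1]
    · by_cases h2 : i = k <;> simp [h1, h2]

/-- The action of a braid generator on `ℕ × G`, recording the position of a distinguished
strand. -/
def strandPerm (N : ℕ) (s : ℕ → G) (k : ℕ) : Equiv.Perm (ℕ × G) :=
  swapPerm k (tau N s k) fun i => if N + 1 < i then 1 else if k + 1 < i then s k else s (k - 1)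

variable {k : ℕ}

theorem strandPerm_succ (k : ℕ) (a : G) : strandPerm N s k (k + 1, a) = (k, a) := by
  simp [strandPerm, swapPerm]

theorem strandPerm_self (k : ℕ) (a : G) :
    strandPerm N s k (k, a) = (k + 1, tau N s k * a) := by
  simp [strandPerm, swapPerm]

theorem strandPerm_of_gt {i : ℕ} (h : k + 1 < i) (hi : i ≤ N + 1) (a : G) :
    strandPerm N s k (i, a) = (i, s k * a) := by
  simp [strandPerm, swapPerm, h, hi.not_gt, h.ne', show i ≠ k by omega]

theorem strandPerm_of_lt {i : ℕ} (h : i ≤ k) (hk : k < N) (a : G) :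
    strandPerm N s (k + 1) (i, a) = (i, s k * a) := by
  simp [strandPerm, swapPerm, show i ≠ k + 1 + 1 by omega, show i ≠ k + 1 by omega,
    show ¬ N + 1 < i by omega, show ¬ k + 1 + 1 < i by omega]

theorem strandPerm_of_big {i : ℕ} (h : N + 1 < i) (hk : k ≤ N) (a : G) :
    strandPerm N s k (i, a) = (i, a) := by
  simp [strandPerm, swapPerm, show i ≠ k + 1 by omega, show i ≠ k by omega, h]

theorem isBraidSeq_strandPerm (h : IsTypeBSeq N s) :
    IsBraidSeq (Set.Iio (N + 1)) (strandPerm N s) where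
  comm k l _ hl hkl := by
    have hl : l < N + 1 := hl
    obtain ⟨l, rfl⟩ : ∃ m, l = m + 1 := ⟨l - 1, by omega⟩
    ext1 ⟨i, a⟩
    simp only [Equiv.Perm.mul_apply]
    rcases lt_or_ge (N + 1) i with hi | hi
    · simp only [strandPerm_of_big hi (show k ≤ N by omega),
        strandPerm_of_big hi (show l + 1 ≤ N by omega)]
    rcases lt_trichotomy i k with h1 | rfl | h1
    · obtain ⟨k, rfl⟩ : ∃ m, k = m + 1 := ⟨k - 1, by omega⟩
      simp only [strandPerm_of_lt (show i ≤ k by omega) (show k < N by omega),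
        strandPerm_of_lt (show i ≤ l by omega) (show l < N by omega)]
      rw [← mul_assoc, ← mul_assoc, (h.comm k l (by omega) (by omega)).eq]
    · rw [strandPerm_of_lt (by omega) (by omega), strandPerm_self, strandPerm_self,
        strandPerm_of_lt (by omega) (by omega), ← mul_assoc, ← mul_assoc,
        (h.comm_tau_of_gt (by omega) (by omega)).eq]
    rcases (show k + 1 ≤ i from h1).eq_or_lt with rfl | h1
    · rw [strandPerm_of_lt (by omega) (by omega), strandPerm_succ, strandPerm_succ,
        strandPerm_of_lt (by omega) (by omega)]
    rcases lt_trichotomy i (l + 1) with h2 | rfl | h2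
    · rw [strandPerm_of_lt (by omega) (by omega), strandPerm_of_gt h1 hi, strandPerm_of_gt h1 hi,
        strandPerm_of_lt (by omega) (by omega), ← mul_assoc, ← mul_assoc,
        (h.comm k l (by omega) (by omega)).eq]
    · rw [strandPerm_self, strandPerm_of_gt h1 hi, strandPerm_of_gt (by omega) (by omega),
        strandPerm_self, ← mul_assoc, ← mul_assoc, (h.comm_tau_of_lt (by omega) (by omega)).eq]
    rcases (show l + 1 + 1 ≤ i from h2).eq_or_lt with rfl | h2
    · rw [strandPerm_succ, strandPerm_of_gt h1 hi, strandPerm_of_gt (by omega) (by omega),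
        strandPerm_succ]
    · rw [strandPerm_of_gt h1 hi, strandPerm_of_gt h2 hi, strandPerm_of_gt h1 hi,
        strandPerm_of_gt h2 hi, ← mul_assoc, ← mul_assoc,
        (h.comm k (l + 1) (by omega) (by omega)).eq]
  braid k _ hk := by
    have hk : k + 1 < N + 1 := hk
    ext1 ⟨i, a⟩
    simp only [Equiv.Perm.mul_apply]
    rcases lt_or_ge (N + 1) i with hi | hi
    · simp only [strandPerm_of_big hi (show k ≤ N by omega),
        strandPerm_of_big hi (show k + 1 ≤ N by omega)]
    rcases lt_trichotomy i k with h1 | rfl | h1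
    · obtain ⟨k, rfl⟩ : ∃ m, k = m + 1 := ⟨k - 1, by omega⟩
      have hb := h.braid k (by omega)
      simp only [strandPerm_of_lt (show i ≤ k by omega) (show k < N by omega),
        strandPerm_of_lt (show i ≤ k + 1 by omega) (show k + 1 < N by omega), ← mul_assoc, hb]
    · rw [strandPerm_self, strandPerm_self, strandPerm_of_gt (Nat.lt_succ_self (i + 1)) (by omega),
        strandPerm_of_lt le_rfl (by omega), strandPerm_self, strandPerm_self]
      have h4 := h.tau_four (show i < N by omega)
      have h5 : s i * tau N s (i + 1) * tau N s i = tau N s (i + 1) * tau N s i * s i := by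
        rw [mul_assoc (tau _ _ _), tau_mul (by omega), tau_of_lt (show i < N by omega),
          ← mul_assoc, mul_inv_eq_iff_eq_mul, ← mul_assoc, ← mul_assoc, h4]
      simp only [← mul_assoc, h5]
    rcases (show k + 1 ≤ i from h1).eq_or_lt with rfl | h1
    · rw [strandPerm_succ, strandPerm_of_lt le_rfl (by omega), strandPerm_self, strandPerm_self,
        strandPerm_of_gt (Nat.lt_succ_self (k + 1)) (by omega), strandPerm_succ, ← mul_assoc,
        ← mul_assoc,
        tau_mul (by omega)]
    rcases (show k + 1 + 1 ≤ i from h1).eq_or_lt with rfl | h2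
    · rw [strandPerm_of_gt (Nat.lt_succ_self (k + 1)) hi, strandPerm_succ, strandPerm_succ,
        strandPerm_succ, strandPerm_succ, strandPerm_of_lt le_rfl (by omega)]
    · simp only [strandPerm_of_gt h1 hi, strandPerm_of_gt h2 hi, ← mul_assoc,
        h.braid k (by omega)]

end IsTypeBSeq

namespace ArtinB

variable {G : Type*} [Group G] {N : ℕ} {s : ℕ → G}

/-- The Artin generators of type `B (N + 1)`, extended by `1`. -/
def gen (N k : ℕ) : ArtinGroup (BTypeMatrix (N + 1)) :=
  if h : k < N + 1 then artinGen _ ⟨k, h⟩ else 1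

theorem gen_of_lt {k : ℕ} (h : k < N + 1) : gen N k = artinGen _ ⟨k, h⟩ := dif_pos h

theorem matrix_eq_two {i j : ℕ} (h : i + 1 < j) (hj : j < N + 1) :
    BTypeMatrix (N + 1) ⟨i, by omega⟩ ⟨j, hj⟩ = 2 := by
  simp only [BTypeMatrix, Fin.mk.injEq]
  split_ifs <;> omega

theorem matrix_eq_three {i : ℕ} (h : i + 1 < N) :
    BTypeMatrix (N + 1) ⟨i, by omega⟩ ⟨i + 1, by omega⟩ = 3 := by
  simp [BTypeMatrix, h.ne, show i + 1 + 1 ≠ i by omega]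

theorem matrix_eq_four (i : ℕ) :
    BTypeMatrix (i + 1 + 1) ⟨i, by omega⟩ ⟨i + 1, by omega⟩ = 4 := by
  simp [BTypeMatrix]

theorem matrix_symm {n : ℕ} (i j : Fin n) : BTypeMatrix n i j = BTypeMatrix n j i := by
  simp only [BTypeMatrix]
  split_ifs <;> omega

theorem isTypeBSeq_gen (N : ℕ) : IsTypeBSeq N (gen N) where
  comm i j hij hj := by
    have h := ArtinGroup.altProd_artinGen (BTypeMatrix (N + 1)) (i := ⟨i, by omega⟩)
      (j := ⟨j, by omega⟩) (by simp; omega) (by rw [matrix_eq_two hij]; decide)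
    rw [matrix_eq_two hij, ← gen_of_lt, ← gen_of_lt] at h
    simpa [altProd, Commute, SemiconjBy] using h
  braid i hi := by
    have h := ArtinGroup.altProd_artinGen (BTypeMatrix (N + 1)) (i := ⟨i, by omega⟩)
      (j := ⟨i + 1, by omega⟩) (by simp) (by rw [matrix_eq_three hi]; decide)
    rw [matrix_eq_three hi, ← gen_of_lt, ← gen_of_lt] at h
    simpa [altProd, mul_assoc] using h
  four i hi := by
    subst hi
    have h := ArtinGroup.altProd_artinGen (BTypeMatrix (i + 1 + 1)) (i := ⟨i, by omega⟩)
      (j := ⟨i + 1, by omega⟩) (by simp) (by rw [matrix_eq_four]; decide)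
    rw [matrix_eq_four, ← gen_of_lt, ← gen_of_lt] at h
    simpa [altProd, mul_assoc] using h.symm

/-- The homomorphism out of the Artin group of type `B` determined by elements satisfying its
relations. -/
def lift (s : ℕ → G) (h : IsTypeBSeq N s) : ArtinGroup (BTypeMatrix (N + 1)) →* G :=
  ArtinGroup.lift (fun i => s i) (by
    have key (i j : ℕ) (hi : i < N + 1) (hj : j < N + 1) (hij : i < j) :
        altProd (BTypeMatrix (N + 1) ⟨i, hi⟩ ⟨j, hj⟩) (s i) (s j) =
          altProd (BTypeMatrix (N + 1) ⟨i, hi⟩ ⟨j, hj⟩) (s j) (s i) := by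
      rcases (show i + 1 ≤ j from hij).eq_or_lt with rfl | h1
      · rcases (Nat.lt_succ_iff.1 hj).eq_or_lt with rfl | h2
        · rw [matrix_eq_four]
          simpa [altProd, mul_assoc] using (h.four i rfl).symm
        · rw [matrix_eq_three h2]
          simpa [altProd, mul_assoc] using h.braid i h2
      · rw [matrix_eq_two h1]
        simpa [altProd] using (h.comm i j h1 (by omega)).eq
    intro i j hij _
    rcases lt_or_gt_of_ne hij with h1 | h1
    · exact key i j i.2 j.2 h1
    · rw [matrix_symm]
      exact (key j i j.2 i.2 h1).symm)

theorem lift_gen (h : IsTypeBSeq N s) {k : ℕ} (hk : k ≤ N) : lift s h (gen N k) = s k := by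
  rw [gen_of_lt (Nat.lt_succ_of_le hk)]
  exact ArtinGroup.lift_artinGen _ _ _

theorem hom_ext {f g : ArtinGroup (BTypeMatrix (N + 1)) →* G}
    (h : ∀ k ≤ N, f (gen N k) = g (gen N k)) : f = g :=
  ArtinGroup.hom_ext fun i => by
    simpa [gen_of_lt i.2] using h i (Nat.lt_succ_iff.1 i.2)

theorem isTypeBSeq_of_isBraidSeq {u : ℕ → G} (h : IsBraidSeq (Set.Iio (N + 1)) u) :
    IsTypeBSeq N fun k => if k = N then u k ^ 2 else u k where
  comm i j hij hj := by
    have hi : i ≠ N := by omega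
    have h1 : Commute (u i) (u j) :=
      h.comm i j (show i < N + 1 by omega) (show j < N + 1 by omega) hij
    simp only [hi, if_false]
    split_ifs
    · exact h1.pow_right 2
    · exact h1
  braid i hi := by
    simpa [hi.ne, show i ≠ N by omega] using
      h.braid i (show i < N + 1 by omega) (show i + 1 < N + 1 by omega)
  four i hi := by
    subst hi
    have h1 := h.braid i (show i < i + 1 + 1 by omega) (show i + 1 < i + 1 + 1 by omega)
    simp only [if_true, show i ≠ i + 1 by omega, if_false, sq]
    generalize u i = a at *
    generalize u (i + 1) = b at *
    calc _ = b * (b * a * b) * b * a := by simp only [mul_assoc]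
      _ = (b * a * b) * (a * b * a) := by nth_rw 1 [← h1]; simp only [mul_assoc]
      _ = (a * b * a) * (b * a * b) := by rw [h1]
      _ = a * b * (b * a * b) * b := by nth_rw 2 [← h1]; simp only [mul_assoc]
      _ = _ := by simp only [mul_assoc]

/-- The homomorphism from the Artin group of type `B` to the braid group which squares the last
generator. -/
noncomputable def toBraid (N : ℕ) :
    ArtinGroup (BTypeMatrix (N + 1)) →* BraidGroup (Set.Iio (N + 1)) :=
  lift _ (isTypeBSeq_of_isBraidSeq (BraidGroup.isBraidSeq_gen (Set.Iio (N + 1))))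

theorem toBraid_gen_of_lt {k : ℕ} (h : k < N) :
    toBraid N (gen N k) = BraidGroup.gen (Set.Iio (N + 1)) k := by
  rw [toBraid, lift_gen _ h.le, if_neg h.ne]

theorem toBraid_gen_self :
    toBraid N (gen N N) = BraidGroup.gen (Set.Iio (N + 1)) N ^ 2 := by
  rw [toBraid, lift_gen _ le_rfl, if_pos rfl]

theorem toBraid_injective (N : ℕ) : Function.Injective (toBraid N) := by
  let Φ := BraidGroup.lift _ (isTypeBSeq_gen N).isBraidSeq_strandPerm
  have hΦ (k : ℕ) (hk : k ≤ N) : Φ (BraidGroup.gen _ k) = IsTypeBSeq.strandPerm N (gen N) k :=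
    BraidGroup.lift_gen _ (Nat.lt_succ_of_le hk)
  have key (g : ArtinGroup (BTypeMatrix (N + 1))) :
      ∀ a, Φ (toBraid N g) (N + 1, a) = (N + 1, g * a) := by
    have hg : g ∈ Subgroup.closure (Set.range (artinGen (BTypeMatrix (N + 1)))) :=
      ArtinGroup.closure_range_artinGen (BTypeMatrix (N + 1)) ▸ Subgroup.mem_top g
    induction hg using Subgroup.closure_induction with
    | mem x hx =>
      obtain ⟨⟨k, hk⟩, rfl⟩ := hx
      intro a
      rw [← gen_of_lt]
      rcases (Nat.lt_succ_iff.1 hk).eq_or_lt with rfl | hk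
      · rw [toBraid_gen_self, map_pow, hΦ k le_rfl, sq, Equiv.Perm.mul_apply,
          IsTypeBSeq.strandPerm_succ, IsTypeBSeq.strandPerm_self, IsTypeBSeq.tau_self]
      · rw [toBraid_gen_of_lt hk, hΦ k hk.le, IsTypeBSeq.strandPerm_of_gt (by omega) le_rfl]
    | one => simp
    | mul x y _ _ hx hy =>
      intro a
      rw [map_mul, map_mul, Equiv.Perm.mul_apply, hy, hx, mul_assoc]
    | inv x _ hx =>
      intro a
      rw [map_inv, map_inv, Equiv.Perm.inv_eq_iff_eq, hx, mul_inv_cancel_left]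
  rw [injective_iff_map_eq_one]
  intro g hg
  have h := key g 1
  rw [hg, map_one, mul_one] at h
  exact (congrArg Prod.snd h).symm

theorem isTypeBSeq_braidGen (N : ℕ) : IsTypeBSeq N (BraidGroup.gen (Set.Iio N)) where
  comm i j hij hj := by
    rcases hj.eq_or_lt with rfl | hj
    · rw [BraidGroup.gen_of_notMem (i := j) (by simp)]
      exact .one_right _
    · exact (BraidGroup.isBraidSeq_gen _).comm i j (show i < N by omega) hj hij
  braid i hi := (BraidGroup.isBraidSeq_gen _).braid i (show i < N by omega) hi
  four i hi := by
    subst hi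
    rw [BraidGroup.gen_of_notMem (i := i + 1) (by simp)]
    simp

end ArtinB

namespace BraidGroup

/-- The homomorphism between parabolic braid groups induced by an inclusion of index sets. -/
noncomputable def incl {S T : Set ℕ} (h : S ⊆ T) : BraidGroup S →* BraidGroup T :=
  lift (gen T) ((isBraidSeq_gen T).mono h)

theorem incl_gen {S T : Set ℕ} (h : S ⊆ T) {i : ℕ} (hi : i ∈ S) : incl h (gen S i) = gen T i :=
  lift_gen _ hi

theorem Iio_subset_succ (N : ℕ) : Set.Iio N ⊆ Set.Iio (N + 1) :=
  Set.Iio_subset_Iio N.le_succ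

theorem incl_succ_injective (N : ℕ) : Function.Injective (incl (Iio_subset_succ N)) := by
  have hB : IsBraidSeq (Set.Iio N) (ArtinB.gen N) :=
    ⟨fun i j _ hj hij => (ArtinB.isTypeBSeq_gen N).comm i j hij (le_of_lt hj),
      fun i _ hi => (ArtinB.isTypeBSeq_gen N).braid i hi⟩
  have h1 : (ArtinB.lift _ (ArtinB.isTypeBSeq_braidGen N)).comp (lift _ hB) =
      MonoidHom.id (BraidGroup (Set.Iio N)) := by
    refine hom_ext fun i hi => ?_
    rw [MonoidHom.comp_apply, lift_gen _ hi, ArtinB.lift_gen _ (le_of_lt hi), MonoidHom.id_apply]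
  have h2 : incl (Iio_subset_succ N) = (ArtinB.toBraid N).comp (lift _ hB) := by
    refine hom_ext fun i hi => ?_
    rw [MonoidHom.comp_apply, lift_gen _ hi, ArtinB.toBraid_gen_of_lt hi, incl_gen _ hi]
  rw [h2]
  exact (ArtinB.toBraid_injective N).comp
    (Function.LeftInverse.injective fun x => DFunLike.congr_fun h1 x)

theorem incl_Iio_injective {n M : ℕ} (h : n ≤ M) :
    Function.Injective (incl (Set.Iio_subset_Iio h)) := by
  induction M, h using Nat.le_induction with
  | base =>
    have : incl (Set.Iio_subset_Iio le_rfl) = MonoidHom.id (BraidGroup (Set.Iio n)) :=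
      hom_ext fun i hi => incl_gen _ hi
    rw [this]
    exact Function.injective_id
  | succ M h ih =>
    have : incl (Set.Iio_subset_Iio (h.trans M.le_succ)) =
        (incl (Iio_subset_succ M)).comp (incl (Set.Iio_subset_Iio h)) := by
      refine hom_ext fun i hi => ?_
      rw [MonoidHom.comp_apply, incl_gen _ hi, incl_gen _ hi,
        incl_gen _ (Set.Iio_subset_Iio h hi)]
    rw [this]
    exact (incl_succ_injective M).comp ih

/-- The sequences of braids which are eventually trivial. -/
def eventuallyOne : Subgroup (∀ M : ℕ, BraidGroup (Set.Iio M)) where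
  carrier := {f | ∀ᶠ M in Filter.atTop, f M = 1}
  one_mem' := .of_forall fun _ => rfl
  mul_mem' hf hg := by filter_upwards [hf, hg] with M h1 h2; simp [h1, h2]
  inv_mem' hf := by filter_upwards [hf] with M h1; simp [h1]

instance : eventuallyOne.Normal where
  conj_mem f hf g := by
    have hf : ∀ᶠ M in Filter.atTop, f M = 1 := hf
    filter_upwards [hf] with M h1
    simp [h1]

theorem mk_eq_mk {f g : ∀ M : ℕ, BraidGroup (Set.Iio M)} (n : ℕ) (h : ∀ M, n ≤ M → f M = g M) :
    QuotientGroup.mk' eventuallyOne f = QuotientGroup.mk' eventuallyOne g := by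
  refine QuotientGroup.eq.2 ?_
  filter_upwards [Filter.eventually_ge_atTop n] with M hM
  simp [h M hM]

theorem incl_univ_injective (n : ℕ) :
    Function.Injective (incl (Set.subset_univ (Set.Iio n))) := by
  have hs : IsBraidSeq Set.univ fun i =>
      QuotientGroup.mk' eventuallyOne fun M => gen (Set.Iio M) i := by
    constructor
    · intro i j _ _ hij
      rw [← map_mul, ← map_mul]
      exact mk_eq_mk (j + 1) fun M hM =>
        (isBraidSeq_gen _).comm i j (show i < M by omega) (show j < M by omega) hij
    · intro i _ _
      rw [← map_mul, ← map_mul, ← map_mul, ← map_mul]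
      exact mk_eq_mk (i + 2) fun M hM =>
        (isBraidSeq_gen _).braid i (show i < M by omega) (show i + 1 < M by omega)
  let Ψ : BraidGroup (Set.Iio n) →* ∀ M : ℕ, BraidGroup (Set.Iio M) :=
    MonoidHom.pi fun M => if h : n ≤ M then incl (Set.Iio_subset_Iio h) else 1
  have hΨ (x : BraidGroup (Set.Iio n)) {M : ℕ} (h : n ≤ M) :
      Ψ x M = incl (Set.Iio_subset_Iio h) x := by
    simp [Ψ, MonoidHom.pi_apply, h]
  have key : (QuotientGroup.mk' eventuallyOne).comp Ψ =
      (lift _ hs).comp (incl (Set.subset_univ _)) := by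
    refine hom_ext fun i hi => ?_
    rw [MonoidHom.comp_apply, MonoidHom.comp_apply, incl_gen _ hi, lift_gen _ (Set.mem_univ i)]
    exact mk_eq_mk n fun M hM => by rw [hΨ _ hM, incl_gen _ hi]
  rw [injective_iff_map_eq_one]
  intro x hx
  have h1 := DFunLike.congr_fun key x
  rw [MonoidHom.comp_apply, MonoidHom.comp_apply, hx, map_one] at h1
  have h2 : ∀ᶠ M in Filter.atTop, Ψ x M = 1 := (QuotientGroup.eq_one_iff _).1 h1
  obtain ⟨M, hM, h3⟩ := (h2.and (Filter.eventually_ge_atTop n)).exists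
  rw [hΨ x h3] at hM
  exact (injective_iff_map_eq_one _).1 (incl_Iio_injective h3) x hM

end BraidGroup

/-- The left-invariant linear order determined by a positive cone. -/
theorem exists_linearOrder_of_cone {G : Type*} [Group G] (P : G → Prop)
    (hmul : ∀ x y, P x → P y → P (x * y)) (hone : ¬ P 1) (htri : ∀ x, x = 1 ∨ P x ∨ P x⁻¹) :
    ∃ lo : LinearOrder G, ∀ x y, lo.lt x y ↔ P (x⁻¹ * y) := by
  classical
  have hanti (x y : G) (h1 : P (x⁻¹ * y)) (h2 : P (y⁻¹ * x)) : False :=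
    hone (by simpa [mul_assoc] using hmul _ _ h1 h2)
  refine ⟨{
    le := fun x y => x = y ∨ P (x⁻¹ * y)
    lt := fun x y => P (x⁻¹ * y)
    le_refl := fun x => .inl rfl
    le_trans := ?_
    lt_iff_le_not_ge := ?_
    le_antisymm := ?_
    le_total := ?_
    toDecidableLE := Classical.decRel _ }, fun x y => Iff.rfl⟩
  · rintro x y z (rfl | h1) (rfl | h2)
    · exact .inl rfl
    · exact .inr h2
    · exact .inr h1
    · exact .inr (by simpa [mul_assoc] using hmul _ _ h1 h2)
  · intro x y
    refine ⟨fun h => ⟨.inr h, ?_⟩, ?_⟩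
    · rintro (rfl | h2)
      · exact hone (by simpa using h)
      · exact hanti _ _ h h2
    · rintro ⟨rfl | h, h2⟩
      · exact absurd (.inl rfl) h2
      · exact h
  · rintro x y (rfl | h1) (h | h2)
    · rfl
    · rfl
    · exact h.symm
    · exact (hanti _ _ h1 h2).elim
  · intro x y
    rcases htri (x⁻¹ * y) with h | h | h
    · exact .inl (.inl (inv_mul_eq_one.1 h))
    · exact .inl (.inr h)
    · exact .inr (.inr (by simpa using h))

namespace ArtinB

/-- The embedding of the Artin group of type `B` in the braid group on infinitely many
strands. -/
noncomputable def toBraidInf (N : ℕ) : ArtinGroup (BTypeMatrix (N + 1)) →* BraidInf :=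
  (BraidGroup.incl (Set.subset_univ _)).comp (toBraid N)

theorem toBraidInf_injective (N : ℕ) : Function.Injective (toBraidInf N) :=
  (BraidGroup.incl_univ_injective _).comp (toBraid_injective N)

theorem reverse_toBraidInf {rev : ArtinGroup (BTypeMatrix (N + 1)) →
      ArtinGroup (BTypeMatrix (N + 1))}
    (hmul : ∀ x y, rev (x * y) = rev y * rev x)
    (hgen : ∀ i, rev (artinGen (BTypeMatrix (N + 1)) i) = artinGen (BTypeMatrix (N + 1)) i)
    (x : ArtinGroup (BTypeMatrix (N + 1))) :
    toBraidInf N (rev x) = (BraidInf.reverse (toBraidInf N x)).unop := by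
  let r : ArtinGroup (BTypeMatrix (N + 1)) →* (ArtinGroup (BTypeMatrix (N + 1)))ᵐᵒᵖ :=
    MonoidHom.mk' (fun x => MulOpposite.op (rev x)) fun x y => by rw [hmul, MulOpposite.op_mul]
  have key : (MonoidHom.op (toBraidInf N)).comp r = BraidInf.reverse.comp (toBraidInf N) := by
    refine hom_ext fun k hk => MulOpposite.unop_injective ?_
    have hk' : k < N + 1 := Nat.lt_succ_of_le hk
    have hmem : k ∈ Set.Iio (N + 1) := hk'
    have hr : rev (gen N k) = gen N k := by rw [gen_of_lt hk']; exact hgen _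
    change toBraidInf N (rev (gen N k)) = (BraidInf.reverse (toBraidInf N (gen N k))).unop
    rw [hr, toBraidInf, MonoidHom.comp_apply]
    rcases hk.eq_or_lt with rfl | hk
    · rw [toBraid_gen_self, map_pow, BraidGroup.incl_gen _ hmem, map_pow, MulOpposite.unop_pow]
      exact congrArg (· ^ 2) (congrArg MulOpposite.unop (BraidInf.reverse_σ k).symm)
    · rw [toBraid_gen_of_lt hk, BraidGroup.incl_gen _ hmem]
      exact congrArg MulOpposite.unop (BraidInf.reverse_σ k).symm
  exact congrArg MulOpposite.unop (DFunLike.congr_fun key x)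

end ArtinB

/-- For every `n ≥ 2`, the Artin group of type `B n` admits a left-invariant
linear order `<` such that `x > 1` iff `rev x > 1`, where `rev` is the (unique) involutive
anti-automorphism fixing each Artin generator. -/
theorem artinB_exists_leftInvariant_order_compatible_with_rev
    (n : ℕ) (hn : 2 ≤ n)
    (rev : ArtinGroup (BTypeMatrix n) → ArtinGroup (BTypeMatrix n))
    (hmul : ∀ x y, rev (x * y) = rev y * rev x)
    (hinv : ∀ x, rev (rev x) = x)
    (hgen : ∀ i : Fin n, rev (artinGen (BTypeMatrix n) i) = artinGen (BTypeMatrix n) i) :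
    ∃ lo : LinearOrder (ArtinGroup (BTypeMatrix n)),
      (∀ a x y : ArtinGroup (BTypeMatrix n), lo.lt x y → lo.lt (a * x) (a * y)) ∧
      (∀ x : ArtinGroup (BTypeMatrix n), lo.lt 1 x ↔ lo.lt 1 (rev x)) := by
  obtain ⟨N, rfl⟩ : ∃ N, n = N + 1 := ⟨n - 1, by omega⟩
  obtain ⟨lo, hlo⟩ := exists_linearOrder_of_cone (fun x => BraidInf.Pos (ArtinB.toBraidInf N x))
    (fun x y hx hy => by simpa using hx.mul hy)
    (fun h => h.ne_one (map_one _))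
    (fun x => by
      simpa [map_eq_one_iff _ (ArtinB.toBraidInf_injective N)] using
        BraidInf.trichotomy (ArtinB.toBraidInf N x))
  have hpos (x : ArtinGroup (BTypeMatrix (N + 1))) (h : BraidInf.Pos (ArtinB.toBraidInf N x)) :
      BraidInf.Pos (ArtinB.toBraidInf N (rev x)) := by
    rw [ArtinB.reverse_toBraidInf hmul hgen]
    exact h.imp fun _ hi => hi.reverse
  refine ⟨lo, fun a x y h => ?_, fun x => ?_⟩
  · rw [hlo] at h ⊢
    rwa [mul_inv_rev, mul_assoc, inv_mul_cancel_left]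
  · rw [hlo, hlo, inv_one, one_mul, one_mul]
    exact ⟨hpos x, fun h => hinv x ▸ hpos _ h⟩
end

section
/- For every n ≥ 4, the Artin group A of type D n admits a left-invariant linear order < such that for all x ∈ A, x > 1 if and only if rev x > 1. -/
/-- The Coxeter matrix of type `Dₙ` (indices `0, …, n-1` correspond to `s 1, …, s n`):
`m i (i+1) = 3` for consecutive pairs along the path `s 1, …, s (n-1)`, the extra edge
`m (n-2) n = 3`, and all other off-diagonal entries equal to `2`. -/
def DTypeMatrix (n : ℕ) : Fin n → Fin n → ℕ := fun i j =>
  if i = j then 1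
  else if ((i : ℕ) + 1 = (j : ℕ) ∧ (j : ℕ) ≤ n - 2) ∨
          ((j : ℕ) + 1 = (i : ℕ) ∧ (i : ℕ) ≤ n - 2) then 3
  else if ((i : ℕ) = n - 3 ∧ (j : ℕ) = n - 1) ∨
          ((j : ℕ) = n - 3 ∧ (i : ℕ) = n - 1) then 3
  else 2

/-! ### The free product of countably many groups of order two -/

/-- The free product of copies of the group of order two, indexed by `ℕ`. -/
abbrev InvGroup : Type := PresentedGroup (Set.range fun i : ℕ => FreeGroup.of i * FreeGroup.of i)

namespace InvGroup

/-- The generating involutions. -/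
def x (i : ℕ) : InvGroup := PresentedGroup.of i

@[simp] lemma x_mul_self (i : ℕ) : x i * x i = 1 :=
  PresentedGroup.one_of_mem ⟨i, rfl⟩

@[simp] lemma x_mul_x_mul (i : ℕ) (g : InvGroup) : x i * (x i * g) = g := by
  rw [← mul_assoc, x_mul_self, one_mul]

@[simp] lemma x_inv (i : ℕ) : (x i)⁻¹ = x i := inv_eq_of_mul_eq_one_left (x_mul_self i)

/-- The homomorphism determined by a family of involutions. -/
def lift {G : Type*} [Group G] (f : ℕ → G) (h : ∀ i, f i * f i = 1) : InvGroup →* G :=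
  PresentedGroup.toGroup (f := f) (by rintro _ ⟨i, rfl⟩; simpa using h i)

@[simp] lemma lift_x {G : Type*} [Group G] (f : ℕ → G) (h : ∀ i, f i * f i = 1) (i : ℕ) :
    lift f h (x i) = f i := PresentedGroup.toGroup.of _

lemma hom_ext {G : Type*} [Group G] {f g : InvGroup →* G} (h : ∀ i, f (x i) = g (x i)) :
    f = g := PresentedGroup.ext h

/-- The element represented by a list of indices. -/
def ofList (l : List ℕ) : InvGroup := (l.map x).prod

@[simp] lemma ofList_nil : ofList [] = 1 := rfl
@[simp] lemma ofList_cons (i : ℕ) (l : List ℕ) : ofList (i :: l) = x i * ofList l := by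
  simp [ofList]
@[simp] lemma ofList_append (l m : List ℕ) : ofList (l ++ m) = ofList l * ofList m := by
  simp [ofList]
lemma ofList_reverse (l : List ℕ) : ofList l.reverse = (ofList l)⁻¹ := by
  induction l with
  | nil => simp
  | cons a l ih => simp [ih]

/-- Left multiplication by a generator on reduced words. -/
def toggle (i : ℕ) : List ℕ → List ℕ
  | [] => [i]
  | j :: l => if i = j then l else i :: j :: l

/-- A list is reduced if adjacent entries are distinct. -/
abbrev Reduced (l : List ℕ) : Prop := l.IsChain (· ≠ ·)

lemma Reduced.of_cons {i : ℕ} {l : List ℕ} (h : Reduced (i :: l)) : Reduced l := h.tail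

lemma Reduced.toggle {l : List ℕ} (h : Reduced l) (i : ℕ) : Reduced (toggle i l) := by
  cases l with
  | nil => exact .singleton _
  | cons j l =>
    by_cases hij : i = j
    · simpa [InvGroup.toggle, hij] using h.tail
    · simp only [InvGroup.toggle, if_neg hij]; exact .cons_cons hij h

lemma toggle_toggle {l : List ℕ} (h : Reduced l) (i : ℕ) : toggle i (toggle i l) = l := by
  rcases l with _ | ⟨j, _ | ⟨k, l⟩⟩
  · simp [toggle]
  · by_cases hij : i = j <;> simp [toggle, hij]
  · have := List.isChain_cons_cons.1 h
    by_cases hij : i = j <;> simp [toggle, hij, this.1]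

lemma ofList_toggle (i : ℕ) (l : List ℕ) : ofList (toggle i l) = x i * ofList l := by
  cases l with
  | nil => simp [toggle]
  | cons j l => by_cases hij : i = j <;> simp [toggle, hij]

/-- The action on reduced words. -/
def wordAction : InvGroup →* Equiv.Perm {l : List ℕ // Reduced l} :=
  lift (fun i => Function.Involutive.toPerm (fun l => ⟨toggle i l.1, l.2.toggle i⟩)
    (fun l => Subtype.ext (toggle_toggle l.2 i))) (fun i => by
      ext l : 2
      exact toggle_toggle l.2 i)

/-- The reduced word of an element. -/
def word (g : InvGroup) : List ℕ := (wordAction g ⟨[], .nil⟩).1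

lemma reduced_word (g : InvGroup) : Reduced (word g) := (wordAction g ⟨[], .nil⟩).2

@[simp] lemma word_one : word 1 = [] := by simp [word]

@[simp] lemma word_x_mul (i : ℕ) (g : InvGroup) : word (x i * g) = toggle i (word g) := by
  simp only [word, map_mul, Equiv.Perm.mul_apply]
  simp only [wordAction, lift_x]
  rfl

lemma word_ofList {l : List ℕ} (h : Reduced l) : word (ofList l) = l := by
  induction l with
  | nil => simp
  | cons i l ih =>
    rw [ofList_cons, word_x_mul, ih h.tail]
    cases l with
    | nil => rfl
    | cons j l => simp [toggle, (List.isChain_cons_cons.1 h).1]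

@[elab_as_elim]
lemma induction {C : InvGroup → Prop} (g : InvGroup) (one : C 1)
    (mul : ∀ i g, C g → C (x i * g)) : C g := by
  have hg : g ∈ Subgroup.closure (Set.range x) := by
    rw [show Set.range x = Set.range PresentedGroup.of from rfl,
      PresentedGroup.closure_range_of]; trivial
  induction hg using Subgroup.closure_induction_left with
  | one => exact one
  | mul_left a ha y hy ih => obtain ⟨i, rfl⟩ := ha; exact mul _ _ ih
  | inv_mul_cancel a ha y hy ih => obtain ⟨i, rfl⟩ := ha; rw [x_inv]; exact mul _ _ ih

@[simp] lemma ofList_word (g : InvGroup) : ofList (word g) = g := by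
  induction g using induction with
  | one => simp
  | mul i g ih => rw [word_x_mul, ofList_toggle, ih]

lemma exists_reduced (g : InvGroup) : ∃ l, Reduced l ∧ ofList l = g :=
  ⟨word g, reduced_word g, ofList_word g⟩

/-! ### The ascent number -/

/-- The sign of `b - a`. -/
def step (a b : ℕ) : ℤ := if a < b then 1 else if b < a then -1 else 0

/-- The number of ascents minus the number of descents of a list. -/
def asc : List ℕ → ℤ
  | [] => 0
  | [_] => 0
  | a :: b :: l => step a b + asc (b :: l)

@[simp] lemma asc_nil : asc [] = 0 := rfl
@[simp] lemma asc_singleton (a : ℕ) : asc [a] = 0 := rfl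
@[simp] lemma asc_cons_cons (a b : ℕ) (l : List ℕ) :
    asc (a :: b :: l) = step a b + asc (b :: l) := rfl

lemma asc_reverse_append (u v : List ℕ) (c : ℕ) :
    asc (u.reverse ++ c :: v) = asc (c :: v) - asc (c :: u) := by
  induction u generalizing c v with
  | nil => simp
  | cons a u ih =>
    simp only [List.reverse_cons, List.append_assoc, List.singleton_append, ih, asc_cons_cons]
    grind [step]

lemma asc_reverse (u : List ℕ) : asc u.reverse = -asc u := by
  cases u with
  | nil => simp
  | cons c u => simpa using asc_reverse_append u [] c

lemma reduced_reverse_append {u v : List ℕ} {c : ℕ} (hu : Reduced (c :: u))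
    (hv : Reduced (c :: v)) : Reduced (u.reverse ++ c :: v) := by
  induction u generalizing c v with
  | nil => simpa
  | cons a u ih =>
    simp only [List.reverse_cons, List.append_assoc, List.singleton_append]
    have := List.isChain_cons_cons.1 hu
    exact ih this.2 (.cons_cons this.1.symm hv)

lemma reduced_reverse {u : List ℕ} (hu : Reduced u) : Reduced u.reverse := by
  cases u with
  | nil => simp
  | cons c u => simpa using reduced_reverse_append hu (.singleton c)

/-- The ascent number of the reduced word of an element. -/
def s (g : InvGroup) : ℤ := asc (word g)

lemma s_ofList {l : List ℕ} (h : Reduced l) : s (ofList l) = asc l := by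
  rw [s, word_ofList h]

@[simp] lemma s_one : s 1 = 0 := by simp [s]

lemma s_inv (g : InvGroup) : s g⁻¹ = -s g := by
  obtain ⟨l, hl, rfl⟩ := exists_reduced g
  rw [← ofList_reverse, s_ofList (reduced_reverse hl), s_ofList hl, asc_reverse]

lemma s_inv_mul_of_ne {p q : ℕ} {u v : List ℕ} (hu : Reduced (p :: u)) (hv : Reduced (q :: v))
    (hpq : p ≠ q) : s ((ofList (p :: u))⁻¹ * ofList (q :: v)) =
      asc (q :: v) - asc (p :: u) + step p q := by
  have h : Reduced ((p :: u).reverse ++ q :: v) := by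
    simpa using reduced_reverse_append hu (.cons_cons hpq hv)
  rw [← ofList_reverse, ← ofList_append, s_ofList h, asc_reverse_append]
  simp only [asc_cons_cons]
  grind [step]

lemma abs_s_inv_mul_le {u v : List ℕ} (hu : Reduced u) (hv : Reduced v) :
    |s ((ofList u)⁻¹ * ofList v) - (asc v - asc u)| ≤ 1 := by
  induction u generalizing v with
  | nil => simp [s_ofList hv]
  | cons c u ih =>
    cases v with
    | nil => simp [s_inv, s_ofList hu, -ofList_cons]
    | cons d v =>
      by_cases hcd : c = d
      · subst hcd
        rw [show (ofList (c :: u))⁻¹ * ofList (c :: v) = (ofList u)⁻¹ * ofList v by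
          simp [mul_assoc]]
        rcases u with _ | ⟨p, u⟩ <;> rcases v with _ | ⟨q, v⟩
        · simp
        · simp only [ofList_nil, inv_one, one_mul, s_ofList hv.of_cons, asc_cons_cons,
            asc_singleton, abs_le]
          grind [step]
        · simp only [ofList_nil, mul_one, s_inv, s_ofList hu.of_cons, asc_cons_cons,
            asc_singleton, abs_le]
          grind [step]
        · by_cases hpq : p = q
          · subst hpq
            simpa using ih hu.of_cons hv.of_cons
          · rw [s_inv_mul_of_ne hu.of_cons hv.of_cons hpq]
            have h₁ := (List.isChain_cons_cons.1 hu).1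
            have h₂ := (List.isChain_cons_cons.1 hv).1
            simp only [asc_cons_cons, abs_le]
            grind [step]
      · rw [s_inv_mul_of_ne hu hv hcd, abs_le]
        grind [step]

lemma s_add_s_le (g h : InvGroup) : s g + s h ≤ s (g * h) + 1 := by
  obtain ⟨u, hu, hug⟩ := exists_reduced g⁻¹
  obtain ⟨v, hv, rfl⟩ := exists_reduced h
  obtain rfl : g = (ofList u)⁻¹ := by simp [hug]
  have := abs_le.1 (abs_s_inv_mul_le hu hv)
  rw [s_inv, s_ofList hu, s_ofList hv]
  linarith

lemma s_mul_pos {g h : InvGroup} (hg : 0 < s g) (hh : 0 < s h) : 0 < s (g * h) := by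
  linarith [s_add_s_le g h, hg, hh]

/-- The parity homomorphism. -/
def parity : InvGroup →* ℤˣ := lift (fun _ => -1) (by simp)

lemma odd_asc {l : List ℕ} (hl : Reduced l) (hne : l ≠ []) : Odd (asc l + l.length) := by
  induction l with
  | nil => simp at hne
  | cons a l ih =>
    cases l with
    | nil => simp
    | cons b l =>
      have h₁ := List.isChain_cons_cons.1 hl
      obtain ⟨k, hk⟩ := ih h₁.2 (by simp)
      simp only [asc_cons_cons, List.length_cons, Nat.cast_add, Nat.cast_one] at hk ⊢
      rcases lt_or_gt_of_ne h₁.1 with h | h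
      · exact ⟨k + 1, by simp [step, h]; linarith⟩
      · exact ⟨k, by simp [step, h, h.le.not_gt]; linarith⟩

lemma parity_ofList (l : List ℕ) : parity (ofList l) = (-1) ^ l.length := by
  induction l with
  | nil => simp
  | cons a l ih => rw [ofList_cons, map_mul, ih, List.length_cons, pow_succ', parity, lift_x]

lemma eq_one_of_s_eq_zero {g : InvGroup} (hg : parity g = 1) (hs : s g = 0) : g = 1 := by
  obtain ⟨l, hl, rfl⟩ := exists_reduced g
  by_contra hne
  have h := odd_asc hl (by rintro rfl; simp at hne)
  rw [s_ofList hl] at hs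
  rw [hs, zero_add] at h
  rw [parity_ofList, Odd.neg_one_pow (by exact_mod_cast h)] at hg
  exact absurd hg (by decide)

/-- The automorphism determined by mutually inverse families of involutions. -/
def mkAut (f g : ℕ → InvGroup) (hf : ∀ i, f i * f i = 1) (hg : ∀ i, g i * g i = 1)
    (hgf : ∀ i, lift g hg (f i) = x i) (hfg : ∀ i, lift f hf (g i) = x i) : MulAut InvGroup :=
  MonoidHom.toMulEquiv (lift f hf) (lift g hg) (hom_ext fun i => by simp [hgf])
    (hom_ext fun i => by simp [hfg])

lemma aut_ext {f g : MulAut InvGroup} (h : ∀ i, f (x i) = g (x i)) : f = g := by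
  have : f.toMonoidHom = g.toMonoidHom := hom_ext h
  ext w
  exact DFunLike.congr_fun this w

lemma conj_mul_conj (g : InvGroup) (i : ℕ) : g * x i * g⁻¹ * (g * x i * g⁻¹) = 1 := by
  simp [mul_assoc]

/-- The elementary braid automorphism. -/
def sigma (i : ℕ) : MulAut InvGroup :=
  mkAut (fun j => if j = i then x i * x (i + 1) * x i else if j = i + 1 then x i else x j)
    (fun j => if j = i then x (i + 1) else if j = i + 1 then x (i + 1) * x i * x (i + 1) else x j)
    (fun j => by split_ifs <;> simp [mul_assoc])
    (fun j => by split_ifs <;> simp [mul_assoc])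
    (fun j => by split_ifs <;> simp [mul_assoc, *])
    (fun j => by split_ifs <;> simp [mul_assoc, *])

@[simp] lemma sigma_self (i : ℕ) : sigma i (x i) = x i * x (i + 1) * x i := by
  simp [sigma, mkAut]

@[simp] lemma sigma_succ (i : ℕ) : sigma i (x (i + 1)) = x i := by
  simp [sigma, mkAut]

lemma sigma_of_ne {i j : ℕ} (h : j ≠ i) (h' : j ≠ i + 1) : sigma i (x j) = x j := by
  simp [sigma, mkAut, h, h']

/-- The possible shapes of a reduced word `l` and of the reduced word of its image under
`sigma i`. -/
inductive SigmaShape (i : ℕ) : List ℕ → List ℕ → Prop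
  | nil : SigmaShape i [] []
  | fst (l q) : SigmaShape i (i :: l) (i :: (i + 1) :: q)
  | snd (l q) (h : q.head? ≠ some (i + 1)) : SigmaShape i ((i + 1) :: l) (i :: q)
  | snd' (l q) : SigmaShape i ((i + 1) :: l) ((i + 1) :: q)
  | other (c l q) (h : c ≠ i) (h' : c ≠ i + 1) : SigmaShape i (c :: l) (c :: q)

lemma sigmaShape_word (i : ℕ) {l : List ℕ} (hl : Reduced l) :
    SigmaShape i l (word (sigma i (ofList l))) ∧ asc (word (sigma i (ofList l))) = asc l := by
  induction l with
  | nil => simpa using .nil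
  | cons c l ih =>
    obtain ⟨h₁, h₂⟩ := ih hl.of_cons
    have hr := reduced_word (sigma i (ofList l))
    rw [ofList_cons, map_mul]
    generalize sigma i (ofList l) = g at *
    have hw : word (sigma i (x c) * g) = if c = i then toggle i (toggle (i + 1) (toggle i (word g)))
        else if c = i + 1 then toggle i (word g) else toggle c (word g) := by
      split_ifs with h h'
      · subst h; simp [mul_assoc]
      · subst h'; simp
      · simp [sigma_of_ne h h']
    rw [hw]
    generalize word g = r at *
    clear hw g
    by_cases hc : c = i
    · subst hc
      simp only [if_true]
      cases h₁ with
      | nil => simpa [toggle, step] using SigmaShape.fst _ _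
      | fst l q => simp at hl
      | snd l q h =>
        have : toggle (c + 1) q = (c + 1) :: q := by cases q <;> grind [toggle]
        have h2 : toggle c (toggle (c + 1) (toggle c (c :: q))) = c :: (c + 1) :: q := by
          rw [show toggle c (c :: q) = q by simp [toggle], this]; simp [toggle]
        rw [h2]
        refine ⟨.fst _ _, ?_⟩
        rcases q with _ | ⟨d, q⟩
        · simp [step] at h₂ ⊢; linarith
        · have := (List.isChain_cons_cons.1 hr).1
          simp only [asc_cons_cons, List.head?_cons, ne_eq, Option.some.injEq] at h₂ h ⊢
          grind [step]
      | snd' l q =>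
        simp only [toggle]
        refine ⟨by simpa [toggle] using SigmaShape.fst _ _, ?_⟩
        simp [step] at h₂ ⊢
        linarith
      | other d l q h h' =>
        refine ⟨by simpa [toggle, h, h', h.symm, h'.symm] using SigmaShape.fst _ _, ?_⟩
        simp [toggle, h.symm, step] at h₂ ⊢
        linarith
    by_cases hc' : c = i + 1
    · subst hc'
      simp only [if_neg hc, if_true]
      cases h₁ with
      | nil => simpa [toggle, step] using SigmaShape.snd (i := i) [] [] (by simp)
      | fst l q =>
        refine ⟨by simpa [toggle] using SigmaShape.snd' _ _, ?_⟩
        simp [toggle, step] at h₂ ⊢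
        linarith
      | snd l q h => simp at hl
      | snd' l q => simp at hl
      | other d l q h h' =>
        refine ⟨by simpa [toggle, h.symm] using SigmaShape.snd _ _ (by simpa using h'), ?_⟩
        simp only [toggle, h.symm, if_false, asc_cons_cons] at h₂ ⊢
        grind [step]
    · have hl' := hl
      simp only [if_neg hc, if_neg hc']
      cases h₁ with
      | nil => simpa [toggle] using SigmaShape.other c [] [] hc hc'
      | fst l q =>
        simp only [toggle, hc, if_false, asc_cons_cons] at h₂ ⊢
        exact ⟨.other _ _ _ hc hc', by linarith⟩
      | snd l q h =>
        simp only [toggle, hc, if_false, asc_cons_cons] at h₂ ⊢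
        exact ⟨.other _ _ _ hc hc', by grind [step]⟩
      | snd' l q =>
        simp only [toggle, hc', if_false, asc_cons_cons] at h₂ ⊢
        exact ⟨.other _ _ _ hc hc', by linarith⟩
      | other d l q h h' =>
        have := (List.isChain_cons_cons.1 hl).1
        simp only [toggle, this, if_false, asc_cons_cons] at h₂ ⊢
        exact ⟨.other _ _ _ hc hc', by linarith⟩

lemma s_sigma (i : ℕ) (g : InvGroup) : s (sigma i g) = s g := by
  obtain ⟨l, hl, rfl⟩ := exists_reduced g
  rw [s_ofList hl]
  exact (sigmaShape_word i hl).2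

/-- The shift by two. -/
def shift : InvGroup →* InvGroup := lift (fun i => x (i + 2)) (by simp)

@[simp] lemma shift_x (i : ℕ) : shift (x i) = x (i + 2) := lift_x _ _ _

lemma word_shift (g : InvGroup) : word (shift g) = (word g).map (· + 2) := by
  induction g using induction with
  | one => simp
  | mul i g ih =>
    rw [map_mul, shift_x, word_x_mul, word_x_mul, ih]
    cases word g with
    | nil => rfl
    | cons j l => by_cases h : i = j <;> simp [toggle, h]

lemma s_shift (g : InvGroup) : s (shift g) = s g := by
  rw [s, s, word_shift]
  induction word g with
  | nil => rfl
  | cons a l ih =>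
    cases l with
    | nil => rfl
    | cons b l =>
      simp only [List.map_cons, asc_cons_cons, step, add_lt_add_iff_right] at ih ⊢
      rw [ih]

lemma s_shift_iterate (k : ℕ) (g : InvGroup) : s (shift^[k] g) = s g := by
  induction k generalizing g with
  | zero => rfl
  | succ k ih => rw [Function.iterate_succ_apply, ih, s_shift]

/-- The product of the first `i` generators. -/
def base (i : ℕ) : InvGroup := ofList (List.range' 0 i)

lemma base_add (i n : ℕ) : base (i + n) = base i * ofList (List.range' i n) := by
  rw [base, base, ← ofList_append]
  congr 1
  simpa using (List.range'_append_1 (s := 0) (m := i) (n := n)).symm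

@[simp] lemma base_zero : base 0 = 1 := rfl

lemma base_succ (i : ℕ) : base (i + 1) = base i * x i := by simp [base_add]

/-- The homomorphism underlying `tau`. -/
def tauHom : InvGroup →* InvGroup :=
  lift (fun i => base i * x i * (base i)⁻¹) (fun _ => conj_mul_conj _ _)

@[simp] lemma tauHom_x (i : ℕ) : tauHom (x i) = base i * x i * (base i)⁻¹ := lift_x _ _ _

lemma tauHom_base (i : ℕ) : tauHom (base i) = (base i)⁻¹ := by
  induction i with
  | zero => simp
  | succ i ih => rw [base_succ, map_mul, ih, tauHom_x]; simp [mul_assoc]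

lemma tauHom_comp_tauHom : tauHom.comp tauHom = MonoidHom.id _ := hom_ext fun i => by
  simp [tauHom_base, mul_assoc]

/-- The involutive automorphism conjugating `x i` by the product of the preceding generators. -/
def tau : MulAut InvGroup := tauHom.toMulEquiv tauHom tauHom_comp_tauHom tauHom_comp_tauHom

@[simp] lemma tau_x (i : ℕ) : tau (x i) = base i * x i * (base i)⁻¹ := tauHom_x i

@[simp] lemma tau_tau (g : InvGroup) : tau (tau g) = g := tau.left_inv g

lemma tau_mul_tau : tau * tau = 1 := MulEquiv.ext tau_tau

lemma exists_ascent (n : ℕ) {a m : ℕ} {q : List ℕ} (hq : Reduced (m :: q)) (h : a + n ≤ m) :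
    ∃ m' q', Reduced (m' :: q') ∧ a ≤ m' ∧ asc (m' :: q') = n + asc (m :: q) ∧
      ofList (m' :: q') = ofList (List.range' a n) * ofList (m :: q) := by
  induction n generalizing a with
  | zero => exact ⟨m, q, hq, h, by simp, by simp⟩
  | succ n ih =>
    obtain ⟨m', q', h₁, h₂, h₃, h₄⟩ := ih (a := a + 1) (by omega)
    refine ⟨a, m' :: q', .cons_cons (by omega) h₁, le_rfl, ?_, ?_⟩
    · rw [asc_cons_cons, h₃, step, if_pos (by omega)]; push_cast; ring
    · rw [ofList_cons, h₄, List.range'_succ, ofList_cons a, mul_assoc]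

lemma exists_descent (d : ℕ) {c : ℕ} {v : List ℕ} (hv : Reduced (c :: v))
    (h : d = 0 → ∀ k ∈ v.head?, k < c) :
    ∃ q, Reduced ((c + d) :: q) ∧ (∀ k ∈ q.head?, k < c + d) ∧
      asc ((c + d) :: q) = asc (c :: v) - d ∧
      ofList ((c + d) :: q) = (ofList (List.range' (c + 1) d))⁻¹ * ofList (c :: v) := by
  suffices H : ∃ q, Reduced ((c + d) :: q) ∧ (d = 0 → q = v) ∧ (d ≠ 0 → ∀ k ∈ q.head?, k < c + d) ∧
      asc ((c + d) :: q) = asc (c :: v) - d ∧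
      ofList ((c + d) :: q) = (ofList (List.range' (c + 1) d))⁻¹ * ofList (c :: v) by
    obtain ⟨q, h₁, h₂, h₃, h₄⟩ := H
    refine ⟨q, h₁, ?_, h₄⟩
    by_cases hd : d = 0
    · subst hd; rw [h₂ rfl]; exact h rfl
    · exact h₃ hd
  clear h
  induction d with
  | zero => exact ⟨v, hv, by simp, by simp, by simp, by simp⟩
  | succ d ih =>
    obtain ⟨q, h₁, h₂, h₃, h₄, h₅⟩ := ih
    refine ⟨(c + d) :: q, .cons_cons (by omega) h₁, by simp, by simp, ?_, ?_⟩
    · rw [asc_cons_cons, h₄, step, if_neg (by omega), if_pos (by omega)]; push_cast; ring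
    · rw [ofList_cons, h₅, List.range'_1_concat, ofList_append]
      simp [mul_assoc, add_right_comm, ← add_assoc]

lemma exists_tau_word (i : ℕ) {l : List ℕ} (hl : Reduced (i :: l)) :
    ∃ m q, Reduced (m :: q) ∧ (i < m ∨ m = i ∧ ∀ k ∈ q.head?, k < i) ∧
      tau (ofList (i :: l)) = base i * ofList (m :: q) ∧
      i + asc (m :: q) = -asc (i :: l) := by
  induction l generalizing i with
  | nil =>
    obtain ⟨q, h₁, h₂, h₃, h₄⟩ := exists_descent i (.singleton 0) (v := []) (by simp)
    rw [zero_add] at *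
    refine ⟨i, q, h₁, .inr ⟨rfl, h₂⟩, ?_, by simp [h₃]⟩
    rw [h₄]
    have := base_add 1 i
    rw [add_comm, base_succ, base_succ] at this
    simp only [base_zero, one_mul] at this
    have h : x i * (base i)⁻¹ = (ofList (List.range' 1 i))⁻¹ * x 0 := by
      rw [← inv_inj]; simpa using this
    simp [← h, mul_assoc]
  | cons j l ih =>
    obtain ⟨m, q, h₁, h₂, h₃, h₄⟩ := ih j hl.of_cons
    have hij := (List.isChain_cons_cons.1 hl).1
    rw [ofList_cons, map_mul, h₃, tau_x, asc_cons_cons]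
    rcases lt_or_gt_of_ne hij with h | h
    · obtain ⟨n, rfl⟩ := Nat.exists_eq_add_of_lt h
      rw [add_right_comm] at *
      obtain ⟨m', q', k₁, k₂, k₃, k₄⟩ := exists_ascent n (a := i + 1) h₁ (by omega)
      refine ⟨m', q', k₁, .inl k₂, ?_, ?_⟩
      · rw [k₄, base_add, base_succ]; simp [mul_assoc]
      · rw [step, if_pos (by omega), k₃]; push_cast at *; linarith
    · obtain ⟨e, rfl⟩ := Nat.exists_eq_add_of_lt h
      have hb : x (j + e + 1) * (base (j + e + 1))⁻¹ * base j =
          (ofList (List.range' (j + 1) (e + 1)))⁻¹ * x j := by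
        rw [add_right_comm, base_add, base_succ, List.range'_1_concat, ofList_append]
        simp [mul_assoc]
      rw [show base (j + e + 1) * x (j + e + 1) * (base (j + e + 1))⁻¹ * (base j * ofList (m :: q)) =
        base (j + e + 1) * (x (j + e + 1) * (base (j + e + 1))⁻¹ * base j) * ofList (m :: q) by
          simp [mul_assoc], hb, step, if_neg (by omega), if_pos (by omega)]
      rcases h₂ with h₂ | ⟨rfl, h₂⟩
      · obtain ⟨q', k₁, k₂, k₃, k₄⟩ := exists_descent (e + 1) (c := j) (v := m :: q)
          (.cons_cons h₂.ne h₁) (by simp)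
        refine ⟨_, q', k₁, .inr ⟨by omega, k₂⟩, ?_, ?_⟩
        · rw [k₄, ofList_cons j]; simp only [mul_assoc]
        · rw [k₃, asc_cons_cons, step, if_pos h₂]; push_cast at *; linarith
      · obtain ⟨q', k₁, k₂, k₃, k₄⟩ := exists_descent e (c := m + 1) (v := q)
          (by
            cases q with
            | nil => exact .singleton _
            | cons k q => exact .cons_cons (by simp at h₂; omega) h₁.of_cons)
          (by intro _ k hk; have := h₂ k hk; omega)
        refine ⟨_, q', k₁, .inr ⟨by omega, fun k hk => by have := k₂ k hk; omega⟩, ?_, ?_⟩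
        · rw [k₄, List.range'_succ]; simp [mul_assoc]
        · have : asc (m :: q) = asc ((m + 1) :: q) := by
            cases q with
            | nil => rfl
            | cons k q =>
              simp only [List.head?_cons, Option.mem_def, Option.some.injEq, forall_eq'] at h₂
              simp only [asc_cons_cons]
              grind [step]
          rw [k₃, ← this]; push_cast at *; linarith

lemma s_tau (g : InvGroup) : s (tau g) = -s g := by
  obtain ⟨l, hl, rfl⟩ := exists_reduced g
  cases l with
  | nil => simp
  | cons i l =>
    obtain ⟨m, q, h₁, h₂, h₃, h₄⟩ := exists_tau_word i hl
    obtain ⟨m', q', k₁, k₂, k₃, k₄⟩ := exists_ascent i (a := 0) h₁ (by omega)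
    rw [h₃, base, ← k₄, s_ofList k₁, s_ofList hl, k₃, h₄]

lemma sigma_braid (i : ℕ) : sigma i * sigma (i + 1) * sigma i =
    sigma (i + 1) * sigma i * sigma (i + 1) := by
  refine aut_ext fun k => ?_
  simp only [MulAut.mul_apply]
  by_cases h₀ : k = i
  · subst h₀; simp (disch := omega) [sigma_of_ne, mul_assoc]
  by_cases h₁ : k = i + 1
  · subst h₁; simp (disch := omega) [sigma_of_ne, mul_assoc]
  by_cases h₂ : k = i + 1 + 1
  · subst h₂; simp (disch := omega) [sigma_of_ne]
  · simp (disch := omega) [sigma_of_ne]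

lemma sigma_comm {i j : ℕ} (h : i + 1 < j) : sigma i * sigma j = sigma j * sigma i := by
  refine aut_ext fun k => ?_
  simp only [MulAut.mul_apply]
  by_cases h₀ : k = i
  · subst h₀; simp (disch := omega) [sigma_of_ne]
  by_cases h₁ : k = i + 1
  · subst h₁; simp (disch := omega) [sigma_of_ne]
  by_cases h₂ : k = j
  · subst h₂; simp (disch := omega) [sigma_of_ne]
  by_cases h₃ : k = j + 1
  · subst h₃; simp (disch := omega) [sigma_of_ne]
  · simp (disch := omega) [sigma_of_ne]

lemma sigma_base_of_le {i j : ℕ} (h : i ≤ j) : sigma j (base i) = base i := by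
  induction i with
  | zero => simp
  | succ i ih =>
    rw [base_succ, map_mul, ih (by omega), sigma_of_ne (by omega) (by omega)]

lemma sigma_base_of_lt {i j : ℕ} (h : j + 2 ≤ i) : sigma j (base i) = base i := by
  induction i, h using Nat.le_induction with
  | base => simp [base_succ, sigma_base_of_le, mul_assoc]
  | succ i h ih => rw [base_succ, map_mul, ih, sigma_of_ne (by omega) (by omega)]

lemma sigma_tau_sigma (j : ℕ) : sigma j * tau * sigma j = tau := by
  refine aut_ext fun k => ?_
  simp only [MulAut.mul_apply]
  by_cases h₀ : k = j
  · subst h₀; simp [sigma_base_of_le, base_succ, mul_assoc]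
  by_cases h₁ : k = j + 1
  · subst h₁; simp [sigma_base_of_le, base_succ, mul_assoc]
  · rw [sigma_of_ne h₀ h₁, tau_x, map_mul, map_mul, map_inv, sigma_of_ne h₀ h₁]
    rcases lt_or_gt_of_ne h₀ with h | h
    · rw [sigma_base_of_le h.le]
    · rw [sigma_base_of_lt (by omega)]

lemma tau_sigma_tau (j : ℕ) : tau * sigma j * tau = (sigma j)⁻¹ := by
  rw [eq_inv_iff_mul_eq_one, mul_assoc, mul_assoc, ← mul_assoc (sigma j), sigma_tau_sigma,
    tau_mul_tau]

/-- The two-strand cabling of a braid automorphism. -/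
def cable (a : ℕ) : MulAut InvGroup := sigma (a + 1) * sigma a * sigma (a + 2) * sigma (a + 1)

lemma cable_zero (a : ℕ) : cable a (x a) =
    x a * x (a + 1) * x (a + 2) * (x a * x (a + 1))⁻¹ := by
  simp (disch := omega) [cable, sigma_of_ne, mul_assoc]

lemma cable_one (a : ℕ) : cable a (x (a + 1)) =
    x a * x (a + 1) * x (a + 3) * (x a * x (a + 1))⁻¹ := by
  have := sigma_self (a + 2)
  have h := sigma_succ (a + 1)
  have h' := sigma_self (a + 1)
  simp only [add_assoc, Nat.reduceAdd] at this h h'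
  simp (disch := omega) [cable, sigma_of_ne, mul_assoc, this, h, h']

lemma cable_two (a : ℕ) : cable a (x (a + 2)) = x a := by
  have h := sigma_succ (a + 1)
  simp only [add_assoc, Nat.reduceAdd] at h
  simp (disch := omega) [cable, sigma_of_ne, h]

lemma cable_three (a : ℕ) : cable a (x (a + 3)) = x (a + 1) := by
  have := sigma_succ (a + 2)
  have h := sigma_succ (a + 1)
  simp only [add_assoc, Nat.reduceAdd] at this h
  simp (disch := omega) [cable, sigma_of_ne, this, h]

lemma cable_of_ne {a k : ℕ} (h : k < a ∨ a + 4 ≤ k) : cable a (x k) = x k := by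
  simp (disch := omega) [cable, sigma_of_ne]

lemma cable_braid (a : ℕ) : cable a * cable (a + 2) * cable a =
    cable (a + 2) * cable a * cable (a + 2) := by
  refine aut_ext fun k => ?_
  simp only [MulAut.mul_apply]
  have h₀ := cable_zero (a + 2)
  have h₁ := cable_one (a + 2)
  have h₂ := cable_two (a + 2)
  have h₃ := cable_three (a + 2)
  simp only [add_assoc, Nat.reduceAdd] at h₀ h₁ h₂ h₃
  rcases lt_or_ge k a with h | h
  · simp (disch := omega) [cable_of_ne]
  obtain ⟨k, rfl⟩ := Nat.exists_eq_add_of_le h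
  match k with
  | 0 | 1 | 2 | 3 | 4 | 5 =>
    simp (disch := omega) [cable_zero, cable_one, cable_two, cable_three, cable_of_ne, mul_assoc,
      h₀, h₁, h₂, h₃]
  | k + 6 => simp (disch := omega) [cable_of_ne]

lemma cable_comm {a b : ℕ} (h : a + 4 ≤ b) : cable a * cable b = cable b * cable a := by
  refine aut_ext fun k => ?_
  simp only [MulAut.mul_apply]
  rcases lt_or_ge k a with h | h
  · simp (disch := omega) [cable_of_ne]
  obtain ⟨k, rfl⟩ := Nat.exists_eq_add_of_le h
  match k with
  | 0 | 1 | 2 | 3 =>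
    simp (disch := omega) [cable_zero, cable_one, cable_two, cable_three, cable_of_ne]
  | k + 4 =>
    rw [cable_of_ne (a := a) (by omega)]
    rcases lt_or_ge (a + (k + 4)) b with h | h
    · simp (disch := omega) [cable_of_ne]
    obtain ⟨l, hl⟩ := Nat.exists_eq_add_of_le h
    rw [hl]
    match l with
    | 0 | 1 | 2 | 3 =>
      simp (disch := omega) [cable_zero, cable_one, cable_two, cable_three, cable_of_ne]
    | l + 4 => simp (disch := omega) [cable_of_ne]

lemma tau_cable_tau (a : ℕ) : tau * cable a * tau = (cable a)⁻¹ := by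
  have h : tau * cable a * tau = (tau * sigma (a + 1) * tau) * (tau * sigma a * tau) *
      (tau * sigma (a + 2) * tau) * (tau * sigma (a + 1) * tau) := by
    simp only [cable, mul_assoc, ← mul_assoc tau tau, tau_mul_tau, one_mul]
  rw [h, cable, mul_assoc (sigma (a + 1)) (sigma a), sigma_comm (show a + 1 < a + 2 by omega)]
  simp only [tau_sigma_tau]
  simp only [mul_inv_rev, mul_assoc]

lemma cable_shift (a : ℕ) (g : InvGroup) : cable (a + 2) (shift g) = shift (cable a g) := by
  have : (cable (a + 2)).toMonoidHom.comp shift = shift.comp (cable a).toMonoidHom := by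
    refine hom_ext fun k => ?_
    have h₀ := cable_zero (a + 2)
    have h₁ := cable_one (a + 2)
    have h₂ := cable_two (a + 2)
    have h₃ := cable_three (a + 2)
    simp only [add_assoc, Nat.reduceAdd] at h₀ h₁ h₂ h₃
    rcases lt_or_ge k a with h | h
    · simp (disch := omega) [cable_of_ne]
    obtain ⟨k, rfl⟩ := Nat.exists_eq_add_of_le h
    match k with
    | 0 | 1 | 2 | 3 =>
      simp [cable_zero, cable_one, cable_two, cable_three, h₀, h₁, h₂, h₃, add_assoc]
    | k + 4 => simp (disch := omega) [cable_of_ne]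
  exact DFunLike.congr_fun this g

/-- The automorphisms preserving the ascent number and the parity. -/
def ascAut : Subgroup (MulAut InvGroup) where
  carrier := {f | ∀ g, s (f g) = s g ∧ parity (f g) = parity g}
  mul_mem' {f f'} hf hf' g := by
    rw [MulAut.mul_apply, (hf _).1, (hf _).2]; exact hf' g
  one_mem' g := by simp
  inv_mem' {f} hf g := by
    have := hf (f⁻¹ g)
    rw [MulAut.apply_inv_self] at this
    exact ⟨this.1.symm, this.2.symm⟩

lemma sigma_mem_ascAut (i : ℕ) : sigma i ∈ ascAut := by
  refine fun g => ⟨s_sigma i g, ?_⟩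
  have : parity.comp (sigma i).toMonoidHom = parity := by
    refine hom_ext fun k => ?_
    by_cases h₀ : k = i
    · subst h₀; simp [parity]
    by_cases h₁ : k = i + 1
    · subst h₁; simp [parity]
    · simp [sigma_of_ne h₀ h₁]
  exact DFunLike.congr_fun this g

lemma cable_mem_ascAut (a : ℕ) : cable a ∈ ascAut :=
  mul_mem (mul_mem (mul_mem (sigma_mem_ascAut _) (sigma_mem_ascAut _)) (sigma_mem_ascAut _))
    (sigma_mem_ascAut _)

end InvGroup

/-- The first `N` terms of `s` satisfy the braid relations. -/
structure IsBraidFamily {G : Type*} [Group G] (s : ℕ → G) (N : ℕ) : Prop where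
  comm : ∀ i j, i + 1 < j → j < N → Commute (s i) (s j)
  braid : ∀ i, i + 1 < N → s i * s (i + 1) * s i = s (i + 1) * s i * s (i + 1)

lemma conj_inv_of_braid {G : Type*} [Group G] {a b : G} (h : a * b * a = b * a * b) :
    a * (b⁻¹ * a⁻¹) = b⁻¹ * a⁻¹ * b := by
  rw [eq_comm, mul_assoc, inv_mul_eq_iff_eq_mul, inv_mul_eq_iff_eq_mul]
  simp only [← mul_assoc]
  rw [h]
  simp

/-- The successive conjugates of `t` by the elements `s 0`, `s 1`, …. -/
def conjSeq {G : Type*} [Group G] (t : G) (s : ℕ → G) : ℕ → G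
  | 0 => t
  | l + 1 => (s l)⁻¹ * conjSeq t s l * s l

namespace IsBraidFamily

variable {G : Type*} [Group G] {s : ℕ → G} {N : ℕ}

lemma shift (h : IsBraidFamily s N) (k : ℕ) : IsBraidFamily (fun j => s (k + j)) (N - k) where
  comm i j hij hj := h.comm _ _ (by omega) (by omega)
  braid i hi := h.braid (k + i) (by omega)

lemma map {H : Type*} [Group H] (h : IsBraidFamily s N) (f : G →* H) :
    IsBraidFamily (fun j => f (s j)) N where
  comm i j hij hj := (h.comm i j hij hj).map f
  braid i hi := by simpa using congrArg f (h.braid i hi)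

variable {t : G}

lemma commute_conjSeq_of_lt (h : IsBraidFamily s N) (ht : ∀ j, 0 < j → j < N → Commute (s j) t)
    {l j : ℕ} (hl : l < j) (hj : j < N) : Commute (s j) (conjSeq t s l) := by
  induction l with
  | zero => exact ht j hl hj
  | succ l ih =>
    have h₁ := (h.comm l j (by omega) hj).symm
    exact (h₁.inv_right.mul_right (ih (by omega))).mul_right h₁

lemma commute_conjSeq_of_gt (h : IsBraidFamily s N) (ht : ∀ j, 0 < j → j < N → Commute (s j) t)
    {l j : ℕ} (hl : j + 2 ≤ l) (hj : l ≤ N) : Commute (s j) (conjSeq t s l) := by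
  induction l, hl using Nat.le_induction with
  | base =>
    have h₁ := h.commute_conjSeq_of_lt ht (l := j) (j := j + 1) (by omega) (by omega)
    have h₂ := h.braid j (by omega)
    have h₃ : conjSeq t s (j + 2) =
        (s j * s (j + 1))⁻¹ * conjSeq t s j * (s j * s (j + 1)) := by
      simp [conjSeq, mul_assoc]
    have h₄ : s j * (s j * s (j + 1))⁻¹ = (s j * s (j + 1))⁻¹ * s (j + 1) := by
      rw [mul_inv_rev]; exact conj_inv_of_braid h₂
    have h₅ : s (j + 1) * (s j * s (j + 1)) = s j * s (j + 1) * s j := by rw [h₂, mul_assoc]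
    rw [h₃, commute_iff_eq]
    generalize s j * s (j + 1) = p at *
    rw [← mul_assoc, ← mul_assoc, h₄, mul_assoc _ (s (j + 1)), h₁.eq, ← mul_assoc,
      mul_assoc _ _ p, h₅, mul_assoc _ p]
  | succ l hl ih =>
    have h₁ := h.comm j l (by omega) (by omega)
    exact (h₁.inv_right.mul_right (ih (by omega))).mul_right h₁

lemma conj_conjSeq_succ (j : ℕ) : s j * conjSeq t s (j + 1) * (s j)⁻¹ = conjSeq t s j := by
  simp [conjSeq, mul_assoc]

lemma conj_conjSeq_self (h : IsBraidFamily s N) (ht : ∀ j, 0 < j → j < N → Commute (s j) t)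
    (h0 : 0 < N → s 0 * t * (s 0)⁻¹ = t * ((s 0)⁻¹ * t * s 0) * t⁻¹) {j : ℕ} (hj : j < N) :
    s j * conjSeq t s j * (s j)⁻¹ =
      conjSeq t s j * conjSeq t s (j + 1) * (conjSeq t s j)⁻¹ := by
  induction j with
  | zero => exact h0 hj
  | succ j ih =>
    have h₁ := h.commute_conjSeq_of_lt ht (l := j) (j := j + 1) (by omega) (by omega)
    have h₂ := h.braid j (by omega)
    let c := MulAut.conj (s (j + 1) * s j)⁻¹
    have hA : c (conjSeq t s j) = conjSeq t s (j + 1) := by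
      simp only [c, MulAut.conj_apply, inv_inv, mul_inv_rev, conjSeq, mul_assoc]
      rw [← mul_assoc (conjSeq t s j), ← h₁.eq]
      simp [mul_assoc]
    have hs : c (s j) = s (j + 1) := by
      simp only [c, MulAut.conj_apply, inv_inv]
      rw [mul_assoc, inv_mul_eq_iff_eq_mul, ← h₂, mul_assoc]
    have := congrArg c (ih (by omega))
    rw [conjSeq] at this
    change s (j + 1) * conjSeq t s (j + 1) * _ = conjSeq t s (j + 1) *
      ((s (j + 1))⁻¹ * conjSeq t s (j + 1) * s (j + 1)) * _
    simpa only [map_mul, map_inv, hA, hs] using this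

lemma conj_conjSeq_mem (h : IsBraidFamily s N) (ht : ∀ j, 0 < j → j < N → Commute (s j) t)
    (h0 : 0 < N → s 0 * t * (s 0)⁻¹ = t * ((s 0)⁻¹ * t * s 0) * t⁻¹) {j l : ℕ} (hj : j < N)
    (hl : l ≤ N) :
    s j * conjSeq t s l * (s j)⁻¹ ∈ Subgroup.closure (conjSeq t s '' Set.Iic N) ∧
      (s j)⁻¹ * conjSeq t s l * s j ∈ Subgroup.closure (conjSeq t s '' Set.Iic N) := by
  have mem : ∀ l ≤ N, conjSeq t s l ∈ Subgroup.closure (conjSeq t s '' Set.Iic N) :=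
    fun l hl => Subgroup.subset_closure ⟨l, hl, rfl⟩
  have comm (hc : Commute (s j) (conjSeq t s l)) :
      s j * conjSeq t s l * (s j)⁻¹ = conjSeq t s l ∧
        (s j)⁻¹ * conjSeq t s l * s j = conjSeq t s l := by
    constructor
    · rw [hc.eq, mul_inv_cancel_right]
    · rw [hc.inv_left.eq, inv_mul_cancel_right]
  rcases lt_or_ge l j with h₁ | h₁
  · have := comm (h.commute_conjSeq_of_lt ht h₁ hj)
    rw [this.1, this.2]
    exact ⟨mem l hl, mem l hl⟩
  rcases lt_or_ge (j + 1) l with h₂ | h₂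
  · have := comm (h.commute_conjSeq_of_gt ht h₂ hl)
    rw [this.1, this.2]
    exact ⟨mem l hl, mem l hl⟩
  have h₃ := h.conj_conjSeq_self ht h0 hj
  obtain rfl | rfl : l = j ∨ l = j + 1 := by omega
  · rw [h₃]
    exact ⟨mul_mem (mul_mem (mem l hl) (mem _ hj)) (inv_mem (mem l hl)), mem _ hj⟩
  · refine ⟨by rw [conj_conjSeq_succ]; exact mem j hj.le, ?_⟩
    have : (s j)⁻¹ * conjSeq t s (j + 1) * s j =
        (conjSeq t s (j + 1))⁻¹ * conjSeq t s j * conjSeq t s (j + 1) := by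
      have h₄ : conjSeq t s (j + 1) =
          (conjSeq t s j)⁻¹ * (s j * conjSeq t s j * (s j)⁻¹) * conjSeq t s j := by
        rw [h₃]; group
      have h₅ : conjSeq t s (j + 1) = (s j)⁻¹ * conjSeq t s j * s j := rfl
      conv_lhs => rw [h₄]
      rw [h₅]
      group
    rw [this]
    exact mul_mem (mul_mem (inv_mem (mem _ hj)) (mem j hj.le)) (mem _ hj)

lemma le_normalizer (h : IsBraidFamily s N) (ht : ∀ j, 0 < j → j < N → Commute (s j) t)
    (h0 : 0 < N → s 0 * t * (s 0)⁻¹ = t * ((s 0)⁻¹ * t * s 0) * t⁻¹) :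
    Subgroup.closure (s '' Set.Iio N) ≤
      Subgroup.normalizer (Subgroup.closure (conjSeq t s '' Set.Iic N) : Set G) := by
  rw [Subgroup.closure_le]
  rintro _ ⟨j, hj, rfl⟩
  have key (g : G) (hg : ∀ l ≤ N, g * conjSeq t s l * g⁻¹ ∈
      Subgroup.closure (conjSeq t s '' Set.Iic N)) (p : G)
      (hp : p ∈ Subgroup.closure (conjSeq t s '' Set.Iic N)) :
      g * p * g⁻¹ ∈ Subgroup.closure (conjSeq t s '' Set.Iic N) := by
    have : Subgroup.closure (conjSeq t s '' Set.Iic N) ≤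
        (Subgroup.closure (conjSeq t s '' Set.Iic N)).comap (MulAut.conj g).toMonoidHom := by
      rw [Subgroup.closure_le]
      rintro _ ⟨l, hl, rfl⟩
      exact hg l hl
    exact this hp
  refine Subgroup.mem_normalizer_iff.2 fun p => ⟨key _ (fun l hl => ?_) p, fun hp => ?_⟩
  · exact (h.conj_conjSeq_mem ht h0 hj hl).1
  · have := key (s j)⁻¹ (fun l hl => by
      rw [inv_inv]; exact (h.conj_conjSeq_mem ht h0 hj hl).2) _ hp
    simpa [mul_assoc] using this

/-- The products `(s (i - 1))⁻¹ ⋯ (s 0)⁻¹`. -/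
def sweep (s : ℕ → G) : ℕ → G
  | 0 => 1
  | i + 1 => (s i)⁻¹ * sweep s i

lemma commute_sweep (h : IsBraidFamily s N) {i j : ℕ} (hij : i < j) (hj : j < N) :
    Commute (s j) (sweep s i) := by
  induction i with
  | zero => exact Commute.one_right _
  | succ i ih => exact (h.comm i j hij hj).symm.inv_right.mul_right (ih (by omega))

lemma mul_sweep (h : IsBraidFamily s N) {i j : ℕ} (hij : j + 2 ≤ i) (hi : i ≤ N) :
    s j * sweep s i = sweep s i * s (j + 1) := by
  induction i, hij using Nat.le_induction with
  | base =>
    have h₁ := conj_inv_of_braid (h.braid j (by omega))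
    have h₂ := (h.commute_sweep (i := j) (j := j + 1) (by omega) (by omega)).eq
    simp only [sweep]
    rw [← mul_assoc (s (j + 1))⁻¹, ← mul_assoc, h₁, mul_assoc, h₂]
    simp only [mul_assoc]
  | succ i hij ih =>
    rw [sweep, ← mul_assoc, (h.comm j i (by omega) (by omega)).inv_right.eq, mul_assoc,
      ih (by omega), mul_assoc]

lemma sq_mul_sweep (h : IsBraidFamily s N) {i : ℕ} (hi : i < N) :
    s i * s i * sweep s i =
      sweep s i * (conjSeq (s 0 * s 0)⁻¹ (fun j => s (1 + j)) i)⁻¹ := by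
  induction i with
  | zero => simp [sweep, conjSeq]
  | succ i ih =>
    have h₁ := ih (by omega)
    have h₂ := (h.commute_sweep (i := i) (j := i + 1) (by omega) hi).eq
    have h₃ : s (i + 1) * s (i + 1) * (s i)⁻¹ =
        (s i)⁻¹ * (s (i + 1))⁻¹ * (s i * s i * s (i + 1)) := by
      have := h.braid i hi
      rw [← mul_inv_rev, eq_inv_mul_iff_mul_eq]
      calc s (i + 1) * s i * (s (i + 1) * s (i + 1) * (s i)⁻¹)
          = s (i + 1) * s i * s (i + 1) * s (i + 1) * (s i)⁻¹ := by simp only [mul_assoc]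
        _ = s i * s (i + 1) * s i * s (i + 1) * (s i)⁻¹ := by rw [this]
        _ = s i * (s (i + 1) * s i * s (i + 1)) * (s i)⁻¹ := by simp only [mul_assoc]
        _ = _ := by rw [← this]; group
    have h₄ : (s (i + 1))⁻¹ * sweep s i = sweep s i * (s (i + 1))⁻¹ :=
      (h.commute_sweep (i := i) (j := i + 1) (by omega) hi).inv_left.eq
    rw [sweep, conjSeq, Nat.add_comm 1 i, ← mul_assoc, h₃]
    generalize conjSeq (s 0 * s 0)⁻¹ (fun j => s (1 + j)) i = A at *
    calc (s i)⁻¹ * (s (i + 1))⁻¹ * (s i * s i * s (i + 1)) * sweep s i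
        = (s i)⁻¹ * ((s (i + 1))⁻¹ * (s i * s i * sweep s i)) * s (i + 1) := by
          simp only [mul_assoc]; rw [h₂]
      _ = _ := by
          rw [h₁, ← mul_assoc (s (i + 1))⁻¹, h₄]
          group

lemma commute_sq (h : IsBraidFamily s N) (j : ℕ) (h0 : 0 < j) (hj : j < N - 1) :
    Commute (s (1 + j)) (s 0 * s 0)⁻¹ := by
  have := (h.comm 0 (1 + j) (by omega) (by omega)).symm
  exact (this.mul_right this).inv_right

lemma conj_sq (h : IsBraidFamily s N) (hN : 0 < N - 1) :
    s (1 + 0) * (s 0 * s 0)⁻¹ * (s (1 + 0))⁻¹ =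
      (s 0 * s 0)⁻¹ * ((s (1 + 0))⁻¹ * (s 0 * s 0)⁻¹ * s (1 + 0)) * ((s 0 * s 0)⁻¹)⁻¹ := by
  have h₁ := h.braid 0 (by omega)
  rw [Nat.zero_add] at h₁
  rw [Nat.add_zero]
  generalize s 0 = a at *
  generalize s 1 = b at *
  have h₂ : b * a * b⁻¹ = a⁻¹ * b * a := by
    rw [mul_inv_eq_iff_eq_mul, mul_assoc, mul_assoc, eq_inv_mul_iff_mul_eq]
    simpa only [mul_assoc] using h₁
  have h₃ : b⁻¹ * a * b = a * b * a⁻¹ := by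
    rw [eq_mul_inv_iff_mul_eq, mul_assoc, mul_assoc, inv_mul_eq_iff_eq_mul]
    simpa only [mul_assoc] using h₁
  calc b * (a * a)⁻¹ * b⁻¹ = (b * a * b⁻¹ * (b * a * b⁻¹))⁻¹ := by group
    _ = (a * a)⁻¹ * ((a * b * a⁻¹) * (a * b * a⁻¹))⁻¹ * ((a * a)⁻¹)⁻¹ := by rw [h₂]; group
    _ = _ := by rw [← h₃]; group

/-- Up to a left factor `sweep s i`, elements generated by `s` are products of the elements
of two smaller subgroups. -/
lemma exists_eq_sweep_mul (h : IsBraidFamily s N) (hN : 0 < N) {x : G}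
    (hx : x ∈ Subgroup.closure (s '' Set.Iio N)) :
    ∃ i ≤ N, ∃ p ∈ Subgroup.closure
        (conjSeq (s 0 * s 0)⁻¹ (fun j => s (1 + j)) '' Set.Iic (N - 1)),
      ∃ g ∈ Subgroup.closure ((fun j => s (1 + j)) '' Set.Iio (N - 1)),
        x = sweep s i * p * g := by
  set A := conjSeq (s 0 * s 0)⁻¹ (fun j => s (1 + j)) with hA
  set P := Subgroup.closure (A '' Set.Iic (N - 1)) with hP
  set K := Subgroup.closure ((fun j => s (1 + j)) '' Set.Iio (N - 1)) with hK
  have hnorm : K ≤ Subgroup.normalizer (P : Set G) :=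
    (h.shift 1).le_normalizer h.commute_sq h.conj_sq
  have memA : ∀ l < N, A l ∈ P := fun l hl =>
    Subgroup.subset_closure ⟨l, Set.mem_Iic.2 (by omega), rfl⟩
  have memK : ∀ j, 0 < j → j < N → s j ∈ K := fun j h0 hj =>
    Subgroup.subset_closure ⟨j - 1, Set.mem_Iio.2 (by omega), by
      change s (1 + (j - 1)) = s j; congr 1; omega⟩
  have step (y : G) (i' : ℕ) (hi' : i' ≤ N) (q : G) (hq : q ∈ P ∨ q ∈ K) (i : ℕ)
      (hy : y * sweep s i = sweep s i' * q) (p : G) (hp : p ∈ P) (g : G) (hg : g ∈ K) :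
      ∃ k ≤ N, ∃ r ∈ P, ∃ f ∈ K, y * (sweep s i * p * g) = sweep s k * r * f := by
    rw [← mul_assoc, ← mul_assoc, hy]
    rcases hq with hq | hq
    · exact ⟨i', hi', q * p, mul_mem hq hp, g, hg, by simp only [mul_assoc]⟩
    · exact ⟨i', hi', q * p * q⁻¹, (Subgroup.mem_normalizer_iff.1 (hnorm hq) p).1 hp, q * g,
        mul_mem hq hg, by simp [mul_assoc]⟩
  induction hx using Subgroup.closure_induction_left with
  | one => exact ⟨0, hN.le, 1, one_mem _, 1, one_mem _, by simp [sweep]⟩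
  | mul_left x hx y hy ih =>
    obtain ⟨j, hj, rfl⟩ := hx
    rw [Set.mem_Iio] at hj
    obtain ⟨i, hi, p, hp, g, hg, rfl⟩ := ih
    rcases lt_trichotomy i j with hij | rfl | hij
    · exact step _ i hi _ (.inr (memK j (by omega) hj)) i (h.commute_sweep hij hj).eq p hp g hg
    · refine step _ (i + 1) hj _ (.inl (inv_mem (memA i hj))) i ?_ p hp g hg
      rw [sweep, mul_assoc, ← h.sq_mul_sweep hj]
      group
    obtain rfl | hij : i = j + 1 ∨ j + 2 ≤ i := by omega
    · refine step _ j hj.le 1 (.inl (one_mem _)) _ ?_ p hp g hg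
      rw [sweep, mul_inv_cancel_left, mul_one]
    · exact step _ i hi _ (.inr (memK (j + 1) (by omega) (by omega))) i (h.mul_sweep hij hi)
        p hp g hg
  | inv_mul_cancel x hx y hy ih =>
    obtain ⟨j, hj, rfl⟩ := hx
    rw [Set.mem_Iio] at hj
    obtain ⟨i, hi, p, hp, g, hg, rfl⟩ := ih
    rcases lt_trichotomy i j with hij | rfl | hij
    · exact step _ i hi _ (.inr (inv_mem (memK j (by omega) hj))) i
        (h.commute_sweep hij hj).inv_left.eq p hp g hg
    · refine step _ (i + 1) hj 1 (.inl (one_mem _)) _ ?_ p hp g hg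
      rw [sweep, mul_one]
    obtain rfl | hij : i = j + 1 ∨ j + 2 ≤ i := by omega
    · refine step _ j hj.le _ (.inl (memA j hj)) _ ?_ p hp g hg
      have := h.sq_mul_sweep hj
      rw [eq_mul_inv_iff_mul_eq, mul_assoc, ← eq_inv_mul_iff_mul_eq] at this
      rw [hA, this, sweep]
      group
    · refine step _ i hi _ (.inr (inv_mem (memK (j + 1) (by omega) (by omega)))) i ?_ p hp g hg
      rw [inv_mul_eq_iff_eq_mul, ← mul_assoc, h.mul_sweep hij hi, mul_inv_cancel_right]

end IsBraidFamily

namespace InvGroup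

/-- The retraction of `InvGroup` killing the generators `x i` with `i < c + 2`. -/
def ret (c : ℕ) : InvGroup →* InvGroup :=
  lift (fun i => if i < c + 2 then 1 else x i) fun i => by split_ifs <;> simp

lemma ret_x_of_lt {c i : ℕ} (h : i < c + 2) : ret c (x i) = 1 := by simp [ret, h]

lemma ret_x_of_le {c i : ℕ} (h : c + 2 ≤ i) : ret c (x i) = x i := by
  simp [ret, Nat.not_lt.2 h]

open Classical in
/-- An action of `InvGroup` on two copies of itself, used to bound the centralizer of `x c`. -/
noncomputable def retAction (c : ℕ) : InvGroup →* Equiv.Perm (InvGroup × Bool) :=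
  lift (fun i => if i = c then Equiv.swap (1, false) (1, true) else
    (Equiv.mulLeft (ret c (x i))).prodCongr (Equiv.refl Bool)) fun i => by
      split_ifs with h
      · exact Equiv.swap_mul_self _ _
      · ext1 ⟨g, b⟩
        simp only [Equiv.Perm.mul_apply, Equiv.prodCongr_apply, Prod.map_apply,
          Equiv.coe_mulLeft, ← mul_assoc, ← map_mul, x_mul_self]
        simp

lemma retAction_fst (c : ℕ) (u : InvGroup) (p : InvGroup × Bool) :
    (retAction c u p).1 = ret c u * p.1 := by
  classical
  induction u using induction with
  | one => simp
  | mul i g ih =>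
    rw [map_mul, map_mul, Equiv.Perm.mul_apply, mul_assoc, ← ih]
    generalize retAction c g p = q
    rw [retAction, lift_x]
    split_ifs with h
    · rw [ret_x_of_lt (by omega), one_mul, Equiv.swap_apply_def]
      split_ifs with h₁ h₂ <;> simp_all
    · simp

lemma ret_eq_one_of_commute {c : ℕ} {u : InvGroup} (h : Commute u (x c)) : ret c u = 1 := by
  classical
  have h₁ := congrArg (fun f => f (1, false)) (h.map (retAction c)).eq
  have hx : retAction c (x c) = Equiv.swap (1, false) (1, true) := by simp [retAction]
  simp only [hx, Equiv.Perm.mul_apply, Equiv.swap_apply_left] at h₁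
  have h₂ := retAction_fst c u (1, false)
  rw [mul_one] at h₂
  by_contra hne
  rw [Equiv.swap_apply_of_ne_of_ne] at h₁
  · simpa using (retAction c u).injective h₁
  · rintro h; rw [h] at h₂; exact hne h₂.symm
  · rintro h; rw [h] at h₂; exact hne h₂.symm

lemma eq_of_conj_x_eq {i j : ℕ} {u : InvGroup} (h : u * x i * u⁻¹ = x j) : i = j := by
  let f : InvGroup →* ℤˣ := lift (fun k => if k = j then -1 else 1) fun k => by split_ifs <;> simp
  have := congrArg f h
  simp only [map_mul, map_inv, mul_inv_cancel_comm, f, lift_x] at this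
  by_contra hne
  simp [hne] at this

/-- The inversion of the generators of the free group, as a permutation. -/
def freeInv : Equiv.Perm (FreeGroup ℕ) where
  toFun := FreeGroup.lift fun l => (FreeGroup.of l)⁻¹
  invFun := FreeGroup.lift fun l => (FreeGroup.of l)⁻¹
  left_inv w := by
    rw [← MonoidHom.comp_apply]
    conv_rhs => rw [← MonoidHom.id_apply _ w]
    congr 1; ext; simp
  right_inv w := by
    rw [← MonoidHom.comp_apply]
    conv_rhs => rw [← MonoidHom.id_apply _ w]
    congr 1; ext; simp

lemma freeInv_mul_self : freeInv * freeInv = 1 := by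
  ext1 w; exact freeInv.left_inv w

lemma freeInv_mul (v w : FreeGroup ℕ) : freeInv (v * w) = freeInv v * freeInv w :=
  map_mul (FreeGroup.lift fun l => (FreeGroup.of l)⁻¹) v w

lemma freeInv_of (l : ℕ) : freeInv (FreeGroup.of l) = (FreeGroup.of l)⁻¹ :=
  FreeGroup.lift_apply_of (f := fun l => (FreeGroup.of l)⁻¹)

lemma freeInv_freeInv (w : FreeGroup ℕ) : freeInv (freeInv w) = w := freeInv.left_inv w

/-- The homomorphism from the free group sending the generators to the products
`x (c + 2 * (l + 1)) * x (c + 2 * (l + 1) + 1)`. -/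
def pairHom (c : ℕ) : FreeGroup ℕ →* InvGroup :=
  FreeGroup.lift fun l => x (c + 2 * (l + 1)) * x (c + 2 * (l + 1) + 1)

lemma pairHom_of (c l : ℕ) :
    pairHom c (FreeGroup.of l) = x (c + 2 * (l + 1)) * x (c + 2 * (l + 1) + 1) :=
  FreeGroup.lift_apply_of

lemma eq_one_of_pairHom_eq_one {c : ℕ} {w : FreeGroup ℕ} (h : pairHom c w = 1) : w = 1 := by
  let f : InvGroup →* Equiv.Perm (FreeGroup ℕ) := lift (fun i => if (i - c) % 2 = 1 then
      freeInv * Equiv.mulLeft (FreeGroup.of ((i - c) / 2 - 1)) else freeInv) fun i => by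
    split_ifs with h
    · ext1 v
      simp [freeInv_mul, freeInv_of, freeInv_freeInv]
    · exact freeInv_mul_self
  have hf : f.comp (pairHom c) = MulAction.toPermHom (FreeGroup ℕ) (FreeGroup ℕ) := by
    ext l v : 2
    have h₁ : (c + 2 * (l + 1) - c) % 2 = 0 := by omega
    have h₂ : (c + 2 * (l + 1) + 1 - c) % 2 = 1 := by omega
    have h₃ : (c + 2 * (l + 1) + 1 - c) / 2 - 1 = l := by omega
    simp only [MonoidHom.comp_apply, pairHom_of, map_mul, f, lift_x, h₁, h₂, h₃]
    simp [← mul_assoc, freeInv_mul_self]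
  have := congrArg (fun g => g w 1) hf
  simpa [h] using this.symm

/-- The automorphism `f` is trivial modulo the kernel of `ret c`, and maps `x c` to a conjugate
`u * x c * u⁻¹` with `ret c u = v⁻¹`. -/
def Moves (c : ℕ) (f : MulAut InvGroup) (v : InvGroup) : Prop :=
  (∀ y, ret c (f y) = ret c y) ∧ ∃ u, f (x c) = u * x c * u⁻¹ ∧ ret c u * v = 1

lemma Moves.one (c : ℕ) : Moves c 1 1 := ⟨fun _ => rfl, 1, by simp, by simp⟩

lemma Moves.mul {c : ℕ} {f g : MulAut InvGroup} {v w : InvGroup} (hf : Moves c f v)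
    (hg : Moves c g w) : Moves c (f * g) (v * w) := by
  obtain ⟨hf, u₁, h₁, h₁'⟩ := hf
  obtain ⟨hg, u₂, h₂, h₂'⟩ := hg
  refine ⟨fun y => by rw [MulAut.mul_apply, hf, hg], f u₂ * u₁, ?_, ?_⟩
  · rw [MulAut.mul_apply, h₂, map_mul, map_mul, h₁, map_inv]
    group
  · rw [map_mul, hf, mul_assoc, ← mul_assoc _ v, h₁', one_mul, h₂']

lemma Moves.inv {c : ℕ} {f : MulAut InvGroup} {v : InvGroup} (hf : Moves c f v) :
    Moves c f⁻¹ v⁻¹ := by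
  obtain ⟨hf, u, h, h'⟩ := hf
  have hf' : ∀ y, ret c (f⁻¹ y) = ret c y := fun y => by
    rw [← hf, MulAut.apply_inv_self]
  refine ⟨hf', (f⁻¹ u)⁻¹, ?_, ?_⟩
  · have : f⁻¹ (f (x c)) = f⁻¹ (u * x c * u⁻¹) := by rw [h]
    rw [MulAut.inv_apply_self, map_mul, map_mul, map_inv] at this
    conv_rhs => rw [this]
    group
  · rw [map_inv, hf', eq_inv_of_mul_eq_one_left h', inv_inv, mul_inv_cancel]

/-- The automorphisms fixing `x c` and commuting with `ret c`. -/
def retAut (c : ℕ) : Subgroup (MulAut InvGroup) where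
  carrier := {f | f (x c) = x c ∧ ∀ y, ret c (f y) = f (ret c y)}
  one_mem' := ⟨rfl, fun _ => rfl⟩
  mul_mem' := by
    rintro f g ⟨hf, hf'⟩ ⟨hg, hg'⟩
    exact ⟨by rw [MulAut.mul_apply, hg, hf], fun y => by simp [hf', hg']⟩
  inv_mem' := by
    rintro f ⟨hf, hf'⟩
    refine ⟨by conv_lhs => rw [← hf, MulAut.inv_apply_self], fun y => ?_⟩
    apply f.injective
    rw [← hf', MulAut.apply_inv_self, MulAut.apply_inv_self]

lemma Moves.conj {c : ℕ} {f g : MulAut InvGroup} {v : InvGroup} (hf : Moves c f v)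
    (hg : g ∈ retAut c) : Moves c (g * f * g⁻¹) (g v) := by
  obtain ⟨hf, u, h, h'⟩ := hf
  have hg' := inv_mem hg
  refine ⟨fun y => ?_, g u, ?_, ?_⟩
  · simp only [MulAut.mul_apply]
    rw [hg.2, hf, ← hg.2, MulAut.apply_inv_self]
  · simp only [MulAut.mul_apply]
    rw [hg'.1, h]
    simp [hg.1]
  · rw [hg.2, ← map_mul, h', map_one]

lemma cable_mem_retAut {a c : ℕ} (h : c + 2 ≤ a) : cable a ∈ retAut c := by
  refine ⟨cable_of_ne (by omega), fun y => ?_⟩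
  have : (ret c).comp (cable a).toMonoidHom = (cable a).toMonoidHom.comp (ret c) := by
    refine hom_ext fun i => ?_
    change ret c (cable a (x i)) = cable a (ret c (x i))
    rcases lt_or_ge i (c + 2) with hi | hi
    · rw [cable_of_ne (by omega), ret_x_of_lt hi, map_one]
    rw [ret_x_of_le hi]
    by_cases hi' : i < a ∨ a + 4 ≤ i
    · rw [cable_of_ne hi', ret_x_of_le hi]
    have h₀ : ret c (x a) = x a := ret_x_of_le (by omega)
    have h₁ : ret c (x (a + 1)) = x (a + 1) := ret_x_of_le (by omega)
    have h₂ : ret c (x (a + 2)) = x (a + 2) := ret_x_of_le (by omega)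
    have h₃ : ret c (x (a + 3)) = x (a + 3) := ret_x_of_le (by omega)
    obtain rfl | rfl | rfl | rfl : i = a ∨ i = a + 1 ∨ i = a + 2 ∨ i = a + 3 := by omega
    all_goals simp [cable_zero, cable_one, cable_two, cable_three, h₀, h₁, h₂, h₃]
  exact DFunLike.congr_fun this y

lemma moves_cable_sq (c : ℕ) : Moves c (cable c * cable c)⁻¹ (x (c + 2) * x (c + 3)) := by
  have h₀ : ret c (x c) = 1 := ret_x_of_lt (by omega)
  have h₁ : ret c (x (c + 1)) = 1 := ret_x_of_lt (by omega)
  have h₂ : ret c (x (c + 2)) = x (c + 2) := ret_x_of_le (by omega)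
  have h₃ : ret c (x (c + 3)) = x (c + 3) := ret_x_of_le (by omega)
  suffices Moves c (cable c * cable c) (x (c + 2) * x (c + 3))⁻¹ by simpa using this.inv
  constructor
  · intro y
    have : (ret c).comp (cable c * cable c).toMonoidHom = ret c := by
      refine hom_ext fun i => ?_
      change ret c (cable c (cable c (x i))) = ret c (x i)
      by_cases hi : i < c ∨ c + 4 ≤ i
      · rw [cable_of_ne hi, cable_of_ne hi]
      obtain rfl | rfl | rfl | rfl : i = c ∨ i = c + 1 ∨ i = c + 2 ∨ i = c + 3 := by omega
      all_goals simp [cable_zero, cable_one, cable_two, cable_three, h₀, h₁, h₂, h₃, mul_assoc]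
    exact DFunLike.congr_fun this y
  · refine ⟨cable c (x c * x (c + 1)), ?_, ?_⟩
    · rw [MulAut.mul_apply, cable_zero, map_mul, map_mul, cable_two, map_inv]
    · simp [cable_zero, cable_one, h₀, h₁, h₂, h₃, mul_assoc]

end InvGroup

open InvGroup

namespace IsBraidFamily

variable {G : Type*} [Group G] {s : ℕ → G} {N : ℕ} {ρ : G →* MulAut InvGroup} {c : ℕ}

lemma moves_conjSeq (hρ : ∀ j < N, ρ (s j) = cable (c + 2 * j)) {l : ℕ} (hl : l < N) :
    Moves c (ρ (conjSeq (s 0 * s 0)⁻¹ (fun j => s (1 + j)) l)) (pairHom c (FreeGroup.of l)) := by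
  induction l with
  | zero =>
    have := moves_cable_sq c
    simpa [conjSeq, hρ 0 hl, pairHom_of] using this
  | succ l ih =>
    have h₁ := (ih (by omega)).conj (inv_mem (cable_mem_retAut (a := c + 2 * (1 + l)) (by omega)))
    rw [conjSeq, map_mul, map_mul, map_inv, hρ (1 + l) (by omega)]
    convert h₁ using 1
    · rw [inv_inv]
    · rw [← MulEquiv.symm_apply_eq]
      change (cable (c + 2 * (1 + l)))⁻¹⁻¹ _ = _
      rw [inv_inv, pairHom_of, pairHom_of, map_mul,
        show c + 2 * (l + 1 + 1) = c + 2 * (1 + l) + 2 by omega, cable_two, cable_three,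
        Nat.add_comm 1 l]

lemma sweep_apply (hρ : ∀ j < N, ρ (s j) = cable (c + 2 * j)) {i : ℕ} (hi : i ≤ N) :
    ρ (sweep s i) (x c) = x (c + 2 * i) := by
  induction i with
  | zero => simp [sweep]
  | succ i ih =>
    rw [sweep, map_mul, map_inv, MulAut.mul_apply, ih (by omega), hρ i hi]
    apply (cable (c + 2 * i)).injective
    rw [MulAut.apply_inv_self, ← cable_two]
    rfl

/-- The stabilizer of the first strand is generated by the braids of the other strands. -/
theorem mem_closure_of_apply_eq (h : IsBraidFamily s N)
    (hρ : ∀ j < N, ρ (s j) = cable (c + 2 * j)) {y : G}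
    (hy : y ∈ Subgroup.closure (s '' Set.Iio N)) (hfix : ρ y (x c) = x c) :
    y ∈ Subgroup.closure ((fun j => s (1 + j)) '' Set.Iio (N - 1)) := by
  rcases Nat.eq_zero_or_pos N with rfl | hN
  · simpa using hy
  obtain ⟨i, hi, p, hp, g, hg, rfl⟩ := h.exists_eq_sweep_mul hN hy
  have hg' : ρ g ∈ retAut c := by
    have : Subgroup.closure ((fun j => s (1 + j)) '' Set.Iio (N - 1)) ≤ (retAut c).comap ρ := by
      rw [Subgroup.closure_le]
      rintro _ ⟨j, hj, rfl⟩
      rw [Set.mem_Iio] at hj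
      change ρ (s (1 + j)) ∈ retAut c
      rw [hρ _ (by omega)]
      exact cable_mem_retAut (by omega)
    exact this hg
  have hp' : ∃ w, FreeGroup.lift (conjSeq (s 0 * s 0)⁻¹ (fun j => s (1 + j))) w = p ∧
      Moves c (ρ p) (pairHom c w) := by
    clear hy hfix
    induction hp using Subgroup.closure_induction with
    | mem p hp =>
      obtain ⟨l, hl, rfl⟩ := hp
      rw [Set.mem_Iic] at hl
      exact ⟨FreeGroup.of l, FreeGroup.lift_apply_of, moves_conjSeq hρ (by omega)⟩
    | one => exact ⟨1, map_one _, by simpa using Moves.one c⟩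
    | mul p q hp hq ihp ihq =>
      obtain ⟨v, rfl, hv⟩ := ihp
      obtain ⟨w, rfl, hw⟩ := ihq
      exact ⟨v * w, map_mul _ _ _, by simpa only [map_mul] using hv.mul hw⟩
    | inv p hp ih =>
      obtain ⟨v, rfl, hv⟩ := ih
      exact ⟨v⁻¹, map_inv _ _, by simpa only [map_inv] using hv.inv⟩
  obtain ⟨w, rfl, -, u, hu, hu'⟩ := hp'
  rw [map_mul, map_mul, MulAut.mul_apply, MulAut.mul_apply, hg'.1, hu, map_mul, map_mul, map_inv,
    sweep_apply hρ hi] at hfix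
  have hi := eq_of_conj_x_eq hfix
  obtain rfl : i = 0 := by omega
  simp only [sweep, map_one, MulAut.one_apply, mul_zero, add_zero] at hfix
  rw [ret_eq_one_of_commute (mul_inv_eq_iff_eq_mul.1 hfix), one_mul] at hu'
  rw [eq_one_of_pairHom_eq_one hu']
  simpa [sweep] using hg

end IsBraidFamily

namespace InvGroup

/-- `shift^[k]` intertwines `φ` and `f`. -/
def Intertwines (k : ℕ) (φ f : MulAut InvGroup) : Prop :=
  ∀ g, shift^[k] (φ g) = f (shift^[k] g)

lemma Intertwines.mul {k : ℕ} {φ ψ f g : MulAut InvGroup} (h : Intertwines k φ f)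
    (h' : Intertwines k ψ g) : Intertwines k (φ * ψ) (f * g) := fun y => by
  rw [MulAut.mul_apply, h, h', MulAut.mul_apply]

lemma Intertwines.inv {k : ℕ} {φ f : MulAut InvGroup} (h : Intertwines k φ f) :
    Intertwines k φ⁻¹ f⁻¹ := fun y => by
  apply f.injective
  rw [← h, MulAut.apply_inv_self, MulAut.apply_inv_self]

lemma intertwines_cable (k a : ℕ) : Intertwines k (cable a) (cable (a + 2 * k)) := by
  induction k with
  | zero => intro g; rfl
  | succ k ih =>
    intro g
    rw [Function.iterate_succ_apply', ih, ← cable_shift, Function.iterate_succ_apply']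
    rfl

lemma shift_iterate_x (k i : ℕ) : shift^[k] (x i) = x (i + 2 * k) := by
  induction k with
  | zero => rfl
  | succ k ih => rw [Function.iterate_succ_apply', ih, shift_x]; rfl

lemma shift_iterate_mul (k : ℕ) (g h : InvGroup) :
    shift^[k] (g * h) = shift^[k] g * shift^[k] h :=
  iterate_map_mul shift k g h

end InvGroup

namespace IsBraidFamily

variable {G : Type*} [Group G] {s : ℕ → G} {N : ℕ} {ρ : G →* MulAut InvGroup}

/-- The subgroup generated by `s j` for `k ≤ j < N`. -/
def tail (s : ℕ → G) (N k : ℕ) : Subgroup G := Subgroup.closure (s '' Set.Ico k N)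

lemma tail_anti (s : ℕ → G) (N : ℕ) {k l : ℕ} (h : k ≤ l) : tail s N l ≤ tail s N k :=
  Subgroup.closure_mono (Set.image_mono (Set.Ico_subset_Ico_left h))

lemma tail_eq_closure (s : ℕ → G) (N k : ℕ) :
    tail s N k = Subgroup.closure ((fun j => s (k + j)) '' Set.Iio (N - k)) := by
  refine congrArg Subgroup.closure (Set.ext fun g => ⟨?_, ?_⟩)
  · rintro ⟨j, ⟨h₁, h₂⟩, rfl⟩
    exact ⟨j - k, Set.mem_Iio.2 (by omega), by
      change s (k + (j - k)) = s j; rw [Nat.add_sub_cancel' h₁]⟩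
  · rintro ⟨j, hj, rfl⟩
    rw [Set.mem_Iio] at hj
    exact ⟨k + j, ⟨by omega, by omega⟩, rfl⟩

lemma tail_self (s : ℕ → G) (N : ℕ) : tail s N N = ⊥ := by simp [tail]

lemma mem_tail_succ (h : IsBraidFamily s N) (hρ : ∀ j < N, ρ (s j) = cable (2 * j)) {k : ℕ}
    {y : G} (hy : y ∈ tail s N k) (hfix : ρ y (x (2 * k)) = x (2 * k)) : y ∈ tail s N (k + 1) := by
  rw [tail_eq_closure] at hy ⊢
  have := (h.shift k).mem_closure_of_apply_eq (c := 2 * k)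
    (fun j hj => by rw [hρ _ (by omega), Nat.mul_add]) hy hfix
  simpa only [Nat.add_assoc, Nat.sub_sub] using this

lemma apply_x_of_mem_tail (hρ : ∀ j < N, ρ (s j) = cable (2 * j)) {k l : ℕ} (hkl : k < l)
    {y : G} (hy : y ∈ tail s N l) : ρ y (x (2 * k)) = x (2 * k) := by
  induction hy using Subgroup.closure_induction with
  | mem y hy =>
    obtain ⟨j, ⟨h₁, h₂⟩, rfl⟩ := hy
    rw [hρ j h₂, cable_of_ne (by omega)]
  | one => simp
  | mul y z _ _ hy hz => rw [map_mul, MulAut.mul_apply, hz, hy]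
  | inv y _ hy => rw [map_inv, ← hy, MulAut.inv_apply_self, hy]

lemma map_mem_ascAut (hρ : ∀ j < N, ρ (s j) = cable (2 * j)) {k : ℕ} {y : G}
    (hy : y ∈ tail s N k) : ρ y ∈ ascAut := by
  have : tail s N k ≤ ascAut.comap ρ := by
    rw [tail, Subgroup.closure_le]
    rintro _ ⟨j, ⟨h₁, h₂⟩, rfl⟩
    change ρ (s j) ∈ ascAut
    rw [hρ j h₂]
    exact cable_mem_ascAut _
  exact this hy

/-- The displacement of the strand `k` under `f`. -/
def disp (k : ℕ) (f : MulAut InvGroup) : ℤ := InvGroup.s (x (2 * k) * f (x (2 * k)))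

lemma disp_inv {k : ℕ} {f : MulAut InvGroup} (hf : f ∈ ascAut) : disp k f⁻¹ = -disp k f := by
  rw [disp, disp, ← s_inv, ← (hf _).1, map_mul, MulAut.apply_inv_self, mul_inv_rev, ← map_inv,
    x_inv]

/-- The positive cone of the Dehornoy-like order. -/
def Pos (s : ℕ → G) (N : ℕ) (ρ : G →* MulAut InvGroup) (y : G) : Prop :=
  ∃ k, y ∈ tail s N k ∧ 0 < disp k (ρ y)

lemma not_pos_one : ¬ Pos s N ρ 1 := by
  rintro ⟨k, -, h⟩
  simp [disp] at h

lemma Pos.mul (hρ : ∀ j < N, ρ (s j) = cable (2 * j)) {y z : G} (hy : Pos s N ρ y)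
    (hz : Pos s N ρ z) : Pos s N ρ (y * z) := by
  obtain ⟨k, hy, hy'⟩ := hy
  obtain ⟨l, hz, hz'⟩ := hz
  rcases lt_trichotomy k l with h | rfl | h
  · refine ⟨k, mul_mem hy (tail_anti s N h.le hz), ?_⟩
    rwa [disp, map_mul, MulAut.mul_apply, apply_x_of_mem_tail hρ h hz]
  · refine ⟨k, mul_mem hy hz, ?_⟩
    rw [disp, ← (map_mem_ascAut hρ hy _).1] at hz'
    have := s_mul_pos hy' hz'
    rwa [map_mul, mul_assoc, ← mul_assoc (ρ y _), ← map_mul, x_mul_self, map_one, one_mul,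
      ← MulAut.mul_apply, ← map_mul] at this
  · refine ⟨l, mul_mem (tail_anti s N h.le hy) hz, ?_⟩
    rw [disp, ← (map_mem_ascAut hρ hy _).1, map_mul, apply_x_of_mem_tail hρ h hy] at hz'
    rwa [disp, map_mul, MulAut.mul_apply]

lemma pos_or_pos_inv (h : IsBraidFamily s N) (hρ : ∀ j < N, ρ (s j) = cable (2 * j)) {y : G}
    (hy : y ∈ tail s N 0) (h1 : y ≠ 1) : Pos s N ρ y ∨ Pos s N ρ y⁻¹ := by
  by_contra hne
  rw [not_or] at hne
  have : ∀ k ≤ N, y ∈ tail s N k := by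
    intro k hk
    induction k with
    | zero => exact hy
    | succ k ih =>
      have hk := ih (by omega)
      refine h.mem_tail_succ hρ hk ?_
      have h₁ : ¬ 0 < disp k (ρ y) := fun h => hne.1 ⟨k, hk, h⟩
      have h₂ : ¬ 0 < disp k (ρ y⁻¹) := fun h => hne.2 ⟨k, inv_mem hk, h⟩
      rw [map_inv, disp_inv (map_mem_ascAut hρ hk)] at h₂
      have := eq_one_of_s_eq_zero (g := x (2 * k) * ρ y (x (2 * k))) ?_ ?_
      · simpa using (inv_eq_of_mul_eq_one_right this).symm
      · rw [map_mul, (map_mem_ascAut hρ hk _).2, ← map_mul, x_mul_self, map_one]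
      · change disp k (ρ y) = 0
        omega
  have := this N le_rfl
  rw [tail_self, Subgroup.mem_bot] at this
  exact h1 this

lemma Pos.star_inv (hρ : ∀ j < N, ρ (s j) = cable (2 * j)) (star : G →* G)
    (hstar : ∀ j < N, star (s j) = (s j)⁻¹) {y : G} (hy : Pos s N ρ y) :
    Pos s N ρ (star y)⁻¹ := by
  obtain ⟨k, hy, hpos⟩ := hy
  have key : star y ∈ tail s N k ∧ ∃ φ, Intertwines k φ (ρ y) ∧
      Intertwines k (tau * φ * tau) (ρ (star y)) := by
    clear hpos
    induction hy using Subgroup.closure_induction with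
    | mem y hy =>
      obtain ⟨j, ⟨h₁, h₂⟩, rfl⟩ := hy
      rw [hstar j h₂]
      refine ⟨inv_mem (Subgroup.subset_closure ⟨j, ⟨h₁, h₂⟩, rfl⟩), cable (2 * (j - k)), ?_⟩
      have := intertwines_cable k (2 * (j - k))
      rw [← Nat.mul_add, Nat.sub_add_cancel h₁] at this
      rw [tau_cable_tau, map_inv, hρ j h₂]
      exact ⟨this, this.inv⟩
    | one =>
      rw [map_one, map_one]
      exact ⟨one_mem _, 1, fun _ => rfl, by rw [mul_one, tau_mul_tau]; exact fun _ => rfl⟩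
    | mul y z _ _ hy hz =>
      obtain ⟨hy, φ, h₁, h₂⟩ := hy
      obtain ⟨hz, ψ, h₃, h₄⟩ := hz
      rw [map_mul, map_mul, map_mul]
      refine ⟨mul_mem hy hz, φ * ψ, h₁.mul h₃, ?_⟩
      convert h₂.mul h₄ using 1
      simp only [mul_assoc]
      rw [← mul_assoc tau tau, tau_mul_tau, one_mul]
    | inv y _ hy =>
      obtain ⟨hy, φ, h₁, h₂⟩ := hy
      rw [map_inv, map_inv, map_inv]
      refine ⟨inv_mem hy, φ⁻¹, h₁.inv, ?_⟩
      convert h₂.inv using 1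
      simp only [mul_inv_rev, mul_assoc, inv_eq_of_mul_eq_one_left tau_mul_tau]
  obtain ⟨hmem, φ, h₁, h₂⟩ := key
  refine ⟨k, inv_mem hmem, ?_⟩
  have hx : x (2 * k) = InvGroup.shift^[k] (x 0) := by rw [shift_iterate_x, Nat.zero_add]
  have hdisp {φ f : MulAut InvGroup} (h : Intertwines k φ f) :
      disp k f = InvGroup.s (x 0 * φ (x 0)) := by
    rw [disp, hx, ← h, ← shift_iterate_mul, s_shift_iterate]
  have htau : tau (x 0) = x 0 := by simp
  have h₃ : (tau * φ * tau)⁻¹ = tau * φ⁻¹ * tau := by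
    simp only [mul_inv_rev, mul_assoc, inv_eq_of_mul_eq_one_left tau_mul_tau]
  have h₄ := hdisp h₂.inv
  rw [map_inv, h₄, h₃, MulAut.mul_apply, MulAut.mul_apply, htau]
  conv => enter [2, 1, 1]; rw [← htau]
  rw [← map_mul, s_tau, ← hdisp h₁.inv, disp_inv (map_mem_ascAut hρ hy), neg_neg]
  exact hpos

end IsBraidFamily

/-- The elements `s j` for `j < N` and `t` satisfy the Artin relations of type `D`, the element
`t` playing the same role as `s 0`. -/
structure IsDFamily {G : Type*} [Group G] (s : ℕ → G) (t : G) (N : ℕ) : Prop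
    extends IsBraidFamily s N where
  comm_right : ∀ j, j < N → j ≠ 1 → Commute (s j) t
  braid_right : 1 < N → s 1 * t * s 1 = t * s 1 * t

lemma IsBraidFamily.isDFamily {G : Type*} [Group G] {s : ℕ → G} {N : ℕ} (h : IsBraidFamily s N) :
    IsDFamily s (s 0) N where
  toIsBraidFamily := h
  comm_right j hj h1 := by
    rcases Nat.eq_zero_or_pos j with rfl | h0
    · exact Commute.refl _
    · exact (h.comm 0 j (by omega) hj).symm
  braid_right h1 := (h.braid 0 h1).symm

/-- The Artin group of type `D (N + 1)`. -/
abbrev ArtinD (N : ℕ) : Type := ArtinGroup (DTypeMatrix (N + 1))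

namespace ArtinD

variable {N : ℕ}

/-- The generators of the Artin group of type `D`, numbered from the forked end of the diagram. -/
def gen (N j : ℕ) : ArtinD N := artinGen (DTypeMatrix (N + 1)) ⟨N - 1 - j, by omega⟩

/-- The last generator of the Artin group of type `D`. -/
def lastGen (N : ℕ) : ArtinD N := artinGen (DTypeMatrix (N + 1)) ⟨N, by omega⟩

lemma artinGen_mul_eq (i j : Fin (N + 1)) (hij : i ≠ j)
    (h0 : DTypeMatrix (N + 1) i j ≠ 0) :
    FreeGroup.lift (artinGen (DTypeMatrix (N + 1)))
        (artinWord (DTypeMatrix (N + 1) i j) i j) =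
      FreeGroup.lift (artinGen (DTypeMatrix (N + 1)))
        (artinWord (DTypeMatrix (N + 1) i j) j i) := by
  have : FreeGroup.lift (artinGen (DTypeMatrix (N + 1))) =
      PresentedGroup.mk (artinRels (DTypeMatrix (N + 1))) := by
    ext; exact FreeGroup.lift_apply_of
  rw [this]
  exact PresentedGroup.mk_eq_mk_of_mul_inv_mem ⟨i, j, hij, h0, rfl⟩

lemma braid_of_eq_three {i j : Fin (N + 1)} (h : DTypeMatrix (N + 1) i j = 3) (hij : i ≠ j) :
    artinGen (DTypeMatrix (N + 1)) i * artinGen (DTypeMatrix (N + 1)) j *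
      artinGen (DTypeMatrix (N + 1)) i = artinGen (DTypeMatrix (N + 1)) j *
      artinGen (DTypeMatrix (N + 1)) i * artinGen (DTypeMatrix (N + 1)) j := by
  have := artinGen_mul_eq i j hij (by omega)
  simpa [h, artinWord, mul_assoc] using this

lemma commute_of_eq_two {i j : Fin (N + 1)} (h : DTypeMatrix (N + 1) i j = 2) (hij : i ≠ j) :
    Commute (artinGen (DTypeMatrix (N + 1)) i) (artinGen (DTypeMatrix (N + 1)) j) := by
  have := artinGen_mul_eq i j hij (by omega)
  rw [commute_iff_eq]
  simpa [h, artinWord, mul_assoc] using this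

lemma isDFamily (hN : 2 ≤ N) : IsDFamily (gen N) (lastGen N) N where
  comm i j hij hj := by
    have h : N - 1 - i ≠ N - 1 - j := by omega
    refine commute_of_eq_two ?_ (by simpa using h)
    simp only [DTypeMatrix, Fin.mk.injEq, h, if_false]
    rw [if_neg (by omega), if_neg (by omega)]
  braid i hi := by
    have h : N - 1 - i ≠ N - 1 - (i + 1) := by omega
    refine braid_of_eq_three ?_ (by simpa using h)
    simp only [DTypeMatrix, Fin.mk.injEq, h, if_false]
    rw [if_pos (by omega)]
  comm_right j hj h1 := by
    have h : N - 1 - j ≠ N := by omega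
    refine commute_of_eq_two ?_ (by simpa using h)
    simp only [DTypeMatrix, Fin.mk.injEq, h, if_false]
    rw [if_neg (by omega), if_neg (by omega)]
  braid_right h1 := by
    have h : N - 1 - 1 ≠ N := by omega
    refine braid_of_eq_three ?_ (by simpa using h)
    simp only [DTypeMatrix, Fin.mk.injEq, h, if_false]
    rw [if_neg (by omega), if_pos (by omega)]

lemma hom_ext {H : Type*} [Group H] {f g : ArtinD N →* H}
    (h : ∀ j < N, f (gen N j) = g (gen N j)) (h' : f (lastGen N) = g (lastGen N)) : f = g := by
  refine PresentedGroup.ext (rels := artinRels (DTypeMatrix (N + 1))) fun i => ?_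
  rcases Nat.lt_or_ge i N with hi | hi
  · have := h (N - 1 - i) (by omega)
    have hi' : (⟨N - 1 - (N - 1 - i), by omega⟩ : Fin (N + 1)) = i := by ext; simp; omega
    rwa [gen, hi'] at this
  · have hi' : (⟨N, by omega⟩ : Fin (N + 1)) = i := by ext; simp; omega
    rwa [lastGen, hi'] at h'

section lift

variable {H : Type*} [Group H] {s : ℕ → H} {t : H}

/-- The images of the Artin generators under the homomorphism `lift`. -/
def liftFun (s : ℕ → H) (t : H) (i : Fin (N + 1)) : H := if (i : ℕ) = N then t else s (N - 1 - i)

lemma lift_rels (hN : 2 ≤ N) (h : IsDFamily s t N) :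
    ∀ r ∈ artinRels (DTypeMatrix (N + 1)), FreeGroup.lift (liftFun s t) r = 1 := by
  rintro _ ⟨i, j, hij, -, rfl⟩
  rw [map_mul, map_inv, mul_inv_eq_one]
  have hij' : (i : ℕ) ≠ j := fun h => hij (Fin.ext h)
  have hi := i.2
  have hj := j.2
  have h₃ (hb : liftFun s t i * liftFun s t j * liftFun s t i =
      liftFun s t j * liftFun s t i * liftFun s t j) :
      FreeGroup.lift (liftFun s t) (artinWord 3 i j) =
        FreeGroup.lift (liftFun s t) (artinWord 3 j i) := by
    simpa [artinWord, mul_assoc] using hb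
  have h₂ (hb : Commute (liftFun s t i) (liftFun s t j)) :
      FreeGroup.lift (liftFun s t) (artinWord 2 i j) =
        FreeGroup.lift (liftFun s t) (artinWord 2 j i) := by
    simpa [artinWord, mul_assoc] using hb.eq
  unfold DTypeMatrix
  rw [if_neg hij]
  split_ifs with h₄ h₅
  · apply h₃
    unfold liftFun
    rw [if_neg (by omega), if_neg (by omega)]
    rcases h₄ with h₄ | h₄
    · have := h.braid (N - 1 - j) (by omega)
      rw [show N - 1 - j + 1 = N - 1 - i by omega] at this
      exact this.symm
    · have := h.braid (N - 1 - i) (by omega)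
      rwa [show N - 1 - i + 1 = N - 1 - j by omega] at this
  · apply h₃
    unfold liftFun
    rcases h₅ with h₅ | h₅
    · rw [if_neg (by omega), if_pos (by omega), show N - 1 - i = 1 by omega]
      exact h.braid_right (by omega)
    · rw [if_pos (by omega), if_neg (by omega), show N - 1 - j = 1 by omega]
      exact (h.braid_right (by omega)).symm
  · apply h₂
    unfold liftFun
    split_ifs with h₆ h₇ h₇
    · omega
    · exact (h.comm_right _ (by omega) (by omega)).symm
    · exact h.comm_right _ (by omega) (by omega)
    · rcases lt_or_gt_of_ne hij' with h₈ | h₈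
      · exact (h.comm _ _ (by omega) (by omega)).symm
      · exact h.comm _ _ (by omega) (by omega)

/-- The universal property of the Artin group of type `D`. -/
def lift (hN : 2 ≤ N) (h : IsDFamily s t N) : ArtinD N →* H :=
  PresentedGroup.toGroup (lift_rels hN h)

lemma lift_gen (hN : 2 ≤ N) (h : IsDFamily s t N) {j : ℕ} (hj : j < N) :
    lift hN h (gen N j) = s j := by
  refine (PresentedGroup.toGroup.of (lift_rels hN h)).trans ?_
  simp only [liftFun]
  rw [if_neg (by omega), show N - 1 - (N - 1 - j) = j by omega]

lemma lift_lastGen (hN : 2 ≤ N) (h : IsDFamily s t N) : lift hN h (lastGen N) = t := by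
  refine (PresentedGroup.toGroup.of (lift_rels hN h)).trans ?_
  simp [liftFun]

end lift

end ArtinD

lemma exists_leftInvariant_order {G : Type*} [Group G] (P : G → Prop) (one : ¬ P 1)
    (mul : ∀ x y, P x → P y → P (x * y)) (total : ∀ x, x ≠ 1 → P x ∨ P x⁻¹) :
    ∃ lo : LinearOrder G, (∀ a x y : G, lo.lt x y → lo.lt (a * x) (a * y)) ∧
      ∀ x, lo.lt 1 x ↔ P x := by
  classical
  have asymm : ∀ x, P x → ¬ P x⁻¹ := fun x h h' => one (by simpa using mul _ _ h h')
  have symm (x y : G) : (x⁻¹ * y)⁻¹ = y⁻¹ * x := by group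
  let lo : LinearOrder G :=
    { le := fun x y => x = y ∨ P (x⁻¹ * y)
      lt := fun x y => P (x⁻¹ * y)
      le_refl := fun x => .inl rfl
      le_trans := by
        rintro x y z (rfl | h) (rfl | h')
        · exact .inl rfl
        · exact .inr h'
        · exact .inr h
        · exact .inr (by simpa [mul_assoc] using mul _ _ h h')
      lt_iff_le_not_ge := fun x y => by
        constructor
        · intro h
          refine ⟨.inr h, ?_⟩
          rintro (rfl | h')
          · exact one (by simpa using h)
          · exact asymm _ h (by rwa [symm])
        · rintro ⟨rfl | h, h'⟩
          · exact absurd (.inl rfl) h'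
          · exact h
      le_antisymm := by
        rintro x y (h | h) (h' | h')
        · exact h
        · exact h
        · exact h'.symm
        · exact absurd (by rwa [symm]) (asymm _ h)
      le_total := fun x y => by
        by_cases h : x = y
        · exact .inl (.inl h)
        rcases total (x⁻¹ * y) (by rwa [Ne, inv_mul_eq_one]) with h | h
        · exact .inl (.inr h)
        · exact .inr (.inr (by rwa [symm] at h))
      toDecidableLE := Classical.decRel _ }
  refine ⟨lo, fun a x y h => ?_, fun x => ?_⟩
  · change P ((a * x)⁻¹ * (a * y))
    have h : P (x⁻¹ * y) := h
    simpa [mul_assoc] using h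
  · change P (1⁻¹ * x) ↔ _
    simp

namespace ArtinD

variable {N : ℕ} (hN : 2 ≤ N)

lemma isBraidFamily_cable (N : ℕ) : IsBraidFamily (fun j => cable (2 * j)) N where
  comm i j h _ := cable_comm (by omega)
  braid i _ := cable_braid (2 * i)

lemma isBraidFamily_sigma (N : ℕ) : IsBraidFamily sigma N where
  comm _ _ h _ := sigma_comm h
  braid i _ := sigma_braid i

/-- The endomorphism folding the two ends of the fork. -/
def fold : ArtinD N →* ArtinD N := lift hN (isDFamily hN).isDFamily

/-- The action on `InvGroup` in which each strand is doubled. -/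
def cableHom : ArtinD N →* MulAut InvGroup := lift hN (isBraidFamily_cable N).isDFamily

/-- The action on `InvGroup` through the braid group. -/
def sigmaHom : ArtinD N →* MulAut InvGroup := lift hN (isBraidFamily_sigma N).isDFamily

lemma sigmaHom_fold (y : ArtinD N) : sigmaHom hN (fold hN y) = sigmaHom hN y := by
  have : (sigmaHom hN).comp (fold hN) = sigmaHom hN := by
    refine hom_ext (fun j hj => ?_) ?_
    · simp [fold, lift_gen _ _ hj]
    · simp [fold, sigmaHom, lift_gen hN _ (show 0 < N by omega), lift_lastGen]
  exact DFunLike.congr_fun this y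

lemma mem_of_gen_mem (S : Subgroup (ArtinD N)) (gen : ∀ j < N, gen N j ∈ S)
    (lastGen : lastGen N ∈ S) (y : ArtinD N) : y ∈ S := by
  have : Subgroup.closure (Set.range (artinGen (DTypeMatrix (N + 1)))) ≤ S := by
    rw [Subgroup.closure_le]
    rintro _ ⟨i, rfl⟩
    rcases Nat.lt_or_ge i N with hi | hi
    · have := gen (N - 1 - i) (by omega)
      have hi' : (⟨N - 1 - (N - 1 - i), by omega⟩ : Fin (N + 1)) = i := by ext; simp; omega
      rwa [ArtinD.gen, hi'] at this
    · have hi' : (⟨N, by omega⟩ : Fin (N + 1)) = i := by ext; simp; omega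
      rwa [ArtinD.lastGen, hi'] at lastGen
  refine this ?_
  have := PresentedGroup.closure_range_of (artinRels (DTypeMatrix (N + 1)))
  exact this.symm ▸ Subgroup.mem_top y

lemma fold_mem_tail (y : ArtinD N) : fold hN y ∈ IsBraidFamily.tail (gen N) N 0 := by
  refine mem_of_gen_mem ((IsBraidFamily.tail (gen N) N 0).comap (fold hN)) (fun j hj => ?_) ?_ y
  · rw [Subgroup.mem_comap, fold, lift_gen _ _ hj]
    exact Subgroup.subset_closure ⟨j, ⟨by omega, hj⟩, rfl⟩
  · rw [Subgroup.mem_comap, fold, lift_lastGen]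
    exact Subgroup.subset_closure ⟨0, ⟨le_rfl, by omega⟩, rfl⟩

lemma sigmaHom_mem_ascAut (y : ArtinD N) : sigmaHom hN y ∈ ascAut := by
  refine mem_of_gen_mem (ascAut.comap (sigmaHom hN)) (fun j hj => ?_) ?_ y
  · rw [Subgroup.mem_comap, sigmaHom, lift_gen _ _ hj]
    exact sigma_mem_ascAut _
  · rw [Subgroup.mem_comap, sigmaHom, lift_lastGen]
    exact sigma_mem_ascAut _

lemma isDFamily_semidirect : IsDFamily
    (fun j => (⟨1, gen N j⟩ : InvGroup ⋊[sigmaHom hN] ArtinD N)) ⟨x 1 * x 0, gen N 0⟩ N := by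
  have hσ : ∀ j < N, sigmaHom hN (gen N j) = sigma j := fun j hj => lift_gen _ _ hj
  have hD := isDFamily hN
  have h₀ : sigma 0 (x 1) = x 0 := sigma_succ 0
  have h₁ : sigma 0 (x 0) = x 0 * x 1 * x 0 := sigma_self 0
  have h₂ : sigma 0 (x 2) = x 2 := sigma_of_ne (by omega) (by omega)
  have h₃ : sigma 1 (x 0) = x 0 := sigma_of_ne (by omega) (by omega)
  have h₄ : sigma 1 (x 1) = x 1 * x 2 * x 1 := sigma_self 1
  refine { comm := fun i j hij hj => ?_, braid := fun i hi => ?_, comm_right := fun j hj h1 => ?_,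
           braid_right := fun h1 => ?_ }
  · refine SemidirectProduct.ext (by simp) ?_
    exact (hD.comm i j hij hj).eq
  · refine SemidirectProduct.ext (by simp) ?_
    exact hD.braid i hi
  · refine SemidirectProduct.ext ?_ ?_
    · simp only [SemidirectProduct.mul_left, hσ j hj, hσ 0 (by omega), map_one, mul_one, one_mul]
      rcases Nat.eq_zero_or_pos j with rfl | h0
      · simp [h₀, h₁, mul_assoc]
      · rw [map_mul, sigma_of_ne (by omega) (by omega), sigma_of_ne (by omega) (by omega)]
    · exact (hD.isDFamily.comm_right j hj h1).eq
  · refine SemidirectProduct.ext ?_ ?_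
    · simp [hσ 0 (by omega), hσ 1 h1, h₀, h₁, h₂, h₃, h₄, mul_assoc]
    · exact hD.isDFamily.braid_right h1

/-- The map to the semidirect product of `InvGroup` and the braid group. -/
def splitHom : ArtinD N →* InvGroup ⋊[sigmaHom hN] ArtinD N := lift hN (isDFamily_semidirect hN)

/-- The component in `InvGroup` of `splitHom`. -/
def coord (y : ArtinD N) : InvGroup := (splitHom hN y).left

lemma splitHom_right (y : ArtinD N) : (splitHom hN y).right = fold hN y := by
  have : SemidirectProduct.rightHom.comp (splitHom hN) = fold hN := by
    refine hom_ext (fun j hj => ?_) ?_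
    · simp [splitHom, fold, lift_gen hN _ hj]
    · simp [splitHom, fold, lift_lastGen]
  exact DFunLike.congr_fun this y

lemma coord_mul (y z : ArtinD N) : coord hN (y * z) = coord hN y * sigmaHom hN y (coord hN z) := by
  rw [coord, map_mul, SemidirectProduct.mul_left, splitHom_right, sigmaHom_fold]
  rfl

lemma coord_mul_of_fold_eq_one {y : ArtinD N} (hy : fold hN y = 1) (z : ArtinD N) :
    coord hN (y * z) = coord hN y * coord hN z := by
  rw [coord_mul, ← sigmaHom_fold, hy, map_one, MulAut.one_apply]

lemma coord_one : coord hN 1 = 1 := by simp [coord]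

lemma coord_inv_of_fold_eq_one {y : ArtinD N} (hy : fold hN y = 1) :
    coord hN y⁻¹ = (coord hN y)⁻¹ := by
  rw [eq_inv_iff_mul_eq_one, ← coord_mul_of_fold_eq_one hN (by rw [map_inv, hy, inv_one]),
    inv_mul_cancel, coord_one]

lemma parity_coord (y : ArtinD N) : parity (coord hN y) = 1 := by
  have : ∀ y, parity ((splitHom hN y).left) = 1 := by
    let S : Subgroup (ArtinD N) := ((SemidirectProduct.lift (φ := sigmaHom hN) parity 1
      fun g => by
        refine MonoidHom.ext fun v => ?_
        simpa using (sigmaHom_mem_ascAut hN g v).2).comp (splitHom hN)).ker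
    intro y
    have := mem_of_gen_mem S (fun j hj => ?_) ?_ y
    · simpa [S, SemidirectProduct.lift] using this
    · simp [S, splitHom, lift_gen hN _ hj]
    · simp [S, splitHom, lift_lastGen, parity]
  exact this y

section star

variable (star : ArtinD N →* ArtinD N)

lemma fold_star (hstar : ∀ j < N, star (gen N j) = (gen N j)⁻¹)
    (hstar' : star (lastGen N) = (lastGen N)⁻¹) (y : ArtinD N) :
    fold hN (star y) = star (fold hN y) := by
  have : (fold hN).comp star = star.comp (fold hN) := by
    refine hom_ext (fun j hj => ?_) ?_
    · simp [fold, lift_gen hN _ hj, hstar j hj]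
    · simp [fold, lift_lastGen, hstar 0 (by omega), hstar']
  exact DFunLike.congr_fun this y

lemma tau_sigmaHom (hstar : ∀ j < N, star (gen N j) = (gen N j)⁻¹)
    (hstar' : star (lastGen N) = (lastGen N)⁻¹) (y : ArtinD N) :
    sigmaHom hN (star y) = tau * sigmaHom hN y * tau := by
  have hinv : tau⁻¹ = tau := inv_eq_of_mul_eq_one_left tau_mul_tau
  have : (sigmaHom hN).comp star = (MulAut.conj tau).toMonoidHom.comp (sigmaHom hN) := by
    refine hom_ext (fun j hj => ?_) ?_
    · simp [sigmaHom, lift_gen hN _ hj, hstar j hj, hinv, tau_sigma_tau]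
    · simp [sigmaHom, lift_lastGen, hstar', hinv, tau_sigma_tau]
  have := DFunLike.congr_fun this y
  simpa [hinv] using this

lemma coord_star (hstar : ∀ j < N, star (gen N j) = (gen N j)⁻¹)
    (hstar' : star (lastGen N) = (lastGen N)⁻¹) (y : ArtinD N) :
    coord hN (star y) = tau (coord hN y) := by
  let f : InvGroup ⋊[sigmaHom hN] ArtinD N →* InvGroup ⋊[sigmaHom hN] ArtinD N :=
    SemidirectProduct.map tau.toMonoidHom star fun g => by
      rw [tau_sigmaHom hN star hstar hstar']
      ext v
      simp
  have : (splitHom hN).comp star = f.comp (splitHom hN) := by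
    refine hom_ext (fun j hj => ?_) ?_
    · refine SemidirectProduct.ext ?_ ?_
      · simp [splitHom, lift_gen hN _ hj, hstar j hj, f]
      · simp [splitHom, lift_gen hN _ hj, hstar j hj, f]
    · have h₀ : (sigma 0).symm (x 0) = x 1 := by
        rw [MulEquiv.symm_apply_eq]
        exact (sigma_succ 0).symm
      have h₁ : (sigma 0).symm (x 1) = x 1 * x 0 * x 1 := by
        have h := sigma_succ 0
        rw [Nat.zero_add] at h
        simp [MulEquiv.symm_apply_eq, h, mul_assoc]
      have h₂ : sigmaHom hN (gen N 0) = sigma 0 := lift_gen _ _ (by omega)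
      refine SemidirectProduct.ext ?_ ?_
      · simp [splitHom, lift_lastGen, hstar', f, h₀, h₁, h₂, base_succ, mul_assoc]
      · simp [splitHom, lift_lastGen, hstar', f, hstar 0 (by omega)]
  have := congrArg (fun z => z.left) (DFunLike.congr_fun this y)
  exact this

end star

/-- The images of the generators under `swapHom`. -/
def swapFun (N j : ℕ) : ArtinD N := if j = 0 then lastGen N else gen N j

lemma isDFamily_swapFun (hN : 2 ≤ N) : IsDFamily (swapFun N) (gen N 0) N := by
  have h := isDFamily hN
  refine { comm := fun i j hij hj => ?_, braid := fun i hi => ?_, comm_right := fun j hj h1 => ?_,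
           braid_right := fun h1 => ?_ }
  · rw [swapFun, swapFun, if_neg (show j ≠ 0 by omega)]
    split_ifs
    · exact (h.comm_right j hj (by omega)).symm
    · exact h.comm i j hij hj
  · rw [swapFun, swapFun, if_neg (show i + 1 ≠ 0 by omega)]
    split_ifs with h0
    · subst h0
      exact (h.braid_right hi).symm
    · exact h.braid i hi
  · rw [swapFun]
    split_ifs with h0
    · exact (h.comm_right 0 (by omega) (by omega)).symm
    · exact (h.comm 0 j (by omega) hj).symm
  · exact (h.braid 0 h1).symm

/-- The automorphism swapping the two ends of the fork. -/
def swapHom : ArtinD N →* ArtinD N := lift hN (isDFamily_swapFun hN)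

lemma swapHom_gen {j : ℕ} (h0 : 0 < j) (hj : j < N) : swapHom hN (gen N j) = gen N j := by
  rw [swapHom, lift_gen _ _ hj, swapFun, if_neg h0.ne']

lemma swapHom_gen_zero : swapHom hN (gen N 0) = lastGen N := by
  rw [swapHom, lift_gen _ _ (by omega), swapFun, if_pos rfl]

lemma swapHom_lastGen : swapHom hN (lastGen N) = gen N 0 := lift_lastGen _ _

lemma swapHom_swapHom (y : ArtinD N) : swapHom hN (swapHom hN y) = y := by
  have : (swapHom hN).comp (swapHom hN) = MonoidHom.id _ := by
    refine hom_ext (fun j hj => ?_) ?_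
    · rcases Nat.eq_zero_or_pos j with rfl | h0
      · simp [swapHom_gen_zero, swapHom_lastGen]
      · simp [swapHom_gen hN h0 hj]
    · simp [swapHom_gen_zero, swapHom_lastGen]
  exact DFunLike.congr_fun this y

/-- The automorphism swapping the two ends of the fork, as a permutation. -/
def swapPerm : Equiv.Perm (ArtinD N) :=
  ⟨swapHom hN, swapHom hN, swapHom_swapHom hN, swapHom_swapHom hN⟩

lemma swapPerm_mul_self : swapPerm hN * swapPerm hN = 1 := Equiv.ext (swapHom_swapHom hN)

/-- The action of the Artin group on itself by left multiplication. -/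
abbrev leftMul (N : ℕ) : ArtinD N →* Equiv.Perm (ArtinD N) := MulAction.toPermHom _ _

lemma swapPerm_mul_leftMul (y : ArtinD N) :
    swapPerm hN * leftMul N y = leftMul N (swapHom hN y) * swapPerm hN :=
  Equiv.ext fun z => map_mul (swapHom hN) y z

/-- The images of the generators under `reflHom`. -/
abbrev reflSeq : ℕ → Equiv.Perm (ArtinD N) := conjSeq (swapPerm hN) fun j => leftMul N (gen N j)

lemma reflSeq_mul_self (l : ℕ) : reflSeq hN l * reflSeq hN l = 1 := by
  induction l with
  | zero => exact swapPerm_mul_self hN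
  | succ l ih =>
    rw [reflSeq, conjSeq]
    simp only [mul_assoc, mul_inv_cancel_left]
    rw [← mul_assoc (conjSeq _ _ l), ih, one_mul, inv_mul_cancel]

/-- The action of `InvGroup` on the Artin group by conjugates of the swap. -/
noncomputable def reflHom : InvGroup →* Equiv.Perm (ArtinD N) :=
  InvGroup.lift (fun l => if l ≤ N then reflSeq hN l else 1) fun l => by
    split_ifs
    · exact reflSeq_mul_self hN l
    · exact mul_one 1

lemma reflHom_x_of_le {l : ℕ} (hl : l ≤ N) : reflHom hN (x l) = reflSeq hN l := by
  simp [reflHom, hl]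

lemma reflHom_x_of_lt {l : ℕ} (hl : N < l) : reflHom hN (x l) = 1 := by
  simp [reflHom, Nat.not_le.2 hl]

lemma commute_swapPerm (j : ℕ) (h0 : 0 < j) (hj : j < N) :
    Commute (leftMul N (gen N j)) (swapPerm hN) := by
  have := swapPerm_mul_leftMul hN (gen N j)
  rw [swapHom_gen hN h0 hj] at this
  exact this.symm

lemma leftMul_gen_zero_conj (_ : 0 < N) : leftMul N (gen N 0) * swapPerm hN *
    (leftMul N (gen N 0))⁻¹ = swapPerm hN * ((leftMul N (gen N 0))⁻¹ * swapPerm hN *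
      leftMul N (gen N 0)) * (swapPerm hN)⁻¹ := by
  have h₁ := swapPerm_mul_leftMul hN (gen N 0)
  have h₂ := swapPerm_mul_leftMul hN (lastGen N)
  have h₃ := (((isDFamily hN).comm_right 0 (by omega) (by omega)).map (leftMul N)).eq
  have h₄ := swapPerm_mul_self hN
  rw [swapHom_gen_zero] at h₁
  rw [swapHom_lastGen] at h₂
  generalize leftMul N (gen N 0) = a at *
  generalize leftMul N (lastGen N) = b at *
  generalize swapPerm hN = d at *
  have h₅ : d⁻¹ = d := inv_eq_of_mul_eq_one_left h₄
  have h₆ : d * a⁻¹ = b⁻¹ * d := by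
    rw [mul_inv_eq_iff_eq_mul, mul_assoc, h₁, inv_mul_cancel_left]
  have h₇ : a * b⁻¹ = b⁻¹ * a := by
    rw [mul_inv_eq_iff_eq_mul, mul_assoc, h₃, inv_mul_cancel_left]
  calc a * d * a⁻¹ = a * b⁻¹ * d := by rw [mul_assoc, h₆, mul_assoc]
    _ = b⁻¹ * (d * d) * a * d := by rw [h₇, h₄, mul_one]
    _ = _ := by rw [← mul_assoc, ← h₆, h₅]; simp only [← mul_assoc, h₆]

lemma reflHom_sigmaHom (g : ArtinD N) (v : InvGroup) : reflHom hN (sigmaHom hN g v) =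
    leftMul N (fold hN g) * reflHom hN v * (leftMul N (fold hN g))⁻¹ := by
  have key (j : ℕ) (hj : j < N) (v : InvGroup) : reflHom hN (sigma j v) =
      leftMul N (gen N j) * reflHom hN v * (leftMul N (gen N j))⁻¹ := by
    have hB := ((isDFamily hN).toIsBraidFamily).map (leftMul N)
    have : (reflHom hN).comp (sigma j).toMonoidHom =
        (MulAut.conj (leftMul N (gen N j))).toMonoidHom.comp (reflHom hN) := by
      refine InvGroup.hom_ext fun l => ?_
      change reflHom hN (sigma j (x l)) = leftMul N (gen N j) * reflHom hN (x l) *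
        (leftMul N (gen N j))⁻¹
      by_cases h₁ : l = j
      · subst h₁
        rw [sigma_self, map_mul, map_mul, reflHom_x_of_le hN hj.le, reflHom_x_of_le hN hj]
        have := hB.conj_conjSeq_self (commute_swapPerm hN) (leftMul_gen_zero_conj hN) hj
        rw [this, inv_eq_of_mul_eq_one_left (reflSeq_mul_self hN l)]
      by_cases h₂ : l = j + 1
      · subst h₂
        rw [sigma_succ, reflHom_x_of_le hN hj.le, reflHom_x_of_le hN hj]
        exact (IsBraidFamily.conj_conjSeq_succ (s := fun j => leftMul N (gen N j)) j).symm
      rw [sigma_of_ne h₁ h₂, eq_mul_inv_iff_mul_eq]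
      rcases Nat.lt_or_ge N l with h₃ | h₃
      · rw [reflHom_x_of_lt hN h₃, one_mul, mul_one]
      rw [reflHom_x_of_le hN h₃]
      rcases Nat.lt_or_ge l j with h₄ | h₄
      · exact (hB.commute_conjSeq_of_lt (commute_swapPerm hN) h₄ hj).eq.symm
      · exact (hB.commute_conjSeq_of_gt (commute_swapPerm hN) (by omega) h₃).eq.symm
    exact DFunLike.congr_fun this v
  let S : Subgroup (ArtinD N) :=
    { carrier := {g | ∀ v, reflHom hN (sigmaHom hN g v) =
        leftMul N (fold hN g) * reflHom hN v * (leftMul N (fold hN g))⁻¹}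
      one_mem' := fun v => by
        rw [map_one, map_one, map_one, MulAut.one_apply, inv_one, mul_one, one_mul]
      mul_mem' := fun {a b} ha hb v => by
        rw [map_mul, MulAut.mul_apply, ha, hb, map_mul, map_mul]
        group
      inv_mem' := fun {a} ha v => by
        have := ha (sigmaHom hN a⁻¹ v)
        rw [map_inv, MulAut.apply_inv_self] at this
        rw [map_inv (fold hN), map_inv (leftMul N), map_inv, this]
        group }
  refine mem_of_gen_mem S (fun j hj v => ?_) (fun v => ?_) g v
  · rw [sigmaHom, lift_gen _ _ hj, fold, lift_gen _ _ hj, key j hj]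
  · rw [sigmaHom, lift_lastGen, fold, lift_lastGen, key 0 (by omega)]

lemma fold_fold (y : ArtinD N) : fold hN (fold hN y) = fold hN y := by
  have : (fold hN).comp (fold hN) = fold hN := by
    refine hom_ext (fun j hj => ?_) ?_
    · simp [fold, lift_gen _ _ hj]
    · simp [fold, lift_lastGen, lift_gen _ _ (show 0 < N by omega)]
  exact DFunLike.congr_fun this y

lemma leftMul_eq (y : ArtinD N) :
    leftMul N y = reflHom hN (coord hN y) * leftMul N (fold hN y) := by
  let f := SemidirectProduct.lift (φ := sigmaHom hN) (reflHom hN)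
    ((leftMul N).comp (fold hN)) fun g => MonoidHom.ext fun v => reflHom_sigmaHom hN g v
  have : f.comp (splitHom hN) = leftMul N := by
    refine hom_ext (fun j hj => ?_) ?_
    · rw [MonoidHom.comp_apply, splitHom, lift_gen _ _ hj]
      change reflHom hN 1 * leftMul N (fold hN (gen N j)) = _
      rw [map_one, one_mul, fold, lift_gen _ _ hj]
    · rw [MonoidHom.comp_apply, splitHom, lift_lastGen]
      change reflHom hN (x 1 * x 0) * leftMul N (fold hN (gen N 0)) = _
      rw [map_mul, reflHom_x_of_le hN (by omega), reflHom_x_of_le hN (by omega), fold,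
        lift_gen _ _ (by omega)]
      have h₁ := swapPerm_mul_leftMul hN (gen N 0)
      have h₂ := swapPerm_mul_leftMul hN (lastGen N)
      have h₃ := (((isDFamily hN).comm_right 0 (by omega) (by omega)).map (leftMul N)).eq
      have h₄ := swapPerm_mul_self hN
      rw [swapHom_gen_zero] at h₁
      rw [swapHom_lastGen] at h₂
      change (leftMul N (gen N 0))⁻¹ * swapPerm hN * leftMul N (gen N 0) * swapPerm hN *
        leftMul N (gen N 0) = _
      generalize leftMul N (gen N 0) = a at *
      generalize leftMul N (lastGen N) = b at *
      generalize swapPerm hN = d at *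
      calc a⁻¹ * d * a * d * a = a⁻¹ * d * (a * b) * d := by
            rw [mul_assoc (a⁻¹ * d * a) d a, h₁]; simp only [mul_assoc]
        _ = a⁻¹ * (d * b) * a * d := by rw [h₃]; simp only [mul_assoc]
        _ = b * (d * d) := by rw [h₂, inv_mul_cancel_left, h₁, mul_assoc]
        _ = b := by rw [h₄, mul_one]
  have := DFunLike.congr_fun this y
  rw [← this, ← fold_fold, ← splitHom_right hN y]
  rfl

lemma eq_one_of_fold_of_coord {y : ArtinD N} (h₁ : fold hN y = 1) (h₂ : coord hN y = 1) :
    y = 1 := by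
  have := congrArg (fun f => f 1) (leftMul_eq hN y)
  simpa [h₁, h₂] using this

/-- The positive cone of the order on the Artin group of type `D`. -/
def Pos (y : ArtinD N) : Prop :=
  IsBraidFamily.Pos (gen N) N (cableHom hN) (fold hN y) ∨
    (fold hN y = 1 ∧ 0 < InvGroup.s (coord hN y))

lemma cableHom_gen (j : ℕ) (hj : j < N) : cableHom hN (gen N j) = cable (2 * j) := lift_gen _ _ hj

lemma Pos.mul {y z : ArtinD N} (hy : Pos hN y) (hz : Pos hN z) : Pos hN (y * z) := by
  rcases hy with hy | ⟨hy, hy'⟩ <;> rcases hz with hz | ⟨hz, hz'⟩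
  · exact .inl (by rw [map_mul]; exact hy.mul (cableHom_gen hN) hz)
  · exact .inl (by rwa [map_mul, hz, mul_one])
  · exact .inl (by rwa [map_mul, hy, one_mul])
  · exact .inr ⟨by rw [map_mul, hy, hz, one_mul], by
      rw [coord_mul_of_fold_eq_one hN hy]; exact s_mul_pos hy' hz'⟩

lemma not_pos_one : ¬ Pos hN 1 := by
  rintro (h | ⟨-, h⟩)
  · rw [map_one] at h
    exact IsBraidFamily.not_pos_one h
  · rw [coord_one, s_one] at h
    exact lt_irrefl _ h

lemma pos_or_pos_inv {y : ArtinD N} (hy : y ≠ 1) : Pos hN y ∨ Pos hN y⁻¹ := by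
  by_cases h : fold hN y = 1
  · have hs : InvGroup.s (coord hN y) ≠ 0 := fun hs =>
      hy (eq_one_of_fold_of_coord hN h (eq_one_of_s_eq_zero (parity_coord hN y) hs))
    rcases lt_or_gt_of_ne hs with hs | hs
    · refine .inr (.inr ⟨by rw [map_inv, h, inv_one], ?_⟩)
      rw [coord_inv_of_fold_eq_one hN h, s_inv]
      omega
    · exact .inl (.inr ⟨h, hs⟩)
  · refine ((isDFamily hN).pos_or_pos_inv (cableHom_gen hN) (fold_mem_tail hN y) h).imp .inl ?_
    intro h
    exact .inl (by rwa [map_inv])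

lemma Pos.star_inv (star : ArtinD N →* ArtinD N) (hstar : ∀ j < N, star (gen N j) = (gen N j)⁻¹)
    (hstar' : star (lastGen N) = (lastGen N)⁻¹) {y : ArtinD N} (hy : Pos hN y) :
    Pos hN (star y)⁻¹ := by
  rcases hy with hy | ⟨hy, hs⟩
  · refine .inl ?_
    rw [map_inv, fold_star hN star hstar hstar']
    exact hy.star_inv (cableHom_gen hN) star hstar
  · have h : fold hN (star y) = 1 := by rw [fold_star hN star hstar hstar', hy, map_one]
    refine .inr ⟨by rw [map_inv, h, inv_one], ?_⟩
    rwa [coord_inv_of_fold_eq_one hN h, coord_star hN star hstar hstar', s_inv, s_tau, neg_neg]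

end ArtinD

/-- For every `n ≥ 4`, the Artin group of type `D n` admits a left-invariant
linear order `<` such that `x > 1` iff `rev x > 1`, where `rev` is the (unique) involutive
anti-automorphism fixing each Artin generator. -/
theorem artinD_exists_leftInvariant_order_compatible_with_rev
    (n : ℕ) (hn : 4 ≤ n)
    (rev : ArtinGroup (DTypeMatrix n) → ArtinGroup (DTypeMatrix n))
    (hmul : ∀ x y, rev (x * y) = rev y * rev x)
    (hinv : ∀ x, rev (rev x) = x)
    (hgen : ∀ i : Fin n, rev (artinGen (DTypeMatrix n) i) = artinGen (DTypeMatrix n) i) :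
    ∃ lo : LinearOrder (ArtinGroup (DTypeMatrix n)),
      (∀ a x y : ArtinGroup (DTypeMatrix n), lo.lt x y → lo.lt (a * x) (a * y)) ∧
      (∀ x : ArtinGroup (DTypeMatrix n), lo.lt 1 x ↔ lo.lt 1 (rev x)) := by
  obtain ⟨N, rfl⟩ : ∃ N, n = N + 1 := ⟨n - 1, by omega⟩
  have hN : 2 ≤ N := by omega
  let star : ArtinD N →* ArtinD N :=
    MonoidHom.mk' (fun x => (rev x)⁻¹) fun x y => by rw [hmul, mul_inv_rev]
  have hrev (x : ArtinD N) (hx : ArtinD.Pos hN x) : ArtinD.Pos hN (rev x) := by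
    have := hx.star_inv hN star (fun j _ => congrArg _ (hgen _)) (congrArg _ (hgen _))
    rwa [show star x = (rev x)⁻¹ from rfl, inv_inv] at this
  obtain ⟨lo, h₁, h₂⟩ := exists_leftInvariant_order (ArtinD.Pos hN) (ArtinD.not_pos_one hN)
    (fun _ _ => ArtinD.Pos.mul hN) (fun _ => ArtinD.pos_or_pos_inv hN)
  refine ⟨lo, h₁, fun x => ?_⟩
  rw [h₂, h₂]
  exact ⟨hrev x, fun h => hinv x ▸ hrev (rev x) h⟩
end
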